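/- Let G₀ ∈ C₀^∞(ℝ) (smooth, compactly supported). Then there exists a unique admissible solution ψ : ℝ² → ℂ of the boundary-inflection inner problem such that ‖ψ(·,t) − ψ₀⁺(·,t)‖_{L²(0,+∞)} → 0 as t → +∞, where ψ₀⁺ is the searchlight ansatz built from G₀. -/

import Mathlib

open MeasureTheory Filter Set Function

noncomputable section

/-- Partial derivative in the first variable. -/
def pdX (f : ℝ → ℝ → ℂ) : ℝ → ℝ → ℂ := fun x t => deriv (fun y => f y t) x

/-- Partial derivative in the second variable. -/
def pdT (f : ℝ → ℝ → ℂ) : ℝ → ℝ → ℂ := fun x t => deriv (fun s => f x s) t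

/-- L² norm over the half-line (0,∞). -/
def L2h (f : ℝ → ℂ) : ℝ := Real.sqrt (∫ x in Set.Ioi (0:ℝ), ‖f x‖^2)

/-- L² norm over ℝ. -/
def L2R (f : ℝ → ℂ) : ℝ := Real.sqrt (∫ x : ℝ, ‖f x‖^2)

/-- An admissible solution of the boundary-inflection inner problem:
infinitely smooth on the closed half-plane {x ≥ 0}, satisfying the Schrödinger-type
equation i ψ_t = -(1/2) ψ_xx - x t ψ for x > 0, the Dirichlet boundary condition
ψ(0,t) = 0, and super-algebraic decay as x → +∞ uniformly on bounded t-intervals. -/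
structure IsAdmissible (ψ : ℝ → ℝ → ℂ) : Prop where
  smooth : ContDiffOn ℝ (⊤ : ℕ∞) (Function.uncurry ψ) {p : ℝ × ℝ | 0 ≤ p.1}
  eqn : ∀ x t : ℝ, 0 < x →
    Complex.I * pdT ψ x t
      = -(1/2) * pdX (pdX ψ) x t - (x : ℂ) * (t : ℂ) * ψ x t
  bc : ∀ t : ℝ, ψ 0 t = 0
  decay : ∀ (α β γ : ℕ) (A₁ A₂ : ℝ), A₁ < A₂ → ∀ ε > 0, ∃ X : ℝ, ∀ x ≥ X,
    ∀ t ∈ Set.Icc A₁ A₂, x ^ α * ‖(pdT^[β] (pdX^[γ] ψ)) x t‖ < ε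

/-- The searchlight ansatz ψ₀⁺ built from amplitude G₀:
ψ₀⁺(x,t) = t^{-1/2} exp{i(7/120)t⁵ + (i/2)η t³ + (i/2)η² t} G₀(η), η = x/t - t²/6. -/
def searchlight (G₀ : ℝ → ℂ) (x t : ℝ) : ℂ :=
  (((Real.sqrt t)⁻¹ : ℝ) : ℂ) *
    Complex.exp (Complex.I * ((7/120) * (t:ℂ)^5
      + ((x/t - t^2/6 : ℝ) : ℂ) * (t:ℂ)^3 / 2
      + ((x/t - t^2/6 : ℝ) : ℂ)^2 * (t:ℂ) / 2))
    * G₀ (x/t - t^2/6)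

/-- ‖ψ(·,t) − ψ₀⁺(·,t)‖_{L²(0,∞)} → 0 as t → +∞. -/
def SearchlightLimit (ψ : ℝ → ℝ → ℂ) (G₀ : ℝ → ℂ) : Prop :=
  Tendsto (fun t : ℝ => L2h (fun x => ψ x t - searchlight G₀ x t)) atTop (nhds 0)

/-- A family of functions of time that decays faster than any power of `t` as `t → +∞`,
uniformly in the index and locally uniformly towards `-∞`. -/
def RapidFam {ι : Type*} (f : ι → ℝ → ℝ) : Prop :=
  ∀ (N : ℕ) (M : ℝ), ∃ C : ℝ, ∀ i t, -M ≤ t → (1 + t ^ 2) ^ N * |f i t| ≤ C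

namespace RapidFam

variable {ι : Type*} {f g : ι → ℝ → ℝ}

lemma mono (hg : RapidFam g) (h : ∀ i t, |f i t| ≤ |g i t|) : RapidFam f := fun N M => by
  obtain ⟨C, hC⟩ := hg N M
  exact ⟨C, fun i t ht => (mul_le_mul_of_nonneg_left (h i t) (by positivity)).trans (hC i t ht)⟩

lemma add (hf : RapidFam f) (hg : RapidFam g) : RapidFam (fun i t => f i t + g i t) := fun N M => by
  obtain ⟨C, hC⟩ := hf N M
  obtain ⟨D, hD⟩ := hg N M
  refine ⟨C + D, fun i t ht => ?_⟩
  have h1 := hC i t ht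
  have h2 := hD i t ht
  have h3 : (1 + t ^ 2) ^ N * |f i t + g i t| ≤ (1 + t ^ 2) ^ N * (|f i t| + |g i t|) :=
    mul_le_mul_of_nonneg_left (abs_add_le _ _) (by positivity)
  linarith [mul_add ((1 + t ^ 2) ^ N) |f i t| |g i t|]

lemma poly_mul (hf : RapidFam f) (c : ℝ → ℝ) (C : ℝ) (m : ℕ)
    (hc : ∀ t, |c t| ≤ C * (1 + t ^ 2) ^ m) : RapidFam (fun i t => c t * f i t) := fun N M => by
  obtain ⟨D, hD⟩ := hf (N + m) M
  refine ⟨|C| * D, fun i t ht => ?_⟩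
  have h1 := hD i t ht
  rw [abs_mul]
  calc (1 + t ^ 2) ^ N * (|c t| * |f i t|)
      ≤ (1 + t ^ 2) ^ N * ((|C| * (1 + t ^ 2) ^ m) * |f i t|) := by
        gcongr
        exact (hc t).trans (mul_le_mul_of_nonneg_right (le_abs_self C) (by positivity))
    _ = |C| * ((1 + t ^ 2) ^ (N + m) * |f i t|) := by ring
    _ ≤ |C| * D := by gcongr

lemma const_mul (hf : RapidFam f) (c : ℝ) : RapidFam (fun i t => c * f i t) :=
  hf.poly_mul (fun _ => c) |c| 0 (fun t => by simp)

lemma mul (hf : RapidFam f) (hg : RapidFam g) : RapidFam (fun i t => f i t * g i t) := fun N M => by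
  obtain ⟨C, hC⟩ := hf N M
  obtain ⟨D, hD⟩ := hg 0 M
  refine ⟨C * D, fun i t ht => ?_⟩
  have h1 := hC i t ht
  have h2 := hD i t ht
  rw [pow_zero, one_mul] at h2
  rw [abs_mul, ← mul_assoc]
  exact mul_le_mul h1 h2 (abs_nonneg _) ((by positivity : (0:ℝ) ≤ _).trans h1)

lemma sqrt (hf : RapidFam f) : RapidFam (fun i t => √(f i t)) := fun N M => by
  obtain ⟨C, hC⟩ := hf (2 * N) M
  refine ⟨√C, fun i t ht => ?_⟩
  have h1 := hC i t ht
  rw [abs_of_nonneg (Real.sqrt_nonneg _)]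
  apply Real.le_sqrt_of_sq_le
  rw [mul_pow, ← pow_mul, mul_comm N 2]
  refine le_trans ?_ h1
  gcongr
  rcases le_total 0 (f i t) with h | h
  · rw [Real.sq_sqrt h]; exact le_abs_self _
  · rw [Real.sqrt_eq_zero_of_nonpos h]; simp

lemma of_sq (hf : RapidFam (fun i t => f i t ^ 2)) : RapidFam f :=
  hf.sqrt.mono fun i t => by rw [Real.sqrt_sq_eq_abs, abs_abs]

lemma zero : RapidFam (fun (_ : ι) (_ : ℝ) => (0 : ℝ)) := fun N M => ⟨0, fun i t _ => by simp⟩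

lemma comp_index {κ : Type*} (hf : RapidFam f) (e : κ → ι) : RapidFam (fun i t => f (e i) t) :=
  fun N M => by
    obtain ⟨C, hC⟩ := hf N M
    exact ⟨C, fun i t ht => hC (e i) t ht⟩

/-- Backward Grönwall lemma from `t = +∞`. -/
lemma gronwall {Y Y' r : ι → ℝ → ℝ} (h0 : ∀ i t, 0 ≤ Y i t)
    (hd : ∀ i t, HasDerivAt (Y i) (Y' i t) t) (hr : RapidFam r)
    (hb : ∀ i t, |Y' i t| ≤ r i t * (1 + Y i t))
    (hlim : ∀ i, Tendsto (Y i) atTop (nhds 0)) : RapidFam Y := by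
  have key1 : ∀ M : ℝ, ∃ C, ∀ i t, -M ≤ t → Y i t ≤ C := by
    intro M
    obtain ⟨C, hC⟩ := hr 1 M
    refine ⟨Real.exp (|C| * Real.pi) - 1, fun i t ht => ?_⟩
    have hmono : MonotoneOn (fun s => Real.log (1 + Y i s) + |C| * Real.arctan s) (Ici (-M)) := by
      have hdd : ∀ s, HasDerivAt (fun s => Real.log (1 + Y i s) + |C| * Real.arctan s)
          (Y' i s / (1 + Y i s) + |C| * (1 / (1 + s ^ 2))) s := fun s => by
        have h1 : 1 + Y i s ≠ 0 := by linarith [h0 i s]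
        exact (((hd i s).const_add 1).log h1).add ((Real.hasDerivAt_arctan s).const_mul _)
      apply monotoneOn_of_deriv_nonneg (convex_Ici _)
      · exact fun s _ => (hdd s).continuousAt.continuousWithinAt
      · exact fun s _ => (hdd s).differentiableAt.differentiableWithinAt
      · intro s hs
        rw [interior_Ici] at hs
        rw [(hdd s).deriv]
        have h1 : 0 < 1 + Y i s := by linarith [h0 i s]
        have h2 : |Y' i s / (1 + Y i s)| ≤ r i s := by
          rw [abs_div, abs_of_pos h1, div_le_iff₀ h1]; exact hb i s
        have h3 : r i s ≤ |C| * (1 / (1 + s ^ 2)) := by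
          have := hC i s (le_of_lt hs)
          rw [mul_one_div, le_div_iff₀ (by positivity)]
          have h4 := le_abs_self (r i s)
          have h5 := le_abs_self C
          nlinarith [sq_nonneg s]
        linarith [neg_abs_le (Y' i s / (1 + Y i s))]
    have hl : Tendsto (fun s => Real.log (1 + Y i s) + |C| * Real.arctan s) atTop
        (nhds (Real.log (1 + 0) + |C| * (Real.pi / 2))) := by
      refine Tendsto.add ?_ ?_
      · exact ((hlim i).const_add 1).log (by norm_num)
      · exact (tendsto_nhds_of_tendsto_nhdsWithin Real.tendsto_arctan_atTop).const_mul _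
    have hle : Real.log (1 + Y i t) + |C| * Real.arctan t ≤
        Real.log (1 + 0) + |C| * (Real.pi / 2) := by
      refine ge_of_tendsto hl ?_
      filter_upwards [eventually_ge_atTop t] with s hs
      exact hmono ht (ht.trans hs) hs
    have h6 : Real.log (1 + Y i t) ≤ |C| * Real.pi := by
      have := Real.neg_pi_div_two_lt_arctan t
      simp only [add_zero, Real.log_one, zero_add] at hle
      nlinarith [abs_nonneg C]
    have h1 : 0 < 1 + Y i t := by linarith [h0 i t]
    have := (Real.log_le_iff_le_exp h1).1 h6
    linarith
  intro N M
  obtain ⟨B, hB⟩ := key1 M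
  obtain ⟨C, hC⟩ := hr (N + 1) M
  have hmain : ∀ i t, -M ≤ t → ∀ D, 0 ≤ D → (∀ s, t ≤ s → D ≤ (1 + s ^ 2) ^ N) →
      D * Y i t ≤ |C| * (1 + |B|) * Real.pi := by
    intro i t ht D hD hDs
    set K := |C| * (1 + |B|) with hK
    have hK0 : 0 ≤ K := by positivity
    have hdd : ∀ s, HasDerivAt (fun s => D * Y i s + K * Real.arctan s)
        (D * Y' i s + K * (1 / (1 + s ^ 2))) s := fun s =>
      ((hd i s).const_mul D).add ((Real.hasDerivAt_arctan s).const_mul _)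
    have hmono : MonotoneOn (fun s => D * Y i s + K * Real.arctan s) (Ici t) := by
      apply monotoneOn_of_deriv_nonneg (convex_Ici _)
      · exact fun s _ => (hdd s).continuousAt.continuousWithinAt
      · exact fun s _ => (hdd s).differentiableAt.differentiableWithinAt
      · intro s hs
        rw [interior_Ici] at hs
        have hs' : t ≤ s := le_of_lt hs
        rw [(hdd s).deriv]
        have h1 : 1 + Y i s ≤ 1 + |B| := by linarith [hB i s (ht.trans hs'), le_abs_self B]
        have h2 : |r i s| * (1 + s ^ 2) ^ (N + 1) ≤ |C| := by
          rw [mul_comm]; exact (hC i s (ht.trans hs')).trans (le_abs_self C)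
        have h3 : D * |Y' i s| * (1 + s ^ 2) ≤ K := by
          have hy : |Y' i s| ≤ |r i s| * (1 + |B|) :=
            (hb i s).trans (mul_le_mul (le_abs_self _) h1 (by linarith [h0 i s]) (abs_nonneg _))
          calc D * |Y' i s| * (1 + s ^ 2)
              ≤ (1 + s ^ 2) ^ N * (|r i s| * (1 + |B|)) * (1 + s ^ 2) := by
                gcongr
                exact hDs s hs'
            _ = |r i s| * (1 + s ^ 2) ^ (N + 1) * (1 + |B|) := by ring
            _ ≤ K := by rw [hK]; gcongr
        have h4 : D * |Y' i s| ≤ K * (1 / (1 + s ^ 2)) := by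
          rw [mul_one_div, le_div_iff₀ (by positivity)]; exact h3
        nlinarith [neg_abs_le (Y' i s)]
    have hl : Tendsto (fun s => D * Y i s + K * Real.arctan s) atTop
        (nhds (D * 0 + K * (Real.pi / 2))) :=
      ((hlim i).const_mul _).add
        ((tendsto_nhds_of_tendsto_nhdsWithin Real.tendsto_arctan_atTop).const_mul _)
    have hle : D * Y i t + K * Real.arctan t ≤ D * 0 + K * (Real.pi / 2) := by
      refine ge_of_tendsto hl ?_
      filter_upwards [eventually_ge_atTop t] with s hs
      exact hmono self_mem_Ici hs hs
    have := Real.neg_pi_div_two_lt_arctan t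
    nlinarith
  refine ⟨|C| * (1 + |B|) * Real.pi * (1 + (1 + M ^ 2) ^ N), fun i t ht => ?_⟩
  rw [abs_of_nonneg (h0 i t)]
  have hE : 0 ≤ |C| * (1 + |B|) * Real.pi := by positivity
  have hP : 0 ≤ (1 + M ^ 2) ^ N := by positivity
  rcases le_total 0 t with h | h
  · have := hmain i t ht ((1 + t ^ 2) ^ N) (by positivity) (fun s hs => by gcongr)
    nlinarith
  · have h1 := hmain i t ht 1 zero_le_one (fun s hs => one_le_pow₀ (by nlinarith [sq_nonneg s]))
    have h2 : (1 + t ^ 2) ^ N ≤ (1 + M ^ 2) ^ N := by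
      have : t ^ 2 ≤ M ^ 2 := by nlinarith
      gcongr
    nlinarith [h0 i t]

end RapidFam

/-- If `x² ≤ a x + b` then `x` is controlled by `a` and `√b`. -/
lemma le_add_sqrt_of_sq_le {x a b : ℝ} (ha : 0 ≤ a) (hb : 0 ≤ b) (h : x ^ 2 ≤ a * x + b) :
    x ≤ a + √b := by
  by_contra! hc
  have h1 := Real.sqrt_nonneg b
  have h2 := Real.sq_sqrt hb
  nlinarith

/-- The coupled energy hierarchy: amplitudes `A k` and gradients `B k`. -/
lemma energy_hierarchy {ι : Type*} {A B q : ℕ → ι → ℝ → ℝ} {Y' : ℕ → ι → ℝ → ℝ}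
    (hA : ∀ k i t, 0 ≤ A k i t) (hB : ∀ k i t, 0 ≤ B k i t) (hq0 : ∀ k i t, 0 ≤ q k i t)
    (hq : ∀ k, RapidFam (q k))
    (hd : ∀ k i t, HasDerivAt (fun s => A k i s ^ 2) (Y' k i t) t)
    (h1 : ∀ k i t, |Y' k i t| ≤ 2 * A k i t *
      (k * |t| * B (k - 1) i t + (k.choose 2 : ℝ) * B (k - 2) i t + q k i t))
    (h2 : ∀ k i t, B k i t ^ 2 ≤ 2 * A k i t * (A (k + 1) i t + t ^ 2 / 2 * B k i t +
      k * |t| * B (k - 1) i t + (k.choose 2 : ℝ) * B (k - 2) i t + q k i t))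
    (h3 : ∀ k i, Tendsto (A k i) atTop (nhds 0)) (k : ℕ) :
    RapidFam (A k) ∧ RapidFam (B k) := by
  have habs : ∀ t : ℝ, |t| ≤ 1 * (1 + t ^ 2) ^ 1 := fun t => by
    rw [abs_le]; constructor <;> nlinarith [sq_nonneg (t - 1), sq_nonneg (t + 1)]
  have hsq : ∀ k i t, 1 * A k i t ≤ 1 + A k i t ^ 2 := fun k i t => by
    nlinarith [sq_nonneg (A k i t - 1)]
  -- the amplitude at level `k` from all gradients at lower level
  have step1 : ∀ k (r : ι → ℝ → ℝ), RapidFam r → (∀ i t, 0 ≤ r i t) →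
      (∀ i t, k * |t| * B (k - 1) i t + (k.choose 2 : ℝ) * B (k - 2) i t + q k i t
        ≤ r i t * (1 + A k i t)) → RapidFam (A k) := by
    intro k r hr hr0 hle
    apply RapidFam.of_sq
    refine RapidFam.gronwall (fun i t => sq_nonneg _) (hd k) (hr.const_mul 4) (fun i t => ?_)
      (fun i => by simpa using (h3 k i).pow 2)
    refine (h1 k i t).trans ?_
    have ha := hA k i t
    have : 2 * A k i t * (k * |t| * B (k - 1) i t + (k.choose 2 : ℝ) * B (k - 2) i t + q k i t)
        ≤ 2 * A k i t * (r i t * (1 + A k i t)) := by gcongr; exact hle i t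
    refine this.trans ?_
    have h5 : 2 * (A k i t * (1 + A k i t)) ≤ 4 * (1 + A k i t ^ 2) := by
      nlinarith [sq_nonneg (A k i t - 1)]
    nlinarith [hr0 i t]
  -- gradient at level `k` from amplitudes at level `k`, with the next amplitude as parameter
  have step2 : ∀ k, RapidFam (A k) → (1 ≤ k → RapidFam (B (k - 1))) → (2 ≤ k → RapidFam (B (k - 2))) →
      ∃ r, RapidFam r ∧ (∀ i t, 0 ≤ r i t) ∧ ∀ i t, B k i t ≤ r i t * (1 + A (k + 1) i t) := by
    intro k hAk hB1 hB2
    have hb1 : RapidFam (fun i t => k * |t| * B (k - 1) i t) := by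
      rcases Nat.eq_zero_or_pos k with rfl | hk
      · simpa using RapidFam.zero
      · refine (hB1 hk).poly_mul (fun t => k * |t|) k 1 (fun t => ?_)
        rw [abs_mul, abs_abs, Nat.abs_cast]
        have := habs t
        gcongr
        simpa using this
    have hb2 : RapidFam (fun i t => (k.choose 2 : ℝ) * B (k - 2) i t) := by
      rcases lt_or_ge k 2 with hk | hk
      · rw [Nat.choose_eq_zero_of_lt hk]; simpa using RapidFam.zero
      · exact (hB2 hk).const_mul _
    have hs := (hb1.add hb2).add (hq k)
    have hAs : RapidFam (fun i t => 2 * A k i t *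
        (k * |t| * B (k - 1) i t + (k.choose 2 : ℝ) * B (k - 2) i t + q k i t)) :=
      (hAk.const_mul 2).mul hs
    have hAt : RapidFam (fun i t => t ^ 2 * A k i t) :=
      hAk.poly_mul (fun t => t ^ 2) 1 1 (fun t => by rw [abs_of_nonneg (sq_nonneg t)]; linarith)
    refine ⟨fun i t => t ^ 2 * A k i t + √(2 * A k i t + 2 * A k i t *
        (k * |t| * B (k - 1) i t + (k.choose 2 : ℝ) * B (k - 2) i t + q k i t)),
        hAt.add ((hAk.const_mul 2).add hAs).sqrt, fun i t => ?_, fun i t => ?_⟩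
    · have := hA k i t; positivity
    · have ha := hA k i t
      have ha' := hA (k + 1) i t
      have hb1 := hB (k - 1) i t
      have hb2 := hB (k - 2) i t
      have hqq := hq0 k i t
      set X := k * |t| * B (k - 1) i t + (k.choose 2 : ℝ) * B (k - 2) i t + q k i t with hX
      have hX0 : 0 ≤ X := by positivity
      set a' := A (k + 1) i t with ha'_def
      have e1 : B k i t ^ 2 ≤ (t ^ 2 * A k i t) * B k i t + 2 * A k i t * (a' + X) := by
        have := h2 k i t
        rw [hX]; linarith
      have e2 := le_add_sqrt_of_sq_le (by positivity) (by positivity) e1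
      have e3 : √(2 * A k i t * (a' + X)) ≤ √(2 * A k i t + 2 * A k i t * X) * (1 + a') := by
        apply Real.sqrt_le_iff.2 ⟨by positivity, ?_⟩
        rw [mul_pow, Real.sq_sqrt (by positivity)]
        have hx : 0 ≤ A k i t * X := by positivity
        have hx2 : 0 ≤ A k i t * a' := by positivity
        have hx3 : 0 ≤ A k i t * X * a' := by positivity
        have hx4 : 0 ≤ A k i t * X * a' ^ 2 := by positivity
        have hx5 : 0 ≤ A k i t * a' ^ 2 := by positivity
        nlinarith
      have e4 : 0 ≤ t ^ 2 * A k i t * a' := by positivity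
      nlinarith
  have main : ∀ k, RapidFam (A k) ∧ ∀ j, j < k → RapidFam (A j) ∧ RapidFam (B j) := by
    intro k
    induction k with
    | zero =>
      refine ⟨step1 0 (q 0) (hq 0) (hq0 0) (fun i t => ?_), fun j hj => absurd hj (by simp)⟩
      have := hA 0 i t
      have := hq0 0 i t
      simp only [Nat.cast_zero, zero_mul, Nat.choose_zero_succ, zero_add]
      nlinarith
    | succ k ih =>
      obtain ⟨hAk, hlow⟩ := ih
      obtain ⟨r, hr, hr0, hrB⟩ := step2 k hAk (fun h => (hlow (k - 1) (by omega)).2)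
        (fun h => (hlow (k - 2) (by omega)).2)
      have hb2 : RapidFam (fun i t => ((k + 1).choose 2 : ℝ) * B (k - 1) i t) := by
        rcases Nat.eq_zero_or_pos k with rfl | hk
        · simpa using RapidFam.zero
        · exact (hlow (k - 1) (by omega)).2.const_mul _
      have hr' : RapidFam (fun i t => ((k + 1 : ℕ) : ℝ) * |t| * r i t) := by
        refine hr.poly_mul (fun t => ((k + 1 : ℕ) : ℝ) * |t|) (k + 1 : ℕ) 1 (fun t => ?_)
        rw [abs_mul, abs_abs, Nat.abs_cast]
        have := habs t
        gcongr
        simpa using this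
      have hAk1 : RapidFam (A (k + 1)) := by
        refine step1 (k + 1) (fun i t => ((k + 1 : ℕ) : ℝ) * |t| * r i t +
          ((k + 1).choose 2 : ℝ) * B (k - 1) i t + q (k + 1) i t) ((hr'.add hb2).add (hq (k + 1)))
          (fun i t => ?_) (fun i t => ?_)
        · have := hr0 i t; have := hB (k - 1) i t; have := hq0 (k + 1) i t
          positivity
        · have e1 := hrB i t
          have e2 := hA (k + 1) i t
          have e3 := hB (k - 1) i t; have e4 := hq0 (k + 1) i t
          have e5 : ((k + 1 : ℕ) : ℝ) * |t| * B k i t ≤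
            ((k + 1 : ℕ) : ℝ) * |t| * (r i t * (1 + A (k + 1) i t)) := by gcongr
          have e6 : 0 ≤ (((k + 1).choose 2 : ℝ) * B (k - 1) i t) * A (k + 1) i t := by positivity
          have e7 : 0 ≤ q (k + 1) i t * A (k + 1) i t := by positivity
          have e8 : k + 1 - 2 = k - 1 := by omega
          simp only [Nat.add_sub_cancel, e8]
          nlinarith
      refine ⟨hAk1, fun j hj => ?_⟩
      rcases Nat.lt_succ_iff_lt_or_eq.1 hj with h | rfl
      · exact hlow j h
      · refine ⟨hAk, (hr.add (hr.mul hAk1)).mono fun i t => ?_⟩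
        have := hrB i t
        have e2 := hA (j + 1) i t
        have := hr0 i t
        rw [abs_of_nonneg (hB j i t), abs_of_nonneg (by positivity)]
        linarith
  exact (main (k + 1)).2 k (Nat.lt_succ_self k)

section LinearODE
variable {W : Type*} [NormedAddCommGroup W] [NormedSpace ℝ W] [CompleteSpace W]

/-- Backward solution of a linear ODE with coefficient of quadratic growth. -/
lemma exists_linear_ode (B : ℝ → W →L[ℝ] W) (hB : Continuous B) (K : ℝ) (hK : 1 ≤ K)
    (hBK : ∀ t, ‖B t‖ ≤ K * (1 + t ^ 2)) (f : ℝ → W) (hf : Continuous f) (C : ℝ)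
    (hfC : ∀ t, ‖f t‖ ≤ C) (T : ℝ) (hfT : ∀ t, T ≤ t → f t = 0) :
    ∃ w : ℝ → W, (∀ t, HasDerivAt w (B t (w t) + f t) t) ∧ ∀ t, T ≤ t → w t = 0 := by
  set Λ : ℝ → ℝ := fun t => 2 * K * (t + t ^ 3 / 3) with hΛ
  have hΛc : Continuous Λ := by simp only [hΛ]; fun_prop
  have hΛd : ∀ t, HasDerivAt (fun s => -Real.exp (-Λ s)) (2 * (K * (1 + t ^ 2) * Real.exp (-Λ t))) t := by
    intro t
    have h1 : HasDerivAt Λ (2 * K * (1 + t ^ 2)) t := by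
      have := (((hasDerivAt_id t).add ((hasDerivAt_pow 3 t).div_const 3)).const_mul (2 * K))
      refine (this.congr_deriv ?_)
      norm_num

    have := (h1.neg.exp).neg
    refine this.congr_deriv ?_
    simp only [Pi.neg_apply]
    ring
  have hC : 0 ≤ C := (norm_nonneg _).trans (hfC 0)
  set C' := C * Real.exp (Λ T) with hC'
  have hC'0 : 0 ≤ C' := by positivity
  have hmono : ∀ s, s ≤ T → Λ s ≤ Λ T := by
    intro s hs
    have : s + s ^ 3 / 3 ≤ T + T ^ 3 / 3 := by
      have : s ^ 3 ≤ T ^ 3 := (Odd.strictMono_pow (by decide)).monotone hs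
      linarith
    simp only [hΛ]; gcongr
  -- the key integral estimate
  have key : ∀ (g : ℝ → W) (D : ℝ), 0 ≤ D → (∀ s, s ≤ T → ‖g s‖ ≤ D * (K * (1 + s ^ 2) * Real.exp (-Λ s))) →
      ∀ t, Real.exp (Λ t) * ‖∫ s in T..(min t T), g s‖ ≤ D / 2 := by
    intro g D hD hg t
    rcases le_total T t with h | h
    · rw [min_eq_right h]; simp; positivity
    · rw [min_eq_left h, intervalIntegral.integral_symm, norm_neg]
      have h1 : ‖∫ s in t..T, g s‖ ≤ ∫ s in t..T, D * (K * (1 + s ^ 2) * Real.exp (-Λ s)) :=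
        intervalIntegral.norm_integral_le_of_norm_le h
          (Eventually.of_forall fun s hs => hg s hs.2)
          (Continuous.intervalIntegrable (by fun_prop) _ _)
      have h2 : ∫ s in t..T, D * (K * (1 + s ^ 2) * Real.exp (-Λ s))
          = D / 2 * (Real.exp (-Λ t) - Real.exp (-Λ T)) := by
        have : ∀ s, D * (K * (1 + s ^ 2) * Real.exp (-Λ s)) = D / 2 * (2 * (K * (1 + s ^ 2) * Real.exp (-Λ s))) :=
          fun s => by ring
        simp_rw [this]
        rw [intervalIntegral.integral_const_mul,
          intervalIntegral.integral_eq_sub_of_hasDerivAt (fun s _ => hΛd s)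
          (Continuous.intervalIntegrable (by fun_prop) _ _)]
        ring
      calc Real.exp (Λ t) * ‖∫ s in t..T, g s‖ ≤ Real.exp (Λ t) * (D / 2 * (Real.exp (-Λ t) - Real.exp (-Λ T))) := by
            rw [← h2]; gcongr
        _ ≤ Real.exp (Λ t) * (D / 2 * Real.exp (-Λ t)) := by
            gcongr; linarith [Real.exp_pos (-Λ T)]
        _ = D / 2 := by rw [Real.exp_neg]; field_simp
  have hcont : ∀ u : ℝ → W, Continuous u → Continuous (fun s => B s (Real.exp (-Λ s) • u s) + f s) := by
    intro u hu
    exact (hB.clm_apply (by fun_prop)).add hf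
  have hbd : ∀ (u : BoundedContinuousFunction ℝ W) s, s ≤ T →
      ‖B s (Real.exp (-Λ s) • u s) + f s‖ ≤ (‖u‖ + C') * (K * (1 + s ^ 2) * Real.exp (-Λ s)) := by
    intro u s hs
    have h1 : ‖B s (Real.exp (-Λ s) • u s)‖ ≤ K * (1 + s ^ 2) * (Real.exp (-Λ s) * ‖u‖) := by
      refine ((B s).le_opNorm _).trans ?_
      rw [norm_smul, Real.norm_of_nonneg (Real.exp_pos _).le]
      have := u.norm_coe_le_norm s
      have := hBK s
      gcongr
    have h2 : ‖f s‖ ≤ C' * (K * (1 + s ^ 2) * Real.exp (-Λ s)) := by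
      have e : 1 ≤ Real.exp (Λ T) * Real.exp (-Λ s) := by
        rw [← Real.exp_add]; exact Real.one_le_exp (by linarith [hmono s hs])
      have e2 : 1 ≤ K * (1 + s ^ 2) := by nlinarith [sq_nonneg s]
      calc ‖f s‖ ≤ C * (1 * 1) := by simpa using hfC s
        _ ≤ C * ((Real.exp (Λ T) * Real.exp (-Λ s)) * (K * (1 + s ^ 2))) := by gcongr
        _ = _ := by rw [hC']; ring
    refine (norm_add_le _ _).trans ((add_le_add h1 h2).trans (le_of_eq ?_))
    ring
  have hintc : ∀ g : ℝ → W, Continuous g → Continuous (fun t => ∫ s in T..(min t T), g s) := by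
    intro g hg
    exact (intervalIntegral.continuous_primitive (fun a b => hg.intervalIntegrable a b) T).comp
      (continuous_id.min continuous_const)
  set Φ : BoundedContinuousFunction ℝ W → BoundedContinuousFunction ℝ W := fun u =>
    BoundedContinuousFunction.ofNormedAddCommGroup
      (fun t => Real.exp (Λ t) • ∫ s in T..(min t T), (B s (Real.exp (-Λ s) • u s) + f s))
      ((Real.continuous_exp.comp hΛc).smul (hintc _ (hcont u u.continuous))) ((‖u‖ + C') / 2)
      (fun t => by
        rw [norm_smul, Real.norm_of_nonneg (Real.exp_pos _).le]
        exact key _ _ (by positivity) (hbd u) t) with hΦ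
  have hcontr : ContractingWith (1/2) Φ := by
    refine ⟨by rw [div_lt_one] <;> norm_num, LipschitzWith.of_dist_le_mul fun u v => ?_⟩
    rw [BoundedContinuousFunction.dist_le (by positivity)]
    intro t
    rw [dist_eq_norm]
    simp only [hΦ, BoundedContinuousFunction.coe_ofNormedAddCommGroup]
    rw [← smul_sub, ← intervalIntegral.integral_sub ((hcont u u.continuous).intervalIntegrable _ _)
      ((hcont v v.continuous).intervalIntegrable _ _), norm_smul, Real.norm_of_nonneg (Real.exp_pos _).le]
    refine (key _ (dist u v) dist_nonneg ?_ t).trans (le_of_eq ?_)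
    · intro s hs
      rw [add_sub_add_right_eq_sub, ← map_sub, ← smul_sub]
      refine ((B s).le_opNorm _).trans ?_
      rw [norm_smul, Real.norm_of_nonneg (Real.exp_pos _).le, ← dist_eq_norm]
      have h1 := BoundedContinuousFunction.dist_coe_le_dist (f := u) (g := v) s
      calc ‖B s‖ * (Real.exp (-Λ s) * dist (u s) (v s)) ≤ (K * (1 + s^2)) * (Real.exp (-Λ s) * dist u v) := by
            gcongr; exact hBK s
        _ = _ := by ring
    · simp; ring
  obtain ⟨u, hu⟩ : ∃ u, Φ u = u := ⟨_, hcontr.fixedPoint_isFixedPt⟩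
  have hu' : ∀ t, Real.exp (-Λ t) • u t = ∫ s in T..(min t T), (B s (Real.exp (-Λ s) • u s) + f s) := by
    intro t
    have : u t = Real.exp (Λ t) • ∫ s in T..(min t T), (B s (Real.exp (-Λ s) • u s) + f s) := by
      conv_lhs => rw [← hu]
      simp [hΦ]
    rw [this, smul_smul, ← Real.exp_add]; simp
  set w : ℝ → W := fun t => Real.exp (-Λ t) • u t with hw
  have hwT : ∀ t, T ≤ t → w t = 0 := by
    intro t ht; simp only [hw]; rw [hu' t, min_eq_right ht]; simp
  refine ⟨w, fun t => ?_, hwT⟩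
  set g : ℝ → W := fun s => B s (w s) + f s with hg
  have hgc : Continuous g := hcont u u.continuous
  have hG : ∀ t, HasDerivAt (fun t => ∫ s in T..t, g s) (g t) t := fun t =>
    intervalIntegral.integral_hasDerivAt_right (hgc.intervalIntegrable _ _)
      (hgc.stronglyMeasurableAtFilter _ _) hgc.continuousAt
  have hwG : ∀ t, w t = ∫ s in T..(min t T), g s := hu'
  rcases lt_trichotomy t T with h | h | h
  · refine (hG t).congr_of_eventuallyEq ?_
    filter_upwards [Iio_mem_nhds h] with s hs
    rw [hwG s, min_eq_left (le_of_lt hs)]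
  · subst h
    have hg0 : g t = 0 := by simp [hg, hwT t le_rfl, hfT t le_rfl]
    have h1 := hG t
    change HasDerivAt w (g t) t
    rw [hg0] at h1 ⊢
    rw [hasDerivAt_iff_isLittleO] at h1 ⊢
    simp only [smul_zero, sub_zero, intervalIntegral.integral_same] at h1 ⊢
    rw [hwT t le_rfl]
    simp only [sub_zero]
    rw [Asymptotics.isLittleO_iff] at h1 ⊢
    intro c hc
    filter_upwards [h1 hc] with s hs
    rcases le_total t s with h' | h'
    · rw [hwT s h']; simp; positivity
    · rw [hwG s, min_eq_left h']; exact hs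
  · have : B t (w t) + f t = 0 := by rw [hwT t h.le, hfT t h.le]; simp
    rw [this]
    refine (hasDerivAt_const t (0:W)).congr_of_eventuallyEq ?_
    filter_upwards [Ioi_mem_nhds h] with s hs
    rw [hwT s (le_of_lt hs)]
end LinearODE

section Energy
variable {E : Type*} [NormedAddCommGroup E] [InnerProductSpace ℂ E]

local notation "⟪" x "," y "⟫" => inner ℂ x y

/-- The weak form, tested against `(a, b)`, of the `k`-th time derivative of
`w_t = (i/2) w_xx - (t²/2) w_x + F`, where `d` stands for `w_x`. -/
def WeakEq (w d F : ℕ → ℝ → E) (p : E × E) (k : ℕ) (t : ℝ) : Prop :=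
  ⟪p.1, w (k + 1) t⟫ = -(Complex.I / 2) * ⟪p.2, d k t⟫ - ((t ^ 2 / 2 : ℝ) : ℂ) * ⟪p.1, d k t⟫
    - ((k * t : ℝ) : ℂ) * ⟪p.1, d (k - 1) t⟫ - ((k.choose 2 : ℝ) : ℂ) * ⟪p.1, d (k - 2) t⟫
    + ⟪p.1, F k t⟫

lemma hasDerivAt_norm_sq_complex {v : ℝ → E} {v' : E} {t : ℝ} (h : HasDerivAt v v' t) :
    HasDerivAt (fun s => ‖v s‖ ^ 2) (2 * (⟪v t, v'⟫).re) t := by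
  have h1 := (Complex.reCLM.hasFDerivAt.comp_hasDerivAt t (h.inner ℂ h))
  have e : (Complex.reCLM ∘ fun s => ⟪v s, v s⟫) = fun s => ‖v s‖ ^ 2 := by
    ext s; exact (norm_sq_eq_re_inner (𝕜 := ℂ) _).symm
  rw [e] at h1
  refine h1.congr_deriv ?_
  have h2 : (⟪v', v t⟫).re = (⟪v t, v'⟫).re := by
    rw [← inner_conj_symm]; exact Complex.conj_re _
  simp [h2]; ring

lemma energy_of_weakEq {ι : Type*} (w d F : ι → ℕ → ℝ → E) (Q L : ι → E →L[ℂ] E)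
    (hQ : ∀ i x y, ⟪Q i x, y⟫ = ⟪x, Q i y⟫) (hL : ∀ i x y, ⟪L i x, y⟫ = ⟪x, L i y⟫)
    (hQL : ∀ i x, Q i (L i x) = L i (Q i x))
    (hw : ∀ i k t, HasDerivAt (w i k) (w i (k + 1) t) t)
    (hskew : ∀ i k t, ⟪Q i (Q i (w i k t)), d i k t⟫ +
      ⟪(2:ℂ) • Q i (L i (w i k t)) + Q i (Q i (d i k t)), w i k t⟫ = 0)
    (heq : ∀ i k t, WeakEq (w i) (d i) (F i)
      (Q i (Q i (w i k t)), (2:ℂ) • Q i (L i (w i k t)) + Q i (Q i (d i k t))) k t)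
    (hF : ∀ k, RapidFam (fun i t => ‖Q i (F i k t)‖))
    (hLw : ∀ k, RapidFam (fun i t => ‖L i (w i k t)‖))
    (hLd : ∀ k, RapidFam (fun i t => ‖L i (d i k t)‖))
    (h0 : ∀ k i, Tendsto (fun t => ‖Q i (w i k t)‖) atTop (nhds 0)) (k : ℕ) :
    RapidFam (fun i t => ‖Q i (w i k t)‖) ∧ RapidFam (fun i t => ‖Q i (d i k t)‖) := by
  have hcs : ∀ x y : E, |(⟪x, y⟫).re| ≤ ‖x‖ * ‖y‖ ∧ |(⟪x, y⟫).im| ≤ ‖x‖ * ‖y‖ := fun x y =>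
    ⟨(Complex.abs_re_le_norm _).trans (norm_inner_le_norm x y),
      (Complex.abs_im_le_norm _).trans (norm_inner_le_norm x y)⟩
  -- the weak equation for the weighted functions
  have main : ∀ i k t, ⟪Q i (w i k t), Q i (w i (k + 1) t)⟫ =
      -(Complex.I / 2) * (2 * ⟪Q i (w i k t), L i (d i k t)⟫ + ⟪Q i (d i k t), Q i (d i k t)⟫)
      - ((t ^ 2 / 2 : ℝ) : ℂ) * ⟪Q i (w i k t), Q i (d i k t)⟫
      - ((k * t : ℝ) : ℂ) * ⟪Q i (w i k t), Q i (d i (k - 1) t)⟫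
      - ((k.choose 2 : ℝ) : ℂ) * ⟪Q i (w i k t), Q i (d i (k - 2) t)⟫
      + ⟪Q i (w i k t), Q i (F i k t)⟫ := by
    intro i k t
    have := heq i k t
    simp only [WeakEq, inner_add_left, inner_smul_left, hQL i, hL, hQ] at this ⊢
    have c2 : (starRingEnd ℂ) 2 = 2 := Complex.conj_ofNat 2
    simpa [c2] using this
  have skew : ∀ i k t, |(⟪Q i (w i k t), Q i (d i k t)⟫).re| ≤ ‖Q i (w i k t)‖ * ‖L i (w i k t)‖ := by
    intro i k t
    have := hskew i k t
    rw [inner_add_left, inner_smul_left, hQL i, hL, hQ, hQ i (Q i (d i k t)), hQ i (w i k t),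
      Complex.conj_ofNat, ← hQ i (w i k t)] at this
    have h := congrArg Complex.re this
    have hc : (⟪Q i (d i k t), Q i (w i k t)⟫).re = (⟪Q i (w i k t), Q i (d i k t)⟫).re := by
      rw [← inner_conj_symm]; exact Complex.conj_re _
    have e := hcs (Q i (w i k t)) (L i (w i k t))
    simp [hc, -inner_self_eq_norm_sq_to_K] at h
    rw [abs_le] at e ⊢
    constructor <;> linarith [e.1.1, e.1.2, h]
  refine energy_hierarchy (A := fun k i t => ‖Q i (w i k t)‖) (B := fun k i t => ‖Q i (d i k t)‖)
    (q := fun k i t => 2 * ‖L i (d i k t)‖ + t ^ 2 / 2 * ‖L i (w i k t)‖ + 2 * ‖Q i (F i k t)‖)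
    (Y' := fun k i t => 2 * (⟪Q i (w i k t), Q i (w i (k + 1) t)⟫).re)
    (fun _ _ _ => norm_nonneg _) (fun _ _ _ => norm_nonneg _) (fun _ _ _ => by positivity)
    (fun k => ?_) (fun k i t => ?_) (fun k i t => ?_) (fun k i t => ?_) h0 k
  · refine (((hLd k).const_mul 2).add ((hLw k).poly_mul (fun t => t ^ 2 / 2) 1 1 ?_)).add
      ((hF k).const_mul 2)
    intro t; rw [abs_le]; constructor <;> nlinarith [sq_nonneg t]
  · exact hasDerivAt_norm_sq_complex
      (((Q i).restrictScalars ℝ).hasFDerivAt.comp_hasDerivAt t (hw i k t))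
  · have h := congrArg Complex.re (main i k t)
    have s := skew i k t
    have e1 := (hcs (Q i (w i k t)) (L i (d i k t))).2
    have e2 := (hcs (Q i (w i k t)) (Q i (d i (k - 1) t))).1
    have e3 := (hcs (Q i (w i k t)) (Q i (d i (k - 2) t))).1
    have e4 := (hcs (Q i (w i k t)) (Q i (F i k t))).1
    have im0 : (⟪Q i (d i k t), Q i (d i k t)⟫).im = 0 := inner_self_im (𝕜 := ℂ) _
    simp only [Complex.add_re, Complex.sub_re, Complex.mul_re, Complex.ofReal_re, Complex.ofReal_im,
      Complex.neg_re, Complex.neg_im, Complex.add_im, Complex.mul_im] at h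
    simp [im0, -inner_self_eq_norm_sq_to_K] at h
    rw [h]
    set a := ‖Q i (w i k t)‖
    have ha : 0 ≤ a := norm_nonneg _
    have e2' : |k * t * (⟪Q i (w i k t), Q i (d i (k - 1) t)⟫).re| ≤ k * |t| * (a * ‖Q i (d i (k - 1) t)‖) := by
      rw [abs_mul, abs_mul, Nat.abs_cast]; gcongr
    have e3' : |(k.choose 2 : ℝ) * (⟪Q i (w i k t), Q i (d i (k - 2) t)⟫).re| ≤ k.choose 2 * (a * ‖Q i (d i (k - 2) t)‖) := by
      rw [abs_mul, Nat.abs_cast]; gcongr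
    have s' : |t ^ 2 / 2 * (⟪Q i (w i k t), Q i (d i k t)⟫).re| ≤ t ^ 2 / 2 * (a * ‖L i (w i k t)‖) := by
      rw [abs_mul, abs_of_nonneg (by positivity)]; gcongr
    have p1 : 0 ≤ a * ‖L i (d i k t)‖ := by positivity
    have p2 : 0 ≤ a * ‖Q i (F i k t)‖ := by positivity
    rw [abs_le] at e1 e2' e3' e4 s' ⊢
    constructor <;> nlinarith [e1.1, e1.2, e2'.1, e2'.2, e3'.1, e3'.2, e4.1, e4.2, s'.1, s'.2]
  · have h := congrArg Complex.im (main i k t)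
    have e0 := (hcs (Q i (w i k t)) (Q i (w i (k + 1) t))).2
    have s := (hcs (Q i (w i k t)) (Q i (d i k t))).2
    have e1 := (hcs (Q i (w i k t)) (L i (d i k t))).1
    have e2 := (hcs (Q i (w i k t)) (Q i (d i (k - 1) t))).2
    have e3 := (hcs (Q i (w i k t)) (Q i (d i (k - 2) t))).2
    have e4 := (hcs (Q i (w i k t)) (Q i (F i k t))).2
    have im0 : (⟪Q i (d i k t), Q i (d i k t)⟫).im = 0 := inner_self_im (𝕜 := ℂ) _
    have re0 : (⟪Q i (d i k t), Q i (d i k t)⟫).re = ‖Q i (d i k t)‖ ^ 2 := (norm_sq_eq_re_inner (𝕜 := ℂ) _).symm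
    simp only [Complex.add_re, Complex.mul_re, Complex.ofReal_re, Complex.ofReal_im,
      Complex.neg_re, Complex.neg_im, Complex.add_im, Complex.mul_im,
      Complex.sub_im] at h
    simp [im0, re0, -inner_self_eq_norm_sq_to_K] at h
    set a := ‖Q i (w i k t)‖
    have ha : 0 ≤ a := norm_nonneg _
    have e2' : |k * t * (⟪Q i (w i k t), Q i (d i (k - 1) t)⟫).im| ≤ k * |t| * (a * ‖Q i (d i (k - 1) t)‖) := by
      rw [abs_mul, abs_mul, Nat.abs_cast]; gcongr
    have e3' : |(k.choose 2 : ℝ) * (⟪Q i (w i k t), Q i (d i (k - 2) t)⟫).im| ≤ k.choose 2 * (a * ‖Q i (d i (k - 2) t)‖) := by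
      rw [abs_mul, Nat.abs_cast]; gcongr
    have s' : |t ^ 2 / 2 * (⟪Q i (w i k t), Q i (d i k t)⟫).im| ≤ t ^ 2 / 2 * (a * ‖Q i (d i k t)‖) := by
      rw [abs_mul, abs_of_nonneg (by positivity)]; gcongr
    have p1 : 0 ≤ a * ‖L i (d i k t)‖ := by positivity
    have p2 : 0 ≤ a * ‖Q i (F i k t)‖ := by positivity
    have p3 : 0 ≤ t ^ 2 / 2 * (a * ‖L i (w i k t)‖) := by positivity
    rw [abs_le] at e0 e1 e2' e3' e4 s'
    nlinarith [e0.1, e0.2, e1.1, e1.2, e2'.1, e2'.2, e3'.1, e3'.2, e4.1, e4.2, s'.1, s'.2]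
end Energy

section Galerkin
variable {E : Type*} [NormedAddCommGroup E] [InnerProductSpace ℂ E] [CompleteSpace E]

local notation "⟪" x "," y "⟫" => inner ℂ x y

/-- Three-term recursion generating the time derivatives of a solution. -/
def derivTower {U : Type*} (step : ℕ → (ℝ → U) → (ℝ → U) → (ℝ → U) → ℝ → U) (z u : ℝ → U) :
    ℕ → (ℝ → U) × (ℝ → U) × (ℝ → U)
  | 0 => (z, z, u)
  | k + 1 => ((derivTower step z u k).2.1, (derivTower step z u k).2.2,
      step k (derivTower step z u k).1 (derivTower step z u k).2.1 (derivTower step z u k).2.2)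

lemma exists_derivTower {U : Type*} [NormedAddCommGroup U] [NormedSpace ℂ U]
    (B₀ B₁ : U →L[ℂ] U) (e : U) (c : ℕ → ℝ → ℂ) (hc : ∀ k t, HasDerivAt (c k) (c (k + 1) t) t)
    (u : ℝ → U)
    (hu : ∀ t, HasDerivAt u (B₀ (u t) - ((t ^ 2 / 2 : ℝ) : ℂ) • B₁ (u t) + c 0 t • e) t) :
    ∃ v : ℕ → ℝ → U, v 0 = u ∧ (∀ k t, HasDerivAt (v k) (v (k + 1) t) t) ∧
      ∀ k t, v (k + 1) t = B₀ (v k t) - ((t ^ 2 / 2 : ℝ) : ℂ) • B₁ (v k t)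
        - ((k * t : ℝ) : ℂ) • B₁ (v (k - 1) t) - ((k.choose 2 : ℝ) : ℂ) • B₁ (v (k - 2) t)
        + c k t • e := by
  set tw := derivTower (fun k a b v t => B₀ (v t) - ((t ^ 2 / 2 : ℝ) : ℂ) • B₁ (v t)
        - ((k * t : ℝ) : ℂ) • B₁ (b t) - ((k.choose 2 : ℝ) : ℂ) • B₁ (a t)
        + c k t • e) (0 : ℝ → U) u with htw
  have r1 : ∀ k, (tw (k + 1)).2.1 = (tw k).2.2 := fun k => rfl
  have r0 : ∀ k, (tw (k + 2)).1 = (tw k).2.2 := fun k => rfl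
  have hrec : ∀ k t, (tw (k + 1)).2.2 t = B₀ ((tw k).2.2 t) - ((t ^ 2 / 2 : ℝ) : ℂ) • B₁ ((tw k).2.2 t)
        - ((k * t : ℝ) : ℂ) • B₁ ((tw (k - 1)).2.2 t) - ((k.choose 2 : ℝ) : ℂ) • B₁ ((tw (k - 2)).2.2 t)
        + c k t • e := by
    intro k t
    have : (tw (k + 1)).2.2 t = B₀ ((tw k).2.2 t) - ((t ^ 2 / 2 : ℝ) : ℂ) • B₁ ((tw k).2.2 t)
        - ((k * t : ℝ) : ℂ) • B₁ ((tw k).2.1 t) - ((k.choose 2 : ℝ) : ℂ) • B₁ ((tw k).1 t)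
        + c k t • e := rfl
    rw [this]
    match k with
    | 0 => simp
    | 1 => simp [r1]
    | k + 2 => simp [r1, r0]
  refine ⟨fun k => (tw k).2.2, rfl, ?_, hrec⟩
  intro k
  induction k using Nat.strong_induction_on with
  | _ k ih =>
  intro t
  match k, ih with
  | 0, _ =>
    have := hrec 0 t
    simp only [Nat.cast_zero, zero_mul, Complex.ofReal_zero, zero_smul, sub_zero,
      Nat.choose_zero_succ] at this
    simp only [zero_add] at this ⊢
    rw [this]
    exact hu t
  | k + 1, ih =>
    have hprev : ∀ j t, j < k + 1 → HasDerivAt (tw j).2.2 ((tw (j + 1)).2.2 t) t :=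
      fun j t hj => ih j hj t
    have hB : ∀ (B : U →L[ℂ] U) j, j < k + 1 →
        HasDerivAt (fun s => B ((tw j).2.2 s)) (B ((tw (j + 1)).2.2 t)) t := fun B j hj =>
      (B.restrictScalars ℝ).hasFDerivAt.comp_hasDerivAt t (hprev j t hj)
    have hq : HasDerivAt (fun t : ℝ => ((t ^ 2 / 2 : ℝ) : ℂ)) ((t : ℝ) : ℂ) t :=
      (((hasDerivAt_pow 2 t).div_const 2).congr_deriv (by norm_num)).ofReal_comp
    have hl : HasDerivAt (fun t : ℝ => ((k * t : ℝ) : ℂ)) ((k : ℝ) : ℂ) t :=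
      (((hasDerivAt_id t).const_mul (k : ℝ)).congr_deriv (by simp)).ofReal_comp
    have hfun : (tw (k + 1)).2.2 = fun t => B₀ ((tw k).2.2 t) - ((t ^ 2 / 2 : ℝ) : ℂ) • B₁ ((tw k).2.2 t)
        - ((k * t : ℝ) : ℂ) • B₁ ((tw (k - 1)).2.2 t) - ((k.choose 2 : ℝ) : ℂ) • B₁ ((tw (k - 2)).2.2 t)
        + c k t • e := funext (hrec k)
    have D := ((((hB B₀ k k.lt_succ_self).sub (hq.smul (hB B₁ k k.lt_succ_self))).sub
      (hl.smul (hB B₁ (k - 1) (by omega)))).sub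
      ((hB B₁ (k - 2) (by omega)).const_smul ((k.choose 2 : ℝ) : ℂ))).add ((hc k t).smul_const e)
    have D' := D.congr_of_eventuallyEq (Eventually.of_forall fun s => congrFun hfun s)
    refine D'.congr_deriv (Eq.trans ?_ (hrec (k + 1) t).symm)
    match k with
    | 0 => simp; abel
    | 1 => simp [Nat.choose]; module
    | k + 2 =>
      have : ((k + 2 + 1).choose 2 : ℂ) = (k + 2 : ℂ) + ((k + 2).choose 2 : ℂ) := by
        rw [Nat.choose_succ_succ' (k + 2) 1]; simp
      simp only [Nat.add_sub_cancel]
      push_cast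
      rw [this]
      module

lemma norm_sub_quadratic_smul_le {U : Type*} [NormedAddCommGroup U] [NormedSpace ℂ U]
    (B₀ B₁ : U →L[ℂ] U) (t : ℝ) :
    ‖B₀ - ((t ^ 2 / 2 : ℝ) : ℂ) • B₁‖ ≤ (1 + ‖B₀‖ + ‖B₁‖) * (1 + t ^ 2) := by
  refine (norm_sub_le _ _).trans ?_
  rw [norm_smul, Complex.norm_real, Real.norm_of_nonneg (by positivity)]
  nlinarith [norm_nonneg B₀, norm_nonneg B₁, sq_nonneg t, mul_nonneg (norm_nonneg B₀) (sq_nonneg t),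
    mul_nonneg (norm_nonneg B₁) (sq_nonneg t)]

lemma exists_galerkin (S : Submodule ℂ (E × E)) [FiniteDimensional ℂ S]
    (hinj : ∀ p ∈ S, p.1 = 0 → p.2 = 0) (e₀ : E) (c : ℕ → ℝ → ℂ)
    (hc : ∀ k t, HasDerivAt (c k) (c (k + 1) t) t) (C : ℝ) (hC : ∀ t, ‖c 0 t‖ ≤ C)
    (T : ℝ) (hT : ∀ k t, T ≤ t → c k t = 0) :
    ∃ w d : ℕ → ℝ → E, (∀ k t, (w k t, d k t) ∈ S) ∧ (∀ k t, HasDerivAt (w k) (w (k + 1) t) t) ∧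
      (∀ k t, HasDerivAt (d k) (d (k + 1) t) t) ∧
      (∀ p ∈ S, ∀ k t, WeakEq w d (fun k t => c k t • e₀) p k t) ∧ ∀ k t, T ≤ t → w k t = 0 := by
  set f : S →ₗ[ℂ] E := (LinearMap.fst ℂ E E).comp S.subtype with hf
  have finj : Injective f := by
    rw [← LinearMap.ker_eq_bot, LinearMap.ker_eq_bot']
    rintro ⟨p, hp⟩ h
    have h1 : p.1 = 0 := h
    have h2 := hinj p hp h1
    exact Subtype.ext (Prod.ext h1 h2)
  set U := LinearMap.range f
  set ee : S ≃ₗ[ℂ] U := LinearEquiv.ofInjective f finj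
  have : FiniteDimensional ℂ U := inferInstance
  have : CompleteSpace U := FiniteDimensional.complete ℂ U
  set D : U →L[ℂ] E := LinearMap.toContinuousLinearMap
    ((LinearMap.snd ℂ E E).comp (S.subtype.comp ee.symm.toLinearMap)) with hD
  set J : U →L[ℂ] E := U.subtypeL
  have hpair : ∀ u : U, (J u, D u) = (ee.symm u : E × E) := by
    intro u
    refine Prod.ext ?_ rfl
    have : f (ee.symm u) = (u : E) := by
      have := congrArg Subtype.val (ee.apply_symm_apply u)
      exact this
    exact this.symm
  have hmem : ∀ u : U, (J u, D u) ∈ S := fun u => by rw [hpair]; exact (ee.symm u).2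
  set B₀ : U →L[ℂ] U := (-(Complex.I / 2)) • (ContinuousLinearMap.adjoint D).comp D
  set B₁ : U →L[ℂ] U := (ContinuousLinearMap.adjoint J).comp D
  set K := 1 + ‖B₀‖ + ‖B₁‖ with hK
  obtain ⟨u, hu, huT⟩ := exists_linear_ode
    (fun t => (B₀ - ((t ^ 2 / 2 : ℝ) : ℂ) • B₁).restrictScalars ℝ)
    (by
      have h : Continuous (fun t : ℝ => B₀ - ((t ^ 2 / 2 : ℝ) : ℂ) • B₁) := by fun_prop
      exact (ContinuousLinearMap.restrictScalarsL ℂ U U ℝ ℝ).continuous.comp h)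
    K (by rw [hK]; nlinarith [norm_nonneg B₀, norm_nonneg B₁])
    (by
      intro t
      rw [ContinuousLinearMap.norm_restrictScalars]
      exact norm_sub_quadratic_smul_le B₀ B₁ t)
    (fun t => c 0 t • ContinuousLinearMap.adjoint J e₀)
    ((continuous_iff_continuousAt.2 fun t => (hc 0 t).continuousAt).smul continuous_const)
    (C * ‖ContinuousLinearMap.adjoint J e₀‖)
    (fun t => by rw [norm_smul]; gcongr; exact hC t) T
    (fun t ht => by simp [hT 0 t ht])
  obtain ⟨v, hv0, hvd, hvr⟩ := exists_derivTower B₀ B₁ (ContinuousLinearMap.adjoint J e₀) c hc u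
    (fun t => by simpa using hu t)
  refine ⟨fun k t => J (v k t), fun k t => D (v k t), fun k t => hmem _,
    fun k t => (J.restrictScalars ℝ).hasFDerivAt.comp_hasDerivAt t (hvd k t),
    fun k t => (D.restrictScalars ℝ).hasFDerivAt.comp_hasDerivAt t (hvd k t), ?_, ?_⟩
  · rintro p hp k t
    set u' := ee ⟨p, hp⟩
    have hp' : p = (J u', D u') := by rw [hpair]; simp [u']
    rw [hp', WeakEq]
    have hJ : ∀ x y : U, ⟪J x, J y⟫ = ⟪x, y⟫ := fun x y => rfl
    have hadj : ∀ (x : U) (A : U →L[ℂ] E) y, ⟪x, ContinuousLinearMap.adjoint A y⟫ = ⟪A x, y⟫ :=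
      fun x A y => ContinuousLinearMap.adjoint_inner_right _ _ _
    simp only
    rw [hJ, hvr]
    simp only [inner_add_right, inner_sub_right, inner_smul_right, B₀, B₁,
      smul_apply, ContinuousLinearMap.comp_apply, hadj]
  · have key : ∀ k t, T ≤ t → v k t = 0 := by
      intro k
      induction k using Nat.strong_induction_on with
      | _ k ih =>
      intro t ht
      match k, ih with
      | 0, _ => rw [hv0, huT t ht]
      | k + 1, ih =>
        rw [hvr, ih k (by omega) t ht, ih (k - 1) (by omega) t ht, ih (k - 2) (by omega) t ht,
          hT k t ht]
        simp
    intro k t ht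
    simp [key k t ht]
end Galerkin

section Cutoff

lemma hasDerivAt_iteratedDeriv {F : Type*} [NormedAddCommGroup F] [NormedSpace ℝ F] {f : ℝ → F}
    (hf : ContDiff ℝ (⊤ : ℕ∞) f) (k : ℕ) (t : ℝ) :
    HasDerivAt (iteratedDeriv k f) (iteratedDeriv (k + 1) f t) t := by
  rw [iteratedDeriv_succ]
  exact ((hf.differentiable_iteratedDeriv k (by exact_mod_cast WithTop.coe_lt_top k)) t).hasDerivAt

lemma iteratedDeriv_eq_of_hasDerivAt {F : Type*} [NormedAddCommGroup F] [NormedSpace ℝ F]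
    {γ : ℕ → ℝ → F} (h : ∀ k t, HasDerivAt (γ k) (γ (k + 1) t) t) (k : ℕ) :
    iteratedDeriv k (γ 0) = γ k := by
  induction k with
  | zero => exact iteratedDeriv_zero
  | succ k ih => rw [iteratedDeriv_succ, ih]; ext t; exact (h k t).deriv

lemma contDiff_of_hasDerivAt {F : Type*} [NormedAddCommGroup F] [NormedSpace ℝ F]
    {γ : ℕ → ℝ → F} (h : ∀ k t, HasDerivAt (γ k) (γ (k + 1) t) t) :
    ContDiff ℝ (⊤ : ℕ∞) (γ 0) := by
  refine contDiff_of_differentiable_iteratedDeriv fun m _ => ?_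
  rw [iteratedDeriv_eq_of_hasDerivAt h]
  exact fun t => (h m t).differentiableAt

/-- A rapidly decaying smooth function is approximated by compactly supported ones, with
uniform rapid bounds on all derivatives. -/
lemma exists_cutoff (γ : ℕ → ℝ → ℂ) (hγ : ∀ k t, HasDerivAt (γ k) (γ (k + 1) t) t)
    (hr : ∀ k, RapidFam (fun (_ : Unit) t => ‖γ k t‖)) :
    ∃ c : ℕ → ℕ → ℝ → ℂ, (∀ n k t, HasDerivAt (c n k) (c n (k + 1) t) t) ∧
      (∀ k, RapidFam (fun n t => ‖c n k t‖)) ∧ (∀ n, ∃ C, ∀ t, ‖c n 0 t‖ ≤ C) ∧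
      (∀ n, ∃ T, ∀ k t, T ≤ t → c n k t = 0) ∧
      ∀ k t, ∀ᶠ n in atTop, c n k t = γ k t := by
  let b : ContDiffBump (0 : ℝ) := ⟨1, 2, by norm_num, by norm_num⟩
  let η : ℝ → ℂ := fun x => (b x : ℂ)
  have hη : ContDiff ℝ (⊤ : ℕ∞) η := Complex.ofRealCLM.contDiff.comp b.contDiff
  have hηs : HasCompactSupport η := b.hasCompactSupport.comp_left (g := fun x : ℝ => (x : ℂ)) (by simp)
  have hη1 : ∀ x, |x| ≤ 1 → η x = 1 := fun x hx => by
    simp only [η]; rw [b.one_of_mem_closedBall (by simpa using hx)]; simp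
  have hη0 : ∀ x, 2 ≤ |x| → η x = 0 := fun x hx => by
    simp only [η]; rw [b.zero_of_le_dist (by simpa using hx)]; simp
  have hηb : ∀ j, ∃ C, 0 ≤ C ∧ ∀ x, ‖iteratedDeriv j η x‖ ≤ C := by
    intro j
    obtain ⟨C, hC⟩ := (hη.continuous_iteratedFDeriv (m := j) (by exact_mod_cast le_top)).bounded_above_of_compact_support
      (hηs.iteratedFDeriv j)
    exact ⟨C, (norm_nonneg _).trans (hC 0), fun x => by
      rw [← norm_iteratedFDeriv_eq_norm_iteratedDeriv]; exact hC x⟩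
  choose Cη hCη0 hCη using hηb
  let e : ℕ → ℝ → ℂ := fun n t => η (((n : ℝ) + 1)⁻¹ • t)
  have he : ∀ n, ContDiff ℝ (⊤ : ℕ∞) (e n) := fun n => hη.comp (contDiff_const_smul _)
  have hγs := contDiff_of_hasDerivAt hγ
  have heb : ∀ n j t, ‖iteratedDeriv j (e n) t‖ ≤ Cη j := by
    intro n j t
    have : iteratedDeriv j (e n) t = ((n : ℝ) + 1)⁻¹ ^ j • iteratedDeriv j η (((n : ℝ) + 1)⁻¹ • t) :=
      congrFun (iteratedDeriv_comp_const_smul (hη.of_le (by exact_mod_cast le_top)) _) t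
    rw [this, norm_smul, norm_pow, Real.norm_of_nonneg (by positivity)]
    have h1 : ((n : ℝ) + 1)⁻¹ ^ j ≤ 1 := pow_le_one₀ (by positivity) (inv_le_one_of_one_le₀ (by simp))
    calc _ ≤ 1 * Cη j := mul_le_mul h1 (hCη j _) (norm_nonneg _) zero_le_one
      _ = _ := one_mul _
  have hsm : ∀ n, ContDiff ℝ (⊤ : ℕ∞) (fun t => e n t * γ 0 t) := fun n => (he n).mul hγs
  refine ⟨fun n k => iteratedDeriv k (fun t => e n t * γ 0 t),
    fun n k t => hasDerivAt_iteratedDeriv (hsm n) k t, ?_, ?_, ?_, ?_⟩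
  · intro k
    have hform : ∀ n t, iteratedDeriv k (fun t => e n t * γ 0 t) t =
        ∑ j ∈ Finset.range (k + 1), (k.choose j : ℂ) * iteratedDeriv j (e n) t * γ (k - j) t := by
      intro n t
      rw [iteratedDeriv_fun_mul ((he n).of_le (by exact_mod_cast le_top)).contDiffAt
        (hγs.of_le (by exact_mod_cast le_top)).contDiffAt]
      simp_rw [iteratedDeriv_eq_of_hasDerivAt hγ]
    have hR : ∀ s : Finset ℕ, RapidFam (fun (_ : ℕ) t => ∑ j ∈ s, (k.choose j * Cη j) * ‖γ (k - j) t‖) := by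
      intro s
      induction s using Finset.induction_on with
      | empty => simpa using RapidFam.zero
      | insert a s ha ih =>
        simp_rw [Finset.sum_insert ha]
        exact (((hr (k - a)).comp_index (fun _ : ℕ => ())).const_mul _).add ih
    refine (hR (Finset.range (k + 1))).mono fun n t => ?_
    rw [abs_of_nonneg (norm_nonneg _)]
    refine le_trans ?_ (le_abs_self _)
    simp only [hform]
    refine (norm_sum_le _ _).trans (Finset.sum_le_sum fun j _ => ?_)
    rw [norm_mul, norm_mul, Complex.norm_natCast]
    gcongr
    exact heb n j t
  · intro n
    have hs : HasCompactSupport (fun t => e n t * γ 0 t) := by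
      refine HasCompactSupport.mul_right ?_
      exact hηs.comp_smul (by positivity)
    simpa using (hsm n).continuous.bounded_above_of_compact_support hs
  · intro n
    refine ⟨2 * (n + 1) + 1, fun k t ht => ?_⟩
    have : (fun t => e n t * γ 0 t) =ᶠ[nhds t] fun _ => 0 := by
      filter_upwards [Ioi_mem_nhds (show 2 * ((n : ℝ) + 1) < t by linarith)] with s hs
      have h2 : 2 ≤ |((n : ℝ) + 1)⁻¹ • s| := by
        rw [smul_eq_mul, inv_mul_eq_div]
        refine le_trans ?_ (le_abs_self _)
        rw [le_div_iff₀ (by positivity)]; exact le_of_lt hs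
      simp only [e, hη0 _ h2, zero_mul]
    simp only
    rw [this.iteratedDeriv_eq]; simp
  · intro k t
    filter_upwards [(tendsto_natCast_atTop_atTop (R := ℝ)).eventually (eventually_gt_atTop |t|)] with n hn
    have : (fun t => e n t * γ 0 t) =ᶠ[nhds t] γ 0 := by
      filter_upwards [(continuous_abs.tendsto t).eventually (gt_mem_nhds hn)] with s hs
      have h2 : |((n : ℝ) + 1)⁻¹ • s| ≤ 1 := by
        rw [smul_eq_mul, inv_mul_eq_div, abs_div, abs_of_pos (show (0:ℝ) < n + 1 by positivity),
          div_le_one (by positivity)]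
        linarith
      simp only [e, hη1 _ h2, one_mul]
    rw [this.iteratedDeriv_eq, iteratedDeriv_eq_of_hasDerivAt hγ]
end Cutoff

section WeakLimit
variable {E : Type*} [NormedAddCommGroup E] [InnerProductSpace ℂ E] [CompleteSpace E]

local notation "⟪" x "," y "⟫" => inner ℂ x y

lemma exists_weak_limit {ι : Type*} (𝒰 : Ultrafilter ι) (x : ι → E) (C : ℝ) (hx : ∀ i, ‖x i‖ ≤ C) :
    ∃ y : E, ∀ v, Tendsto (fun i => ⟪v, x i⟫) 𝒰 (nhds ⟪v, y⟫) := by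
  have hc := WeakDual.isCompact_closedBall (𝕜 := ℂ) (E := E) 0 C
  let L : ι → WeakDual ℂ E := fun i => StrongDual.toWeakDual (InnerProductSpace.toDual ℂ E (x i))
  have hmem : ∀ i, L i ∈ WeakDual.toStrongDual ⁻¹' Metric.closedBall (0 : StrongDual ℂ E) C := by
    intro i
    simp only [mem_preimage, mem_closedBall_zero_iff]
    change ‖InnerProductSpace.toDual ℂ E (x i)‖ ≤ C
    rw [LinearIsometryEquiv.norm_map]; exact hx i
  obtain ⟨ℓ, -, hℓ⟩ := hc.ultrafilter_le_nhds (𝒰.map L) (by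
    rw [le_principal_iff]; exact Filter.mem_map.2 (Filter.univ_mem' hmem))
  have ht : Tendsto L 𝒰 (nhds ℓ) := hℓ
  refine ⟨(InnerProductSpace.toDual ℂ E).symm (WeakDual.toStrongDual ℓ), fun v => ?_⟩
  have h1 : Tendsto (fun i => L i v) 𝒰 (nhds (ℓ v)) := ((WeakDual.eval_continuous v).tendsto ℓ).comp ht
  have h2 := (Complex.continuous_conj.tendsto _).comp h1
  have e1 : ∀ i, (starRingEnd ℂ) (L i v) = ⟪v, x i⟫ := fun i => by
    rw [← inner_conj_symm]; rfl
  have e2 : (starRingEnd ℂ) (ℓ v) = ⟪v, (InnerProductSpace.toDual ℂ E).symm (WeakDual.toStrongDual ℓ)⟫ := by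
    rw [← inner_conj_symm, InnerProductSpace.toDual_symm_apply]; rfl
  rw [← e2]
  refine h2.congr fun i => e1 i

lemma norm_le_of_weak_limit {ι : Type*} {𝒰 : Filter ι} [𝒰.NeBot] {x : ι → E} {y : E} {C : ℝ}
    (hx : ∀ i, ‖x i‖ ≤ C) (hy : ∀ v, Tendsto (fun i => ⟪v, x i⟫) 𝒰 (nhds ⟪v, y⟫)) : ‖y‖ ≤ C := by
  have h1 : ‖⟪y, y⟫‖ ≤ ‖y‖ * C := le_of_tendsto (hy y).norm (Eventually.of_forall fun i =>
    (norm_inner_le_norm _ _).trans (mul_le_mul_of_nonneg_left (hx i) (norm_nonneg _)))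
  rw [inner_self_eq_norm_sq_to_K] at h1
  simp only [norm_pow, RCLike.norm_ofReal, abs_norm] at h1
  rcases (norm_nonneg y).eq_or_lt with h | h
  · obtain ⟨i⟩ := 𝒰.nonempty_of_neBot
    rw [← h]; exact (norm_nonneg _).trans (hx i)
  · nlinarith

lemma hasDerivAt_weak_limit {ι : Type*} {𝒰 : Filter ι} [𝒰.NeBot] {x : ι → ℕ → ℝ → E}
    {y : ℕ → ℝ → E} (hx : ∀ i k t, HasDerivAt (x i k) (x i (k + 1) t) t)
    (hr : ∀ k, RapidFam (fun i t => ‖x i k t‖))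
    (hy : ∀ k t v, Tendsto (fun i => ⟪v, x i k t⟫) 𝒰 (nhds ⟪v, y k t⟫)) (k : ℕ) (t : ℝ) :
    HasDerivAt (y k) (y (k + 1) t) t := by
  obtain ⟨C, hC⟩ := hr (k + 2) 0 (1 - t)
  have hC' : ∀ i s, t - 1 ≤ s → ‖x i (k + 2) s‖ ≤ C := fun i s hs => by
    simpa using hC i s (by linarith)
  have tay : ∀ i s, |s - t| ≤ 1 → ‖x i k s - x i k t - (s - t) • x i (k + 1) t‖ ≤ C * |s - t| * |s - t| := by
    intro i s hs
    have hu : ∀ r ∈ uIcc t s, |r - t| ≤ |s - t| := fun r hr => by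
      rw [abs_sub_comm r, abs_sub_comm s]; exact abs_sub_left_of_mem_uIcc hr |> fun h => by
        simpa [abs_sub_comm] using h
    have h1 : ∀ r ∈ uIcc t s, ‖x i (k + 1) r - x i (k + 1) t‖ ≤ C * |s - t| := by
      intro r hr
      have := (convex_uIcc t s).norm_image_sub_le_of_norm_hasDerivWithin_le (f := x i (k + 1))
        (f' := x i (k + 2)) (C := C) (fun q _ => (hx i (k + 1) q).hasDerivWithinAt)
        (fun q hq => hC' i q (by have := hu q hq; rw [abs_le] at this; linarith [this.1]))
        left_mem_uIcc hr
      refine this.trans ?_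
      rw [Real.norm_eq_abs]
      have hC0 : 0 ≤ C := (norm_nonneg _).trans (hC' i t (by linarith))
      exact mul_le_mul_of_nonneg_left (hu r hr) hC0
    have h2 := (convex_uIcc t s).norm_image_sub_le_of_norm_hasDerivWithin_le
      (f := fun r => x i k r - (r - t) • x i (k + 1) t)
      (f' := fun r => x i (k + 1) r - x i (k + 1) t) (C := C * |s - t|)
      (fun q _ => by
        have := (hx i k q).fun_sub (((hasDerivAt_id' q).sub_const t).smul_const (x i (k + 1) t))
        simpa using this.hasDerivWithinAt) h1 left_mem_uIcc right_mem_uIcc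
    rw [Real.norm_eq_abs] at h2
    refine le_trans (le_of_eq ?_) h2
    congr 1
    simp only [sub_self, zero_smul, sub_zero]
    abel
  have ylim : ∀ s, |s - t| ≤ 1 → ‖y k s - y k t - (s - t) • y (k + 1) t‖ ≤ C * |s - t| * |s - t| := by
    intro s hs
    refine norm_le_of_weak_limit (𝒰 := 𝒰) (fun i => tay i s hs) fun v => ?_
    have e : ∀ a b c : E, ⟪v, a - b - (s - t) • c⟫ = ⟪v, a⟫ - ⟪v, b⟫ - ((s - t : ℝ) : ℂ) * ⟪v, c⟫ := by
      intro a b c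
      rw [inner_sub_right, inner_sub_right, ← Complex.coe_smul, inner_smul_right]
    simp_rw [e]
    exact ((hy k s v).sub (hy k t v)).sub ((hy (k + 1) t v).const_mul _)
  rw [hasDerivAt_iff_isLittleO, Asymptotics.isLittleO_iff]
  intro ε hε
  have hC1 : 0 < |C| + 1 := by positivity
  filter_upwards [Metric.ball_mem_nhds t (show 0 < min 1 (ε / (|C| + 1)) by positivity)] with s hs
  rw [Metric.mem_ball, Real.dist_eq, lt_min_iff] at hs
  refine (ylim s hs.1.le).trans ?_
  rw [Real.norm_eq_abs]
  refine mul_le_mul_of_nonneg_right ?_ (abs_nonneg _)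
  have := hs.2
  rw [lt_div_iff₀ hC1] at this
  nlinarith [le_abs_self C, abs_nonneg (s - t), abs_nonneg C]

lemma mem_of_weak_limit {ι : Type*} {𝒰 : Filter ι} [𝒰.NeBot] {Γ : Submodule ℂ (E × E)}
    (hΓ : IsClosed (Γ : Set (E × E))) {x x' : ι → E} {y y' : E} (hx : ∀ i, (x i, x' i) ∈ Γ)
    (hy : ∀ v, Tendsto (fun i => ⟪v, x i⟫) 𝒰 (nhds ⟪v, y⟫))
    (hy' : ∀ v, Tendsto (fun i => ⟪v, x' i⟫) 𝒰 (nhds ⟪v, y'⟫)) : (y, y') ∈ Γ := by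
  by_contra hcon
  obtain ⟨f, u, hf1, hf2⟩ := RCLike.geometric_hahn_banach_closed_point (𝕜 := ℂ) (s := (Γ : Set (E × E)))
    (Γ.restrictScalars ℝ).convex hΓ hcon
  set a := (InnerProductSpace.toDual ℂ E).symm (f.comp (ContinuousLinearMap.inl ℂ E E))
  set b := (InnerProductSpace.toDual ℂ E).symm (f.comp (ContinuousLinearMap.inr ℂ E E))
  have hfe : ∀ p q : E, f (p, q) = ⟪a, p⟫ + ⟪b, q⟫ := by
    intro p q
    rw [InnerProductSpace.toDual_symm_apply, InnerProductSpace.toDual_symm_apply]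
    simp only [ContinuousLinearMap.comp_apply, ← map_add]
    simp
  have lim : Tendsto (fun i => RCLike.re (f (x i, x' i))) 𝒰 (nhds (RCLike.re (f (y, y')))) := by
    simp_rw [hfe]
    exact (RCLike.continuous_re.tendsto _).comp ((hy a).add (hy' b))
  have : RCLike.re (f (y, y')) ≤ u := le_of_tendsto lim (Eventually.of_forall fun i => (hf1 _ (hx i)).le)
  linarith
end WeakLimit

lemma RapidFam.tendsto {ι : Type*} {f : ι → ℝ → ℝ} (hf : RapidFam f) (i : ι) :
    Tendsto (f i) atTop (nhds 0) := by
  obtain ⟨C, hC⟩ := hf 1 0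
  have h1 : Tendsto (fun t : ℝ => C * (1 + t ^ 2)⁻¹) atTop (nhds 0) := by
    have : Tendsto (fun t : ℝ => 1 + t ^ 2) atTop atTop :=
      tendsto_atTop_add_const_left _ _ (tendsto_pow_atTop (by norm_num))
    simpa using this.inv_tendsto_atTop.const_mul C
  refine squeeze_zero_norm' ?_ h1
  filter_upwards [eventually_ge_atTop 0] with t ht
  have := hC i t (by linarith)
  rw [Real.norm_eq_abs, ← div_eq_mul_inv, le_div_iff₀ (by positivity), mul_comm]
  simpa using this

section AbstractEvolution
variable {E : Type*} [NormedAddCommGroup E] [InnerProductSpace ℂ E]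

local notation "⟪" x "," y "⟫" => inner ℂ x y

/-- Existence for the abstract evolution equation with rapidly decaying rank-one source. -/
theorem exists_abstract_evolution [CompleteSpace E] (Γ : Submodule ℂ (E × E))
    (hΓ : IsClosed (Γ : Set (E × E)))
    (hskew : ∀ p ∈ Γ, ∀ q ∈ Γ, ⟪p.1, q.2⟫ + ⟪p.2, q.1⟫ = 0)
    (hinj : ∀ p ∈ Γ, p.1 = 0 → p.2 = 0) (e₀ : E) (γ : ℕ → ℝ → ℂ)
    (hγ : ∀ k t, HasDerivAt (γ k) (γ (k + 1) t) t)
    (hr : ∀ k, RapidFam (fun (_ : Unit) t => ‖γ k t‖)) :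
    ∃ w d : ℕ → ℝ → E, (∀ k t, (w k t, d k t) ∈ Γ) ∧ (∀ k t, HasDerivAt (w k) (w (k + 1) t) t) ∧
      (∀ k t, HasDerivAt (d k) (d (k + 1) t) t) ∧
      (∀ p ∈ Γ, ∀ k t, WeakEq w d (fun k t => γ k t • e₀) p k t) ∧
      (∀ k, RapidFam (fun (_ : Unit) t => ‖w k t‖)) ∧
      ∀ k, RapidFam (fun (_ : Unit) t => ‖d k t‖) := by
  classical
  obtain ⟨c, hc, hcr, hcb, hcT, hclim⟩ := exists_cutoff γ hγ hr
  choose C hC using hcb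
  choose T hT using hcT
  let S : Finset Γ → Submodule ℂ (E × E) := fun s => Submodule.span ℂ ((s.image Subtype.val : Finset (E × E)) : Set (E × E))
  have hSΓ : ∀ s, S s ≤ Γ := fun s => by
    refine Submodule.span_le.2 fun p hp => ?_
    simp only [Finset.coe_image, mem_image] at hp
    obtain ⟨q, -, rfl⟩ := hp
    exact q.2
  have hG := fun i : Finset Γ × ℕ => by
    have : FiniteDimensional ℂ (S i.1) := FiniteDimensional.span_finset ℂ _
    exact exists_galerkin (S i.1) (fun p hp => hinj p (hSΓ _ hp)) e₀ (c i.2) (hc i.2) (C i.2) (hC i.2)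
      (T i.2) (hT i.2)
  choose w d hmem hw hd heq hzero using hG
  have hen := fun k => energy_of_weakEq w d (fun i k t => c i.2 k t • e₀)
    (fun _ => ContinuousLinearMap.id ℂ E) (fun _ => 0)
    (fun _ _ _ => rfl) (fun _ _ _ => by simp) (fun _ _ => by simp) hw
    (fun i k t => by
      have := hskew _ (hSΓ _ (hmem i k t)) _ (hSΓ _ (hmem i k t))
      simpa using this)
    (fun i k t => by simpa using heq i _ (hmem i k t) k t)
    (fun k => by
      refine (((hcr k).comp_index (fun i : Finset Γ × ℕ => i.2)).const_mul ‖e₀‖).mono fun i t => ?_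
      simp only [ContinuousLinearMap.id_apply, norm_smul, mul_comm, abs_mul, abs_norm, le_refl])
    (fun k => by simpa using RapidFam.zero) (fun k => by simpa using RapidFam.zero)
    (fun k i => by
      refine tendsto_const_nhds.congr' ?_
      filter_upwards [eventually_ge_atTop (T i.2)] with t ht
      simp [hzero i k t ht]) k
  simp only [ContinuousLinearMap.id_apply] at hen
  let 𝒰 : Ultrafilter (Finset Γ × ℕ) := Ultrafilter.of atTop
  have h𝒰 : (𝒰 : Filter (Finset Γ × ℕ)) ≤ atTop := Ultrafilter.of_le _
  have bdd : ∀ {f : Finset Γ × ℕ → ℝ → E}, RapidFam (fun i t => ‖f i t‖) → ∀ t, ∃ C, ∀ i, ‖f i t‖ ≤ C := by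
    intro f hf t
    obtain ⟨C, hC⟩ := hf 0 (-t)
    exact ⟨C, fun i => by simpa using hC i t (by linarith)⟩
  have hW : ∀ k t, ∃ y : E, ∀ v, Tendsto (fun i => ⟪v, w i k t⟫) 𝒰 (nhds ⟪v, y⟫) := fun k t => by
    obtain ⟨C, hC⟩ := bdd (hen k).1 t
    exact exists_weak_limit 𝒰 _ C hC
  have hD : ∀ k t, ∃ y : E, ∀ v, Tendsto (fun i => ⟪v, d i k t⟫) 𝒰 (nhds ⟪v, y⟫) := fun k t => by
    obtain ⟨C, hC⟩ := bdd (hen k).2 t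
    exact exists_weak_limit 𝒰 _ C hC
  choose w' hw' using hW
  choose d' hd' using hD
  have rap : ∀ {f : Finset Γ × ℕ → ℝ → E} {g : ℝ → E}, RapidFam (fun i t => ‖f i t‖) →
      (∀ t v, Tendsto (fun i => ⟪v, f i t⟫) 𝒰 (nhds ⟪v, g t⟫)) → RapidFam (fun (_ : Unit) t => ‖g t‖) := by
    intro f g hf hg N M
    obtain ⟨C, hC⟩ := hf N M
    refine ⟨C, fun _ t ht => ?_⟩
    have hp : 0 < (1 + t ^ 2) ^ N := by positivity
    rw [abs_norm, ← le_div_iff₀' hp]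
    refine norm_le_of_weak_limit (fun i => ?_) (hg t)
    rw [le_div_iff₀' hp]
    simpa using hC i t ht
  refine ⟨w', d', fun k t => mem_of_weak_limit hΓ (fun i => hSΓ _ (hmem i k t)) (hw' k t) (hd' k t),
    hasDerivAt_weak_limit hw (fun k => (hen k).1) hw', hasDerivAt_weak_limit hd (fun k => (hen k).2) hd',
    fun p hp k t => ?_, fun k => rap (hen k).1 (hw' k), fun k => rap (hen k).2 (hd' k)⟩
  have hF : Tendsto (fun i : Finset Γ × ℕ => ⟪p.1, c i.2 k t • e₀⟫) 𝒰 (nhds ⟪p.1, γ k t • e₀⟫) := by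
    refine tendsto_const_nhds.congr' ?_
    have := (tendsto_snd.comp (prod_atTop_atTop_eq (α := Finset Γ) (β := ℕ)).ge).eventually (hclim k t)
    filter_upwards [h𝒰 this] with i hi
    simp only [comp_apply] at hi
    rw [hi]
  have hev : ∀ᶠ i in (𝒰 : Filter (Finset Γ × ℕ)), WeakEq (w i) (d i) (fun k t => c i.2 k t • e₀) p k t := by
    have : ∀ᶠ i : Finset Γ × ℕ in atTop, (⟨p, hp⟩ : Γ) ∈ i.1 := by
      filter_upwards [eventually_ge_atTop (({⟨p, hp⟩} : Finset Γ), 0)] with i hi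
      exact hi.1 (Finset.mem_singleton_self _)
    filter_upwards [h𝒰 this] with i hi
    exact heq i p (Submodule.subset_span (by
      simp only [Finset.coe_image, mem_image]
      exact ⟨⟨p, hp⟩, hi, rfl⟩)) k t
  refine tendsto_nhds_unique_of_eventuallyEq (hw' (k + 1) t p.1) ?_ hev
  exact (((((hd' k t p.2).const_mul _).sub ((hd' k t p.1).const_mul _)).sub
    ((hd' (k - 1) t p.1).const_mul _)).sub ((hd' (k - 2) t p.1).const_mul _)).add hF

/-- Propagation of weighted rapid decay. -/
theorem weighted_decay {κ : Type*} (Γ : Submodule ℂ (E × E))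
    (hskew : ∀ p ∈ Γ, ∀ q ∈ Γ, ⟪p.1, q.2⟫ + ⟪p.2, q.1⟫ = 0) (e₀ : E) (γ : ℕ → ℝ → ℂ)
    (hr : ∀ k, RapidFam (fun (_ : Unit) t => ‖γ k t‖)) (w d : ℕ → ℝ → E)
    (hmem : ∀ k t, (w k t, d k t) ∈ Γ) (hw : ∀ k t, HasDerivAt (w k) (w (k + 1) t) t)
    (heq : ∀ p ∈ Γ, ∀ k t, WeakEq w d (fun k t => γ k t • e₀) p k t)
    (hwr : ∀ k, RapidFam (fun (_ : Unit) t => ‖w k t‖))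
    (hdr : ∀ k, RapidFam (fun (_ : Unit) t => ‖d k t‖))
    (M K : κ → E →L[ℂ] E) (hM : ∀ i x y, ⟪M i x, y⟫ = ⟪x, M i y⟫) (hK : ∀ i x y, ⟪K i x, y⟫ = ⟪x, K i y⟫)
    (hMK : ∀ i, Commute (M i) (K i)) (hK1 : ∀ i, ‖K i‖ ≤ 1)
    (hMΓ : ∀ i, ∀ p ∈ Γ, (M i p.1, K i p.1 + M i p.2) ∈ Γ)
    (he : ∀ a : ℕ, ∃ C, ∀ i, ‖(M i ^ a) e₀‖ ≤ C) (a k : ℕ) :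
    RapidFam (fun i t => ‖(M i ^ a) (w k t)‖) ∧ RapidFam (fun i t => ‖(M i ^ a) (d k t)‖) := by
  have hMn : ∀ n i x y, ⟪(M i ^ n) x, y⟫ = ⟪x, (M i ^ n) y⟫ := by
    intro n i
    induction n with
    | zero => intro x y; simp
    | succ n ih =>
      intro x y
      rw [pow_succ, mul_apply_eq_comp, ih, hM, ← mul_apply_eq_comp, ← pow_succ', ← pow_succ]
  have hΓn : ∀ n i, ∀ p ∈ Γ, ((M i ^ (n + 1)) p.1, ((n + 1 : ℕ) : ℂ) • (K i * M i ^ n) p.1 + (M i ^ (n + 1)) p.2) ∈ Γ := by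
    intro n i
    induction n with
    | zero => intro p hp; simpa using hMΓ i p hp
    | succ n ih =>
      intro p hp
      have h := hMΓ i _ (ih p hp)
      convert h using 2
      · simp only
        rw [← mul_apply_eq_comp, ← pow_succ']
      · simp only
        rw [map_add, map_smul, ← mul_apply_eq_comp (M i), ← mul_apply_eq_comp (K i),
          ← mul_apply_eq_comp (M i) (M i ^ (n + 1)), ← pow_succ', ← mul_assoc (M i) (K i),
          (hMK i).eq, mul_assoc, ← pow_succ']
        push_cast
        module
  induction a generalizing k with
  | zero =>
    simp only [pow_zero, one_apply_eq_self]
    exact ⟨(hwr k).comp_index fun _ => (), (hdr k).comp_index fun _ => ()⟩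
  | succ a ih =>
    have hLb : ∀ i x, ‖(((a + 1 : ℕ) : ℂ) • (K i * M i ^ a)) x‖ ≤ |((a + 1 : ℕ) : ℝ) * ‖(M i ^ a) x‖| := by
      intro i x
      rw [abs_of_nonneg (by positivity), smul_apply, norm_smul, Complex.norm_natCast,
        mul_apply_eq_comp]
      gcongr
      exact ((K i).le_opNorm _).trans (mul_le_of_le_one_left (norm_nonneg _) (hK1 i))
    have hcomm : ∀ n i, Commute (M i ^ n) (K i) := fun n i => (hMK i).pow_left n
    have hp : ∀ i k t, ((M i ^ (a + 1)) ((M i ^ (a + 1)) (w k t)),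
        (2:ℂ) • (M i ^ (a + 1)) ((((a + 1 : ℕ) : ℂ) • (K i * M i ^ a)) (w k t)) +
          (M i ^ (a + 1)) ((M i ^ (a + 1)) (d k t))) ∈ Γ := by
      intro i k t
      have h := hΓn (2 * a + 1) i _ (hmem k t)
      have e1 : (M i ^ (a + 1)) * (M i ^ (a + 1)) = M i ^ (2 * a + 1 + 1) := by
        rw [← pow_add]; congr 1; omega
      have e2 : (2:ℂ) • ((M i ^ (a + 1)) * (((a + 1 : ℕ) : ℂ) • (K i * M i ^ a))) =
          ((2 * a + 1 + 1 : ℕ) : ℂ) • (K i * M i ^ (2 * a + 1)) := by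
        rw [mul_smul_comm, ← mul_assoc, (hcomm (a + 1) i).eq, mul_assoc, ← pow_add, smul_smul]
        congr 1
        · push_cast; ring
        · congr 2; omega
      have h1 := congrArg (fun A : E →L[ℂ] E => A (w k t)) e1
      have h2 := congrArg (fun A : E →L[ℂ] E => A (w k t)) e2
      have h3 := congrArg (fun A : E →L[ℂ] E => A (d k t)) e1
      simp only [smul_apply] at h h1 h2 h3
      rw [← h1, ← h2, ← h3] at h
      exact h
    refine energy_of_weakEq (ι := κ) (fun _ => w) (fun _ => d) (fun _ k t => γ k t • e₀)
      (fun i => M i ^ (a + 1)) (fun i => ((a + 1 : ℕ) : ℂ) • (K i * M i ^ a)) (hMn (a + 1)) ?_ ?_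
      (fun _ => hw) (fun i k t => hskew _ (hp i k t) _ (hmem k t)) (fun i k t => heq _ (hp i k t) k t)
      ?_ ?_ ?_ ?_ k
    · intro i x y
      rw [smul_apply, smul_apply, inner_smul_left, inner_smul_right, Complex.conj_natCast,
        mul_apply_eq_comp, hK, hMn, ← mul_apply_eq_comp, (hcomm a i).eq]
    · intro i x
      rw [← mul_apply_eq_comp, ← mul_apply_eq_comp]
      congr 1
      rw [mul_smul_comm, smul_mul_assoc, ← mul_assoc, (hcomm (a + 1) i).eq, mul_assoc, mul_assoc,
        ← pow_add, ← pow_add, add_comm (a + 1) a]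
    · intro k
      obtain ⟨C, hC⟩ := he (a + 1)
      refine (((hr k).comp_index fun _ => ()).const_mul C).mono fun i t => ?_
      rw [abs_norm, map_smul, norm_smul, mul_comm]
      exact (mul_le_mul_of_nonneg_right (hC i) (norm_nonneg _)).trans (le_abs_self _)
    · intro k
      exact ((ih k).1.const_mul ((a + 1 : ℕ) : ℝ)).mono fun i t => by rw [abs_norm]; exact hLb i _
    · intro k
      exact ((ih k).2.const_mul ((a + 1 : ℕ) : ℝ)).mono fun i t => by rw [abs_norm]; exact hLb i _
    · intro k i
      have h1 := ((hwr k).tendsto ()).const_mul ‖M i ^ (a + 1)‖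
      rw [mul_zero] at h1
      exact squeeze_zero (fun _ => norm_nonneg _) (fun t => (M i ^ (a + 1)).le_opNorm _) h1
end AbstractEvolution

section Primitives

theorem absolutelyContinuous_primitive {f : ℝ → ℂ} {a b : ℝ} (h : IntervalIntegrable f volume a b) :
    AbsolutelyContinuousOnInterval (fun x => ∫ v in a..x, f v) a b := by
  have hre : IntervalIntegrable (fun x => (f x).re) volume a b :=
    ⟨h.1.re, h.2.re⟩
  have him : IntervalIntegrable (fun x => (f x).im) volume a b :=
    ⟨h.1.im, h.2.im⟩
  have c1 : AbsolutelyContinuousOnInterval (fun _ : ℝ => (1:ℂ)) a b :=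
    ContDiffOn.absolutelyContinuousOnInterval contDiffOn_const
  have c2 : AbsolutelyContinuousOnInterval (fun _ : ℝ => Complex.I) a b :=
    ContDiffOn.absolutelyContinuousOnInterval contDiffOn_const
  have key := ((hre.absolutelyContinuousOnInterval_intervalIntegral (c := a) (by simp)).smul c1).add
    ((him.absolutelyContinuousOnInterval_intervalIntegral (c := a) (by simp)).smul c2)
  refine (tendsto_congr' ?_).mp key
  refine eventually_inf_principal.2 (Eventually.of_forall fun Q hQ => Finset.sum_congr rfl fun i hi => ?_)
  have hval : ∀ x ∈ uIcc a b, (((fun x => ∫ v in a..x, (f v).re) • fun _ : ℝ => (1:ℂ)) +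
      ((fun x => ∫ v in a..x, (f v).im) • fun _ : ℝ => Complex.I)) x = ∫ v in a..x, f v := by
    intro x hx
    have hfx : IntervalIntegrable f volume a x := h.mono_set (uIcc_subset_uIcc left_mem_uIcc hx)
    have e1 : ∫ v in a..x, (f v).re = (∫ v in a..x, f v).re :=
      Complex.reCLM.intervalIntegral_comp_comm hfx
    have e2 : ∫ v in a..x, (f v).im = (∫ v in a..x, f v).im :=
      Complex.imCLM.intervalIntegral_comp_comm hfx
    simp only [Pi.add_apply, Pi.smul_apply', e1, e2]
    simp [Complex.re_add_im]
  have := hQ.1 i hi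
  rw [hval _ this.1, hval _ this.2]

/-- Product rule for primitives of integrable functions. -/
theorem primitive_mul_primitive {f g : ℝ → ℂ} {b : ℝ} (hf : IntervalIntegrable f volume 0 b)
    (hg : IntervalIntegrable g volume 0 b) :
    (∫ x in (0:ℝ)..b, f x) * (∫ x in (0:ℝ)..b, g x) =
      ∫ x in (0:ℝ)..b, (f x * (∫ y in (0:ℝ)..x, g y) + (∫ y in (0:ℝ)..x, f y) * g x) := by
  have af := absolutelyContinuous_primitive hf
  have ag := absolutelyContinuous_primitive hg
  have hi : IntervalIntegrable (fun x => f x * (∫ y in (0:ℝ)..x, g y) + (∫ y in (0:ℝ)..x, f y) * g x)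
      volume 0 b :=
    (hf.mul_continuousOn ag.continuousOn).add (hg.continuousOn_mul af.continuousOn)
  have ai := absolutelyContinuous_primitive hi
  obtain ⟨C, hC⟩ := ((af.fun_smul ag).fun_sub ai).const_of_ae_hasDerivAt_zero (by
    filter_upwards [hf.ae_hasDerivAt_integral, hg.ae_hasDerivAt_integral, hi.ae_hasDerivAt_integral]
      with x h1 h2 h3 hx
    have := ((h1 hx 0 left_mem_uIcc).mul (h2 hx 0 left_mem_uIcc)).sub (h3 hx 0 left_mem_uIcc)
    simp only [sub_self] at this
    exact this)
  have h0 := hC 0 left_mem_uIcc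
  have h1 := hC b right_mem_uIcc
  rw [← h0] at h1
  simpa [sub_eq_zero] using h1

/-- A locally integrable function on the half-line with vanishing primitive vanishes. -/
theorem ae_eq_zero_of_primitive_eq_zero {f : ℝ → ℂ}
    (hf : ∀ b : ℝ, 0 ≤ b → IntervalIntegrable f volume 0 b)
    (h0 : ∀ x : ℝ, 0 < x → ∫ y in (0:ℝ)..x, f y = 0) :
    f =ᵐ[volume.restrict (Ioi 0)] 0 := by
  rw [EventuallyEq, ae_restrict_iff' measurableSet_Ioi]
  have : ∀ n : ℕ, ∀ᵐ x, x ∈ uIcc (0:ℝ) n → ∀ c ∈ uIcc (0:ℝ) n,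
      HasDerivAt (fun x => ∫ t in c..x, f t) (f x) x := fun n =>
    (hf n n.cast_nonneg).ae_hasDerivAt_integral
  filter_upwards [ae_all_iff.2 this] with x hx hx0
  obtain ⟨n, hn⟩ := exists_nat_ge x
  have h := hx n (by rw [uIcc_of_le n.cast_nonneg]; exact ⟨le_of_lt hx0, hn⟩) 0 left_mem_uIcc
  have h' : HasDerivAt (fun x => ∫ t in (0:ℝ)..x, f t) 0 x := by
    refine (hasDerivAt_const x (0:ℂ)).congr_of_eventuallyEq ?_
    filter_upwards [Ioi_mem_nhds hx0] with y hy using h0 y hy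
  exact h.unique h'

end Primitives

section HalfLine

/-- Square integrable functions on the half-line. -/
abbrev HalfL2 : Type := Lp ℂ 2 (volume.restrict (Ioi (0:ℝ)))

local notation "⟪" x "," y "⟫" => inner ℂ x y

/-- The indicator function of `(0, x]`. -/
def halfInd (x : ℝ) : HalfL2 :=
  indicatorConstLp 2 (measurableSet_Ioc : MeasurableSet (Ioc 0 x))
    (by rw [Measure.restrict_apply measurableSet_Ioc]
        exact ((measure_mono inter_subset_left).trans_lt measure_Ioc_lt_top).ne) (1:ℂ)

/-- The primitive of a square integrable function on the half-line. -/
def halfPrim (δ : HalfL2) (x : ℝ) : ℂ := ⟪halfInd x, δ⟫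

theorem halfPrim_eq (δ : HalfL2) {x : ℝ} (hx : 0 ≤ x) : halfPrim δ x = ∫ y in (0:ℝ)..x, δ y := by
  rw [halfPrim, halfInd, L2.inner_indicatorConstLp_one, Measure.restrict_restrict measurableSet_Ioc,
    inter_eq_self_of_subset_left Ioc_subset_Ioi_self, intervalIntegral.integral_of_le hx]

theorem halfInd_zero : halfInd 0 = 0 := by
  rw [halfInd]
  simp only [Ioc_self]
  exact indicatorConstLp_empty

theorem halfPrim_zero_right (δ : HalfL2) : halfPrim δ 0 = 0 := by
  rw [halfPrim, halfInd_zero, inner_zero_left]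

theorem halfPrim_add (δ ε : HalfL2) (x : ℝ) : halfPrim (δ + ε) x = halfPrim δ x + halfPrim ε x :=
  inner_add_right _ _ _

theorem halfPrim_smul (c : ℂ) (δ : HalfL2) (x : ℝ) : halfPrim (c • δ) x = c * halfPrim δ x :=
  inner_smul_right _ _ _

theorem continuous_halfInd : Continuous halfInd := by
  have hm : ∀ x y : ℝ, dist (halfInd x) (halfInd y) ≤ |x - y| ^ (1 / (2:ℝ)) := by
    intro x y
    have hs : symmDiff (Ioc 0 x) (Ioc 0 y) ⊆ Ioc (min x y) (max x y) := by
      intro z hz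
      simp only [mem_symmDiff, mem_Ioc] at hz ⊢
      grind
    have hfin : volume.restrict (Ioi (0:ℝ)) (symmDiff (Ioc 0 x) (Ioc 0 y)) ≤
        volume (Ioc (min x y) (max x y)) :=
      (Measure.restrict_apply_le _ _).trans (measure_mono hs)
    have hr : (volume.restrict (Ioi (0:ℝ))).real (symmDiff (Ioc 0 x) (Ioc 0 y)) ≤ |x - y| := by
      rw [Measure.real]
      refine (ENNReal.toReal_mono measure_Ioc_lt_top.ne hfin).trans ?_
      rw [Real.volume_Ioc, ENNReal.toReal_ofReal (by simp), max_sub_min_eq_abs']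
    rw [halfInd, halfInd, dist_indicatorConstLp_eq_norm, norm_indicatorConstLp (by norm_num) (by norm_num),
      norm_one, one_mul]
    exact Real.rpow_le_rpow measureReal_nonneg hr (by norm_num)
  refine continuous_iff_continuousAt.2 fun x => tendsto_iff_dist_tendsto_zero.2 ?_
  refine squeeze_zero (fun _ => dist_nonneg) (fun y => hm y x) ?_
  have : Tendsto (fun y : ℝ => |y - x| ^ (1 / (2:ℝ))) (nhds x) (nhds (|x - x| ^ (1 / (2:ℝ)))) :=
    (Continuous.rpow_const (by fun_prop) fun _ => Or.inr (by norm_num)).tendsto x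
  simpa using this

theorem norm_halfInd_sub_le {x y : ℝ} (hx : 0 ≤ x) (hxy : x ≤ y) (hy : y ≤ x + 1) :
    ‖halfInd y - halfInd x‖ ≤ 1 := by
  have hs : symmDiff (Ioc 0 y) (Ioc 0 x) ⊆ Ioc x y := by
    intro z hz
    simp only [mem_symmDiff, mem_Ioc] at hz ⊢
    grind
  have hfin : volume.restrict (Ioi (0:ℝ)) (symmDiff (Ioc 0 y) (Ioc 0 x)) ≤ volume (Ioc x y) :=
    (Measure.restrict_apply_le _ _).trans (measure_mono hs)
  have hr : (volume.restrict (Ioi (0:ℝ))).real (symmDiff (Ioc 0 y) (Ioc 0 x)) ≤ 1 := by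
    rw [Measure.real]
    refine (ENNReal.toReal_mono measure_Ioc_lt_top.ne hfin).trans ?_
    rw [Real.volume_Ioc, ENNReal.toReal_ofReal (by linarith)]
    linarith
  rw [← dist_eq_norm, halfInd, halfInd, dist_indicatorConstLp_eq_norm,
    norm_indicatorConstLp (by norm_num) (by norm_num), norm_one, one_mul]
  exact Real.rpow_le_one measureReal_nonneg hr (by norm_num)

theorem continuous_halfPrim (δ : HalfL2) : Continuous (halfPrim δ) :=
  continuous_halfInd.inner continuous_const

theorem HalfL2.intervalIntegrable (δ : HalfL2) {b : ℝ} (hb : 0 ≤ b) :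
    IntervalIntegrable δ volume 0 b := by
  rw [intervalIntegrable_iff_integrableOn_Ioc_of_le hb]
  have h : MemLp δ 2 (volume.restrict (Ioc 0 b)) :=
    (Lp.memLp δ).mono_measure (Measure.restrict_mono Ioc_subset_Ioi_self le_rfl)
  exact h.integrable (by norm_num)

/-- The graph of the derivative on functions vanishing at the origin. -/
def derivGraph : Submodule ℂ (HalfL2 × HalfL2) where
  carrier := {p | p.1 =ᵐ[volume.restrict (Ioi (0:ℝ))] halfPrim p.2}
  add_mem' := by
    rintro p q hp hq
    simp only [mem_ofPred_eq, Prod.fst_add, Prod.snd_add] at *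
    filter_upwards [Lp.coeFn_add p.1 q.1, hp, hq] with x h1 h2 h3
    rw [h1, Pi.add_apply, h2, h3, halfPrim_add]
  zero_mem' := by
    simp only [mem_ofPred_eq, Prod.fst_zero, Prod.snd_zero]
    filter_upwards [Lp.coeFn_zero ℂ 2 (volume.restrict (Ioi (0:ℝ)))] with x h1
    rw [h1, halfPrim, inner_zero_right, Pi.zero_apply]
  smul_mem' := by
    rintro c p hp
    simp only [mem_ofPred_eq, Prod.smul_fst, Prod.smul_snd] at *
    filter_upwards [Lp.coeFn_smul c p.1, hp] with x h1 h2
    rw [h1, Pi.smul_apply, h2, halfPrim_smul, smul_eq_mul]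

theorem mem_derivGraph {p : HalfL2 × HalfL2} :
    p ∈ derivGraph ↔ p.1 =ᵐ[volume.restrict (Ioi (0:ℝ))] halfPrim p.2 := Iff.rfl

theorem isClosed_derivGraph : IsClosed (derivGraph : Set (HalfL2 × HalfL2)) := by
  refine IsSeqClosed.isClosed fun q p hq hp => ?_
  have h1 : Tendsto (fun n => (q n).1) atTop (nhds p.1) := (continuous_fst.tendsto _).comp hp
  have h2 : Tendsto (fun n => (q n).2) atTop (nhds p.2) := (continuous_snd.tendsto _).comp hp
  obtain ⟨ns, hns, hae⟩ := (tendstoInMeasure_of_tendsto_Lp h1).exists_seq_tendsto_ae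
  have hall : ∀ᵐ x ∂(volume.restrict (Ioi (0:ℝ))), ∀ n, (q n).1 x = halfPrim (q n).2 x :=
    ae_all_iff.2 fun n => hq n
  change p.1 =ᵐ[volume.restrict (Ioi (0:ℝ))] halfPrim p.2
  filter_upwards [hae, hall] with x hx hx'
  refine tendsto_nhds_unique hx ?_
  simp only [hx']
  exact (tendsto_const_nhds.inner h2).comp hns.tendsto_atTop

theorem ae_restrict_Ioi_of_Ioc {p : ℝ → Prop} {b : ℝ} (h : ∀ᵐ x ∂(volume.restrict (Ioi (0:ℝ))), p x) :
    ∀ᵐ x, x ∈ Ioc 0 b → p x := by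
  rw [ae_restrict_iff' measurableSet_Ioi] at h
  filter_upwards [h] with x hx hx' using hx hx'.1

theorem derivGraph_skew {p q : HalfL2 × HalfL2} (hp : p ∈ derivGraph) (hq : q ∈ derivGraph) :
    ⟪p.1, q.2⟫ + ⟪p.2, q.1⟫ = 0 := by
  have i1 := L2.integrable_inner (𝕜 := ℂ) p.1 q.2
  have i2 := L2.integrable_inner (𝕜 := ℂ) p.2 q.1
  have i3 := L2.integrable_inner (𝕜 := ℂ) p.1 q.1
  rw [L2.inner_def, L2.inner_def, ← integral_add i1 i2]
  have hlim := intervalIntegral_tendsto_integral_Ioi 0 (i1.add i2) tendsto_id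
  have hval : ∀ b : ℝ, 0 ≤ b → ∫ x in (0:ℝ)..b, (⟪p.1 x, q.2 x⟫ + ⟪p.2 x, q.1 x⟫) =
      ⟪halfPrim p.2 b, halfPrim q.2 b⟫ := by
    intro b hb
    have hc : IntervalIntegrable (fun x => (starRingEnd ℂ) (p.2 x)) volume 0 b := by
      have := p.2.intervalIntegrable hb
      exact ⟨(Complex.conjCLE.toContinuousLinearMap.integrable_comp this.1),
        (Complex.conjCLE.toContinuousLinearMap.integrable_comp this.2)⟩
    have hcp : ∀ x, (0:ℝ) ≤ x → ∫ y in (0:ℝ)..x, (starRingEnd ℂ) (p.2 y) = (starRingEnd ℂ) (halfPrim p.2 x) := by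
      intro x hx
      rw [halfPrim_eq _ hx]
      exact Complex.conjCLE.toContinuousLinearMap.intervalIntegral_comp_comm (p.2.intervalIntegrable hx)
    have := primitive_mul_primitive hc (q.2.intervalIntegrable hb)
    rw [RCLike.inner_apply', ← hcp b hb, halfPrim_eq _ hb, this]
    refine intervalIntegral.integral_congr_ae ?_
    rw [uIoc_of_le hb]
    filter_upwards [ae_restrict_Ioi_of_Ioc (b := b) hp, ae_restrict_Ioi_of_Ioc (b := b) hq] with x h1 h2 hx
    rw [h1 hx, h2 hx, hcp x hx.1.le, ← halfPrim_eq _ hx.1.le, RCLike.inner_apply', RCLike.inner_apply']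
    ring
  have hlim' : Tendsto (fun b => ⟪halfPrim p.2 b, halfPrim q.2 b⟫) atTop
      (nhds (∫ x in Ioi (0:ℝ), (⟪p.1 x, q.2 x⟫ + ⟪p.2 x, q.1 x⟫))) := by
    refine hlim.congr' ?_
    filter_upwards [eventually_ge_atTop 0] with b hb using hval b hb
  refine IntegrableAtFilter.eq_zero_of_tendsto (l := atTop) (μ := volume)
    (f := fun b => ⟪halfPrim p.2 b, halfPrim q.2 b⟫) ⟨Ioi 0, Ioi_mem_atTop 0, ?_⟩ ?_ hlim'
  · refine i3.congr ?_
    filter_upwards [hp, hq] with x h1 h2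
    rw [h1, h2]
  · intro s hs
    obtain ⟨b, hb⟩ := mem_atTop_sets.1 hs
    rw [← top_le_iff, ← Real.volume_Ici (a := b)]
    exact measure_mono hb

theorem eq_zero_of_halfPrim_eq_zero {δ : HalfL2} (h : ∀ x : ℝ, 0 < x → halfPrim δ x = 0) : δ = 0 := by
  refine (Lp.eq_zero_iff_ae_eq_zero).2 (ae_eq_zero_of_primitive_eq_zero
    (fun b hb => δ.intervalIntegrable hb) fun x hx => ?_)
  rw [← halfPrim_eq _ hx.le, h x hx]

theorem eq_of_ae_eq_Ioi {f g : ℝ → ℂ} (hf : Continuous f) (hg : Continuous g)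
    (h : f =ᵐ[volume.restrict (Ioi (0:ℝ))] g) {x : ℝ} (hx : 0 ≤ x) : f x = g x := by
  have := Measure.eqOn_open_of_ae_eq h isOpen_Ioi hf.continuousOn hg.continuousOn
  have hcl := this.closure hf hg
  rw [closure_Ioi] at hcl
  exact hcl hx

theorem derivGraph_inj {p : HalfL2 × HalfL2} (hp : p ∈ derivGraph) (h0 : p.1 = 0) : p.2 = 0 := by
  refine eq_zero_of_halfPrim_eq_zero fun x hx => ?_
  refine eq_of_ae_eq_Ioi (continuous_halfPrim p.2) (continuous_const (y := (0:ℂ))) ?_ hx.le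
  have h1 := Lp.coeFn_zero ℂ 2 (volume.restrict (Ioi (0:ℝ)))
  rw [← h0] at h1
  exact (mem_derivGraph.1 hp).symm.trans h1

theorem norm_halfPrim_le {p : HalfL2 × HalfL2} (hp : p ∈ derivGraph) {x : ℝ} (hx : 0 ≤ x) :
    ‖halfPrim p.2 x‖ ≤ ‖p.1‖ + ‖p.2‖ := by
  have h1 : ∫ y in x..(x + 1), halfPrim p.2 y = ⟪halfInd (x + 1) - halfInd x, p.1⟫ := by
    rw [inner_sub_left]
    change _ = halfPrim p.1 (x + 1) - halfPrim p.1 x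
    rw [halfPrim_eq _ hx, halfPrim_eq _ (by linarith), intervalIntegral.integral_interval_sub_left
      (p.1.intervalIntegrable (by linarith)) (p.1.intervalIntegrable hx)]
    refine intervalIntegral.integral_congr_ae ?_
    rw [uIoc_of_le (by linarith)]
    filter_upwards [ae_restrict_Ioi_of_Ioc (b := x + 1) hp] with y hy hy'
    exact (hy ⟨hx.trans_lt hy'.1, hy'.2⟩).symm
  have h2 : ‖∫ y in x..(x + 1), (halfPrim p.2 y - halfPrim p.2 x)‖ ≤ ‖p.2‖ * |x + 1 - x| := by
    refine intervalIntegral.norm_integral_le_of_norm_le_const fun y hy => ?_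
    rw [uIoc_of_le (by linarith)] at hy
    rw [halfPrim, halfPrim, ← inner_sub_left]
    refine (norm_inner_le_norm _ _).trans ?_
    exact mul_le_of_le_one_left (norm_nonneg _) (norm_halfInd_sub_le hx hy.1.le hy.2)
  rw [intervalIntegral.integral_sub ((continuous_halfPrim _).intervalIntegrable _ _) (by simp), h1,
    intervalIntegral.integral_const, add_sub_cancel_left, one_smul, abs_one, mul_one] at h2
  have h3 : ‖⟪halfInd (x + 1) - halfInd x, p.1⟫‖ ≤ ‖p.1‖ :=
    (norm_inner_le_norm _ _).trans
      (mul_le_of_le_one_left (norm_nonneg _) (norm_halfInd_sub_le hx (by linarith) le_rfl))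
  calc ‖halfPrim p.2 x‖ = ‖⟪halfInd (x + 1) - halfInd x, p.1⟫ -
        (⟪halfInd (x + 1) - halfInd x, p.1⟫ - halfPrim p.2 x)‖ := by rw [sub_sub_cancel]
    _ ≤ _ := (norm_sub_le _ _).trans (add_le_add h3 h2)

end HalfLine

section Weights

local notation "⟪" x "," y "⟫" => inner ℂ x y

theorem HalfL2.ext_ae {f g : HalfL2} (h : f =ᵐ[volume.restrict (Ioi (0:ℝ))] g) : f = g := Lp.ext h

theorem memLp_mul_bounded {m : ℝ → ℝ} (hm : Continuous m) {C : ℝ} (hC : ∀ x, |m x| ≤ C) (u : HalfL2) :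
    MemLp (fun x => (m x : ℂ) * u x) 2 (volume.restrict (Ioi (0:ℝ))) := by
  refine MemLp.of_le_mul (c := C) (Lp.memLp u) ?_ (Eventually.of_forall fun x => ?_)
  · exact (Complex.continuous_ofReal.comp hm).aestronglyMeasurable.mul (Lp.aestronglyMeasurable u)
  · rw [norm_mul, Complex.norm_real, Real.norm_eq_abs]
    gcongr
    exact hC x

/-- Multiplication by a bounded continuous real function. -/
def mulOp (m : ℝ → ℝ) (hm : Continuous m) (C : ℝ) (hC : ∀ x, |m x| ≤ C) : HalfL2 →L[ℂ] HalfL2 :=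
  LinearMap.mkContinuous
    { toFun := fun u => (memLp_mul_bounded hm hC u).toLp _
      map_add' := fun u v => by
        refine HalfL2.ext_ae ?_
        filter_upwards [(memLp_mul_bounded hm hC (u + v)).coeFn_toLp, (memLp_mul_bounded hm hC u).coeFn_toLp,
          (memLp_mul_bounded hm hC v).coeFn_toLp, Lp.coeFn_add u v,
          Lp.coeFn_add ((memLp_mul_bounded hm hC u).toLp _) ((memLp_mul_bounded hm hC v).toLp _)]
          with x h1 h2 h3 h4 h5
        rw [h1, h5, Pi.add_apply, h2, h3, h4, Pi.add_apply, mul_add]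
      map_smul' := fun c u => by
        refine HalfL2.ext_ae ?_
        rw [RingHom.id_apply]
        filter_upwards [(memLp_mul_bounded hm hC (c • u)).coeFn_toLp, (memLp_mul_bounded hm hC u).coeFn_toLp,
          Lp.coeFn_smul c u, Lp.coeFn_smul c ((memLp_mul_bounded hm hC u).toLp _)] with x h1 h2 h3 h4
        rw [h1, h4, Pi.smul_apply, h2, h3, Pi.smul_apply, smul_eq_mul, smul_eq_mul]
        ring }
    C (fun u => by
      refine Lp.norm_le_mul_norm_of_ae_le_mul ?_
      filter_upwards [(memLp_mul_bounded hm hC u).coeFn_toLp] with x h1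
      change ‖(memLp_mul_bounded hm hC u).toLp _ x‖ ≤ _
      rw [h1, norm_mul, Complex.norm_real, Real.norm_eq_abs]
      gcongr
      exact hC x)

variable {m : ℝ → ℝ} {hm : Continuous m} {C : ℝ} {hC : ∀ x, |m x| ≤ C}

theorem mulOp_coeFn (u : HalfL2) :
    mulOp m hm C hC u =ᵐ[volume.restrict (Ioi (0:ℝ))] fun x => (m x : ℂ) * u x :=
  (memLp_mul_bounded hm hC u).coeFn_toLp

theorem norm_mulOp_le (hC0 : 0 ≤ C) : ‖mulOp m hm C hC‖ ≤ C := LinearMap.mkContinuous_norm_le _ hC0 _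

theorem mulOp_pow_coeFn (n : ℕ) (u : HalfL2) :
    (mulOp m hm C hC ^ n) u =ᵐ[volume.restrict (Ioi (0:ℝ))] fun x => (m x : ℂ) ^ n * u x := by
  induction n with
  | zero => simp
  | succ n ih =>
    rw [pow_succ', mul_apply_eq_comp]
    filter_upwards [mulOp_coeFn (hm := hm) (hC := hC) ((mulOp m hm C hC ^ n) u), ih] with x h1 h2
    rw [h1, h2]
    ring

theorem mulOp_symm (u v : HalfL2) : ⟪mulOp m hm C hC u, v⟫ = ⟪u, mulOp m hm C hC v⟫ := by
  rw [L2.inner_def, L2.inner_def]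
  refine integral_congr_ae ?_
  filter_upwards [mulOp_coeFn (hm := hm) (hC := hC) u, mulOp_coeFn (hm := hm) (hC := hC) v] with x h1 h2
  rw [h1, h2, RCLike.inner_apply', RCLike.inner_apply', map_mul, Complex.conj_ofReal]
  ring

theorem mulOp_commute {m' : ℝ → ℝ} {hm' : Continuous m'} {C' : ℝ} {hC' : ∀ x, |m' x| ≤ C'} :
    Commute (mulOp m hm C hC) (mulOp m' hm' C' hC') := by
  ext1 u
  rw [mul_apply_eq_comp, mul_apply_eq_comp]
  refine HalfL2.ext_ae ?_
  filter_upwards [mulOp_coeFn (hm := hm) (hC := hC) (mulOp m' hm' C' hC' u),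
    mulOp_coeFn (hm := hm') (hC := hC') (mulOp m hm C hC u), mulOp_coeFn (hm := hm) (hC := hC) u,
    mulOp_coeFn (hm := hm') (hC := hC') u] with x h1 h2 h3 h4
  rw [h1, h2, h3, h4]
  ring

/-- A bounded weight growing linearly up to scale `R`. -/
def weight (R x : ℝ) : ℝ := R * Real.arctan (x / R)

/-- The derivative of `weight`. -/
def weight' (R x : ℝ) : ℝ := 1 / (1 + (x / R) ^ 2)

theorem continuous_weight (R : ℝ) : Continuous (weight R) := by
  unfold weight
  fun_prop

theorem continuous_weight' (R : ℝ) : Continuous (weight' R) := by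
  unfold weight'
  exact continuous_const.div (by fun_prop) fun x => by positivity

theorem abs_weight_le (R x : ℝ) : |weight R x| ≤ |R| * (Real.pi / 2) := by
  rw [weight, abs_mul]
  gcongr
  exact abs_le.2 ⟨(Real.neg_pi_div_two_lt_arctan _).le, (Real.arctan_lt_pi_div_two _).le⟩

theorem abs_weight'_le (R x : ℝ) : |weight' R x| ≤ 1 := by
  rw [weight', abs_of_nonneg (by positivity), div_le_one (by positivity)]
  nlinarith [sq_nonneg (x / R)]

theorem hasDerivAt_weight {R : ℝ} (hR : 0 < R) (x : ℝ) : HasDerivAt (weight R) (weight' R x) x := by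
  have := (((hasDerivAt_id x).div_const R).arctan).const_mul R
  refine this.congr_deriv ?_
  rw [weight', id]
  field_simp

theorem abs_weight_le_self {R : ℝ} (hR : 0 < R) {x : ℝ} (hx : 0 ≤ x) : |weight R x| ≤ x := by
  have h : ‖weight R x - weight R 0‖ ≤ 1 * ‖x - 0‖ :=
    Convex.norm_image_sub_le_of_norm_hasDerivWithin_le (s := univ)
      (fun y _ => (hasDerivAt_weight hR y).hasDerivWithinAt) (fun y _ => abs_weight'_le R y)
      convex_univ (mem_univ 0) (mem_univ x)
  simpa [weight, abs_of_nonneg hx] using h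

theorem weight_zero (R : ℝ) : weight R 0 = 0 := by simp [weight]

theorem weight_self (R : ℝ) (hR : 0 < R) : weight R R = R * (Real.pi / 4) := by
  rw [weight, div_self hR.ne', Real.arctan_one]

theorem primitive_weight' {R : ℝ} (hR : 0 < R) (x : ℝ) :
    ∫ y in (0:ℝ)..x, (weight' R y : ℂ) = weight R x := by
  rw [intervalIntegral.integral_ofReal, intervalIntegral.integral_eq_sub_of_hasDerivAt
    (fun y _ => hasDerivAt_weight hR y) ((continuous_weight' R).intervalIntegrable _ _), weight_zero,
    sub_zero]

/-- Multiplication by `weight R`. -/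
def weightOp (R : ℝ) : HalfL2 →L[ℂ] HalfL2 := mulOp (weight R) (continuous_weight R) _ (abs_weight_le R)

/-- Multiplication by `weight' R`. -/
def weightOp' (R : ℝ) : HalfL2 →L[ℂ] HalfL2 := mulOp (weight' R) (continuous_weight' R) _ (abs_weight'_le R)

theorem weight_mem_derivGraph {R : ℝ} (hR : 0 < R) {p : HalfL2 × HalfL2} {κ : ℂ}
    (hp : p.1 =ᵐ[volume.restrict (Ioi (0:ℝ))] fun x => κ + halfPrim p.2 x) :
    (weightOp R p.1, weightOp' R p.1 + weightOp R p.2) ∈ derivGraph ∧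
      ∀ x : ℝ, 0 ≤ x → halfPrim (weightOp' R p.1 + weightOp R p.2) x =
        (weight R x : ℂ) * (κ + halfPrim p.2 x) := by
  have key : ∀ x : ℝ, 0 ≤ x → halfPrim (weightOp' R p.1 + weightOp R p.2) x =
        (weight R x : ℂ) * (κ + halfPrim p.2 x) := by
    intro x hx
    have hw : IntervalIntegrable (fun y => (weight' R y : ℂ)) volume 0 x :=
      (Complex.continuous_ofReal.comp (continuous_weight' R)).intervalIntegrable _ _
    have hprod := primitive_mul_primitive hw (p.2.intervalIntegrable hx)
    rw [primitive_weight' hR, ← halfPrim_eq _ hx] at hprod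
    have hi : IntervalIntegrable (fun y => (weight' R y : ℂ) * (∫ z in (0:ℝ)..y, p.2 z) +
        (∫ z in (0:ℝ)..y, (weight' R z : ℂ)) * p.2 y) volume 0 x :=
      (hw.mul_continuousOn (absolutelyContinuous_primitive (p.2.intervalIntegrable hx)).continuousOn).add
        ((p.2.intervalIntegrable hx).continuousOn_mul (absolutelyContinuous_primitive hw).continuousOn)
    rw [mul_add, hprod, ← primitive_weight' hR, ← intervalIntegral.integral_mul_const,
      ← intervalIntegral.integral_add (hw.mul_const κ) hi, halfPrim_eq _ hx]
    refine intervalIntegral.integral_congr_ae ?_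
    rw [uIoc_of_le hx]
    filter_upwards [ae_restrict_Ioi_of_Ioc (b := x) hp,
      ae_restrict_Ioi_of_Ioc (b := x) (Lp.coeFn_add (weightOp' R p.1) (weightOp R p.2)),
      ae_restrict_Ioi_of_Ioc (b := x) (mulOp_coeFn (hm := continuous_weight R) (hC := abs_weight_le R) p.2),
      ae_restrict_Ioi_of_Ioc (b := x) (mulOp_coeFn (hm := continuous_weight' R) (hC := abs_weight'_le R) p.1)]
      with y h1 h2 h3 h4 hy
    rw [h2 hy, Pi.add_apply, weightOp, weightOp', h3 hy, h4 hy, h1 hy, primitive_weight' hR,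
      halfPrim_eq _ hy.1.le]
    ring
  refine ⟨?_, key⟩
  rw [mem_derivGraph]
  filter_upwards [ae_restrict_mem measurableSet_Ioi, hp,
    mulOp_coeFn (hm := continuous_weight R) (hC := abs_weight_le R) p.1] with x h1 h2 h3
  rw [key x (le_of_lt h1), ← h2]
  exact h3

theorem memLp_exp_neg : MemLp (fun x : ℝ => (Real.exp (-x) : ℂ)) 2 (volume.restrict (Ioi (0:ℝ))) := by
  rw [memLp_two_iff_integrable_sq_norm (by fun_prop)]
  have := exp_neg_integrableOn_Ioi 0 (b := 2) (by norm_num)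
  refine this.congr (Eventually.of_forall fun x => ?_)
  simp only [Complex.norm_real, Real.norm_eq_abs, Real.abs_exp, ← Real.exp_nat_mul]
  congr 1
  push_cast
  ring

theorem memLp_pow_exp_neg (a : ℕ) :
    MemLp (fun x : ℝ => (x : ℂ) ^ a * Real.exp (-x)) 2 (volume.restrict (Ioi (0:ℝ))) := by
  rw [memLp_two_iff_integrable_sq_norm (by fun_prop)]
  have := Real.GammaIntegral_convergent (s := (2 * a + 1 : ℝ)) (by positivity)
  have h2 : IntegrableOn (fun x : ℝ => Real.exp (-x) * x ^ (2 * a)) (Ioi 0) := by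
    refine this.congr_fun (fun x hx => ?_) measurableSet_Ioi
    simp only [add_sub_cancel_right]
    norm_cast
  refine Integrable.mono' h2 (by fun_prop) ?_
  filter_upwards [ae_restrict_mem measurableSet_Ioi] with x hx
  have hx' : (0:ℝ) < x := hx
  simp only [norm_mul, norm_pow, Complex.norm_real, Real.norm_eq_abs, Real.abs_exp, abs_abs]
  rw [abs_of_pos hx', mul_pow, ← pow_mul, mul_comm a 2, mul_comm]
  gcongr
  rw [sq]
  exact mul_le_of_le_one_left (Real.exp_nonneg _) (Real.exp_le_one_iff.2 (by linarith))

/-- The function `exp (-x)` as a square integrable function. -/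
def halfExp : HalfL2 := memLp_exp_neg.toLp _

theorem halfExp_coeFn : halfExp =ᵐ[volume.restrict (Ioi (0:ℝ))] fun x => (Real.exp (-x) : ℂ) :=
  memLp_exp_neg.coeFn_toLp

theorem norm_weightOp_pow_halfExp_le (a : ℕ) :
    ∃ C, ∀ R : Ioi (0:ℝ), ‖(weightOp R ^ a) halfExp‖ ≤ C := by
  refine ⟨‖(memLp_pow_exp_neg a).toLp _‖, fun R => Lp.norm_le_norm_of_ae_le ?_⟩
  filter_upwards [mulOp_pow_coeFn (hm := continuous_weight R) (hC := abs_weight_le R) a halfExp,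
    halfExp_coeFn, (memLp_pow_exp_neg a).coeFn_toLp, ae_restrict_mem measurableSet_Ioi] with x h1 h2 h3 h4
  have h4' : (0:ℝ) < x := h4
  rw [weightOp, h1, h2, h3, norm_mul, norm_mul, norm_pow, norm_pow, Complex.norm_real, Complex.norm_real,
    Complex.norm_of_nonneg h4'.le]
  gcongr
  exact abs_weight_le_self R.2 h4'.le

end Weights

section DuBoisReymond

local notation "⟪" x "," y "⟫" => inner ℂ x y

/-- The average over `0 ≤ y ≤ 1` of the indicator functions of `(0, y]`. -/
def halfTri : HalfL2 := ∫ y in (0:ℝ)..1, halfInd y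

theorem inner_halfTri (h : HalfL2) : ⟪halfTri, h⟫ = ∫ y in (0:ℝ)..1, halfPrim h y := by
  have e1 : ⟪h, halfTri⟫ = ∫ y in (0:ℝ)..1, ⟪h, halfInd y⟫ :=
    ((innerSL ℂ h).intervalIntegral_comp_comm (continuous_halfInd.intervalIntegrable 0 1)).symm
  rw [← inner_conj_symm, e1]
  rw [intervalIntegral.integral_of_le zero_le_one, intervalIntegral.integral_of_le zero_le_one,
    ← integral_conj]
  refine integral_congr_ae (Eventually.of_forall fun y => ?_)
  simp only [inner_conj_symm]
  rfl

theorem halfPrim_halfInd {a y : ℝ} (ha : 0 ≤ a) (hy : 0 ≤ y) : halfPrim (halfInd a) y = ((min y a : ℝ) : ℂ) := by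
  have hfin : ∀ b : ℝ, (volume.restrict (Ioi (0:ℝ))) (Ioc 0 b) ≠ ⊤ := fun b =>
    ((Measure.restrict_apply_le _ _).trans_lt measure_Ioc_lt_top).ne
  rw [halfPrim, halfInd, halfInd, L2.inner_indicatorConstLp_one_indicatorConstLp_one _ _ (hfin y) (hfin a),
    Ioc_inter_Ioc, Measure.real, Measure.restrict_apply measurableSet_Ioc,
    inter_eq_self_of_subset_left (by intro z hz; simpa using (le_max_left _ _).trans_lt hz.1), Real.volume_Ioc,
    ENNReal.toReal_ofReal (by simp [ha, hy])]
  simp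

theorem exists_testPair {x : ℝ} (hx : 0 < x) :
    ∃ p ∈ derivGraph, p.2 = halfInd x - (x : ℂ) • halfInd 1 ∧
      ∀ h : HalfL2, ⟪p.1, h⟫ = -((∫ y in (0:ℝ)..x, halfPrim h y) - x * ∫ y in (0:ℝ)..1, halfPrim h y) := by
  set δ : HalfL2 := halfInd x - (x : ℂ) • halfInd 1 with hδ
  set X := max x 1 with hX
  have hX0 : 0 ≤ X := hx.le.trans (le_max_left _ _)
  have hval : ∀ y : ℝ, 0 ≤ y → halfPrim δ y = ((min y x - x * min y 1 : ℝ) : ℂ) := by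
    intro y hy
    rw [hδ, sub_eq_add_neg, ← neg_smul, halfPrim_add, halfPrim_smul, halfPrim_halfInd hx.le hy,
      halfPrim_halfInd zero_le_one hy]
    push_cast
    ring
  have hzero : ∀ y : ℝ, X ≤ y → halfPrim δ y = 0 := by
    intro y hy
    rw [hval y (hX0.trans hy), min_eq_right ((le_max_left _ _).trans hy),
      min_eq_right ((le_max_right _ _).trans hy)]
    simp
  have hmem : MemLp (halfPrim δ) 2 (volume.restrict (Ioi (0:ℝ))) := by
    have hcs : MemLp ((Icc 0 X).indicator (halfPrim δ)) 2 volume := by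
      rw [memLp_indicator_iff_restrict measurableSet_Icc]
      rw [memLp_two_iff_integrable_sq_norm (continuous_halfPrim δ).aestronglyMeasurable]
      exact ((continuous_halfPrim δ).norm.pow 2).integrableOn_Icc
    refine (hcs.mono_measure Measure.restrict_le_self).ae_eq ?_
    filter_upwards [ae_restrict_mem measurableSet_Ioi] with y hy
    by_cases hyX : y ≤ X
    · rw [indicator_of_mem (show y ∈ Icc 0 X from ⟨le_of_lt hy, hyX⟩)]
    · rw [indicator_of_notMem (fun h => hyX h.2), hzero y (not_le.1 hyX).le]
  refine ⟨(hmem.toLp _, δ), mem_derivGraph.2 hmem.coeFn_toLp, rfl, fun h => ?_⟩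
  have hprod := primitive_mul_primitive (δ.intervalIntegrable hX0) (h.intervalIntegrable hX0)
  rw [← halfPrim_eq δ hX0, hzero X le_rfl, zero_mul] at hprod
  have e1 : IntervalIntegrable (fun y => δ y * halfPrim h y) volume 0 X :=
    (δ.intervalIntegrable hX0).mul_continuousOn (continuous_halfPrim h).continuousOn
  have e2 : IntervalIntegrable (fun y => halfPrim δ y * h y) volume 0 X :=
    (h.intervalIntegrable hX0).continuousOn_mul (continuous_halfPrim δ).continuousOn
  have h0 : (∫ y in (0:ℝ)..X, δ y * halfPrim h y) + ∫ y in (0:ℝ)..X, halfPrim δ y * h y = 0 := by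
    rw [← intervalIntegral.integral_add e1 e2, hprod]
    refine intervalIntegral.integral_congr fun y hy => ?_
    rw [uIcc_of_le hX0] at hy
    simp only [halfPrim_eq _ hy.1]
  have hreal : ∀ y : ℝ, 0 ≤ y → (starRingEnd ℂ) (halfPrim δ y) = halfPrim δ y := by
    intro y hy
    rw [hval y hy, Complex.conj_ofReal]
  have h1 : ⟪hmem.toLp _, h⟫ = ∫ y in (0:ℝ)..X, halfPrim δ y * h y := by
    rw [L2.inner_def, intervalIntegral.integral_of_le hX0]
    have : ∫ y in Ioi (0:ℝ), ⟪hmem.toLp _ y, h y⟫ = ∫ y in Ioi (0:ℝ), halfPrim δ y * h y := by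
      refine integral_congr_ae ?_
      filter_upwards [hmem.coeFn_toLp, ae_restrict_mem measurableSet_Ioi] with y hy hy0
      rw [hy, RCLike.inner_apply', hreal y (le_of_lt hy0)]
    rw [this]
    refine setIntegral_eq_of_subset_of_forall_sdiff_eq_zero measurableSet_Ioi Ioc_subset_Ioi_self ?_
    intro y hy
    have : X < y := by
      by_contra hc
      exact hy.2 ⟨hy.1, not_lt.1 hc⟩
    rw [hzero y this.le, zero_mul]
  have hind : ∀ a : ℝ, 0 ≤ a → a ≤ X → ∫ y in (0:ℝ)..X, (Ioc 0 a).indicator (fun y => halfPrim h y) y =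
      ∫ y in (0:ℝ)..a, halfPrim h y := by
    intro a ha haX
    rw [intervalIntegral.integral_of_le hX0, intervalIntegral.integral_of_le ha,
      setIntegral_indicator measurableSet_Ioc, inter_eq_self_of_subset_right (Ioc_subset_Ioc_right haX)]
  have hii : ∀ a : ℝ, IntervalIntegrable (fun y => (Ioc 0 a).indicator (fun y => halfPrim h y) y) volume 0 X := by
    intro a
    rw [intervalIntegrable_iff_integrableOn_Ioc_of_le hX0]
    exact (((continuous_halfPrim h).intervalIntegrable 0 X).1).indicator measurableSet_Ioc
  have h2 : ∫ y in (0:ℝ)..X, δ y * halfPrim h y =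
      (∫ y in (0:ℝ)..x, halfPrim h y) - x * ∫ y in (0:ℝ)..1, halfPrim h y := by
    rw [← hind x hx.le (le_max_left _ _), ← hind 1 zero_le_one (le_max_right _ _),
      ← intervalIntegral.integral_const_mul, ← intervalIntegral.integral_sub (hii x) ((hii 1).const_mul _)]
    refine intervalIntegral.integral_congr_ae ?_
    rw [uIoc_of_le hX0]
    filter_upwards [ae_restrict_Ioi_of_Ioc (b := X) (Lp.coeFn_sub (halfInd x) ((x:ℂ) • halfInd 1)),
      ae_restrict_Ioi_of_Ioc (b := X) (Lp.coeFn_smul (x:ℂ) (halfInd 1)),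
      ae_restrict_Ioi_of_Ioc (b := X) (indicatorConstLp_coeFn (p := 2) (s := Ioc 0 x) (c := (1:ℂ))),
      ae_restrict_Ioi_of_Ioc (b := X) (indicatorConstLp_coeFn (p := 2) (s := Ioc 0 1) (c := (1:ℂ)))]
      with y h1 h2 h3 h4 hy
    rw [hδ, h1 hy, Pi.sub_apply, h2 hy, Pi.smul_apply, halfInd, halfInd, h3 hy, h4 hy]
    by_cases hyx : y ∈ Ioc 0 x <;> by_cases hy1 : y ∈ Ioc (0:ℝ) 1 <;> simp [hyx, hy1, sub_mul]
  rw [h1, ← h2]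
  exact eq_neg_of_add_eq_zero_right h0

/-- A du Bois-Reymond lemma: a function whose weak derivative against functions vanishing at the
origin is square integrable agrees with a primitive. -/
theorem ae_eq_const_add_halfPrim {d h : HalfL2} (hdh : ∀ p ∈ derivGraph, ⟪p.2, d⟫ + ⟪p.1, h⟫ = 0) :
    d =ᵐ[volume.restrict (Ioi (0:ℝ))] fun x => (⟪halfInd 1, d⟫ - ⟪halfTri, h⟫) + halfPrim h x := by
  set κ := ⟪halfInd 1, d⟫ - ⟪halfTri, h⟫ with hκ
  have hc : Continuous fun x => κ + halfPrim h x := continuous_const.add (continuous_halfPrim h)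
  have h0 : (fun x => d x - (κ + halfPrim h x)) =ᵐ[volume.restrict (Ioi (0:ℝ))] 0 := by
    refine ae_eq_zero_of_primitive_eq_zero
      (fun b hb => (d.intervalIntegrable hb).sub (hc.intervalIntegrable _ _)) fun x hx => ?_
    obtain ⟨p, hp, hp2, hp1⟩ := exists_testPair hx
    have := hdh p hp
    rw [hp1, hp2, inner_sub_left, inner_smul_left, Complex.conj_ofReal, ← inner_halfTri] at this
    rw [intervalIntegral.integral_sub (d.intervalIntegrable hx.le) (hc.intervalIntegrable _ _),
      intervalIntegral.integral_add (by simp) ((continuous_halfPrim h).intervalIntegrable _ _),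
      intervalIntegral.integral_const, ← halfPrim_eq d hx.le, hκ]
    simp only [sub_zero, Complex.real_smul]
    change halfPrim d x - _ + _ = 0 at this
    linear_combination this
  filter_upwards [h0] with x hx
  exact sub_eq_zero.1 hx

end DuBoisReymond

section HalfLineEvolution

local notation "⟪" x "," y "⟫" => inner ℂ x y

theorem weight_pow_mem_derivGraph {R : ℝ} (hR : 0 < R) {p : HalfL2 × HalfL2} {κ : ℂ}
    (hp : p.1 =ᵐ[volume.restrict (Ioi (0:ℝ))] fun x => κ + halfPrim p.2 x) (n : ℕ) :
    ((weightOp R ^ (n + 1)) p.1, ((n + 1 : ℕ) : ℂ) • (weightOp' R * weightOp R ^ n) p.1 +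
      (weightOp R ^ (n + 1)) p.2) ∈ derivGraph := by
  have hcomm : Commute (weightOp R) (weightOp' R) := mulOp_commute
  induction n with
  | zero => simpa using (weight_mem_derivGraph hR hp).1
  | succ n ih =>
    have h := (weight_mem_derivGraph hR (κ := 0) (p := ((weightOp R ^ (n + 1)) p.1, _)) (by
      simpa only [zero_add] using mem_derivGraph.1 ih)).1
    convert h using 2
    · simp only
      rw [← mul_apply_eq_comp, ← pow_succ']
    · simp only
      rw [map_add, map_smul, ← mul_apply_eq_comp (weightOp R), ← mul_apply_eq_comp (weightOp' R),
        ← mul_apply_eq_comp (weightOp R) (weightOp R ^ (n + 1)), ← pow_succ',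
        ← mul_assoc (weightOp R) (weightOp' R), hcomm.eq, mul_assoc, ← pow_succ']
      push_cast
      module

theorem weight_pow_mul_norm_le {R : ℝ} (hR : 0 < R) {p : HalfL2 × HalfL2} {κ : ℂ}
    (hp : p.1 =ᵐ[volume.restrict (Ioi (0:ℝ))] fun x => κ + halfPrim p.2 x) (n : ℕ) {x : ℝ} (hx : 0 ≤ x) :
    |weight R x| ^ (n + 1) * ‖κ + halfPrim p.2 x‖ ≤ ‖(weightOp R ^ (n + 1)) p.1‖ +
      ((n + 1) * ‖(weightOp R ^ n) p.1‖ + ‖(weightOp R ^ (n + 1)) p.2‖) := by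
  have hmem := weight_pow_mem_derivGraph hR hp n
  have heq : (weight R x : ℂ) ^ (n + 1) * (κ + halfPrim p.2 x) =
      halfPrim (((n + 1 : ℕ) : ℂ) • (weightOp' R * weightOp R ^ n) p.1 + (weightOp R ^ (n + 1)) p.2) x := by
    refine eq_of_ae_eq_Ioi (f := fun x => (weight R x : ℂ) ^ (n + 1) * (κ + halfPrim p.2 x)) ?_
      (continuous_halfPrim _) ?_ hx
    · exact ((Complex.continuous_ofReal.comp (continuous_weight R)).pow _).mul
        (continuous_const.add (continuous_halfPrim _))
    · filter_upwards [mem_derivGraph.1 hmem, hp,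
        mulOp_pow_coeFn (hm := continuous_weight R) (hC := abs_weight_le R) (n + 1) p.1] with y h1 h2 h3
      rw [← h1, ← h2]
      exact h3.symm
  have hn := norm_halfPrim_le hmem hx
  rw [← heq, norm_mul, norm_pow, Complex.norm_real, Real.norm_eq_abs] at hn
  refine hn.trans (add_le_add_right ((norm_add_le _ _).trans (add_le_add_left ?_ _)) _)
  rw [norm_smul, Complex.norm_natCast, mul_apply_eq_comp]
  push_cast
  gcongr
  exact ((weightOp' R).le_opNorm _).trans
    (mul_le_of_le_one_left (norm_nonneg _) (norm_mulOp_le zero_le_one))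

/-- Rapid decay in `x`, locally uniformly in `t`. -/
def RapidX (f : ℝ → ℝ → ℂ) : Prop :=
  ∀ (a : ℕ) (A : ℝ), ∃ C, ∀ x t : ℝ, 1 ≤ x → |t| ≤ A → x ^ a * ‖f x t‖ ≤ C

theorem rapidX_of_weighted {w h : ℝ → HalfL2} {κ : ℝ → ℂ}
    (hp : ∀ t, w t =ᵐ[volume.restrict (Ioi (0:ℝ))] fun x => κ t + halfPrim (h t) x)
    (hw : ∀ (a : ℕ) (A : ℝ), ∃ C, ∀ (R : Ioi (0:ℝ)) (t : ℝ), |t| ≤ A → ‖(weightOp R ^ a) (w t)‖ ≤ C)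
    (hh : ∀ (a : ℕ) (A : ℝ), ∃ C, ∀ (R : Ioi (0:ℝ)) (t : ℝ), |t| ≤ A → ‖(weightOp R ^ a) (h t)‖ ≤ C) :
    RapidX fun x t => κ t + halfPrim (h t) x := by
  intro a A
  obtain ⟨C1, h1⟩ := hw (a + 1) A
  obtain ⟨C2, h2⟩ := hw a A
  obtain ⟨C3, h3⟩ := hh (a + 1) A
  refine ⟨2 ^ (a + 1) * (C1 + ((a + 1) * C2 + C3)), fun x t hx ht => ?_⟩
  have hx0 : 0 < x := by linarith
  have hb := weight_pow_mul_norm_le hx0 (p := (w t, h t)) (hp t) a hx0.le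
  have hwx : x / 2 ≤ |weight x x| := by
    rw [weight_self x hx0, abs_of_pos (by positivity)]
    nlinarith [Real.pi_gt_three]
  have hs : (x / 2) ^ (a + 1) * ‖κ t + halfPrim (h t) x‖ ≤ C1 + ((a + 1) * C2 + C3) := by
    refine le_trans (mul_le_mul_of_nonneg_right (pow_le_pow_left₀ (by positivity) hwx _) (norm_nonneg _))
      (hb.trans ?_)
    have := h1 ⟨x, hx0⟩ t ht
    have := h2 ⟨x, hx0⟩ t ht
    have := h3 ⟨x, hx0⟩ t ht
    gcongr
  rw [div_pow, div_mul_eq_mul_div, div_le_iff₀ (by positivity)] at hs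
  calc x ^ a * ‖κ t + halfPrim (h t) x‖ ≤ x ^ (a + 1) * ‖κ t + halfPrim (h t) x‖ := by
        gcongr
        omega
    _ ≤ _ := by linarith

end HalfLineEvolution

section HalfLineSolution

local notation "⟪" x "," y "⟫" => inner ℂ x y

/-- The strong derivative of `d k` dictated by the evolution equation. -/
def evolutionFlux (w d : ℕ → ℝ → HalfL2) (γ : ℕ → ℝ → ℂ) (k : ℕ) (t : ℝ) : HalfL2 :=
  (-2 * Complex.I) • (w (k + 1) t + ((t ^ 2 / 2 : ℝ) : ℂ) • d k t + ((k * t : ℝ) : ℂ) • d (k - 1) t +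
    ((k.choose 2 : ℝ) : ℂ) • d (k - 2) t - γ k t • halfExp)

theorem hasDerivAt_evolutionFlux {w d : ℕ → ℝ → HalfL2} {γ : ℕ → ℝ → ℂ}
    (hw : ∀ k t, HasDerivAt (w k) (w (k + 1) t) t) (hd : ∀ k t, HasDerivAt (d k) (d (k + 1) t) t)
    (hγ : ∀ k t, HasDerivAt (γ k) (γ (k + 1) t) t) (k : ℕ) (t : ℝ) :
    HasDerivAt (evolutionFlux w d γ k) (evolutionFlux w d γ (k + 1) t) t := by
  have h1 : HasDerivAt (fun t : ℝ => ((t ^ 2 / 2 : ℝ) : ℂ)) ((t : ℝ) : ℂ) t := by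
    have := ((hasDerivAt_id t).pow 2).div_const 2
    refine (this.ofReal_comp).congr_deriv ?_
    simp
  have h2 : HasDerivAt (fun t : ℝ => ((k * t : ℝ) : ℂ)) ((k : ℝ) : ℂ) t := by
    refine (((hasDerivAt_id t).const_mul (k : ℝ)).ofReal_comp).congr_deriv ?_
    simp
  have h := (((((hw (k + 1) t).fun_add (h1.fun_smul (hd k t))).fun_add (h2.fun_smul (hd (k - 1) t))).fun_add
    ((hd (k - 2) t).fun_const_smul ((k.choose 2 : ℝ) : ℂ))).fun_sub
    ((hγ k t).fun_smul (hasDerivAt_const t halfExp))).fun_const_smul (-2 * Complex.I)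
  refine h.congr_deriv ?_
  rw [evolutionFlux]
  congr 1
  rcases k with _ | _ | k
  · simp
    abel
  · simp
    module
  · have e : ((k + 1 + 1 + 1).choose 2 : ℝ) = (k + 2 : ℝ) + ((k + 1 + 1).choose 2 : ℝ) := by
      rw [Nat.choose_succ_succ' (k + 1 + 1) 1]
      push_cast
      simp
      ring
    simp only [Nat.add_sub_cancel, show k + 1 + 1 - 2 = k by omega, show k + 1 + 1 + 1 - 2 = k + 1 by omega,
      e, smul_zero, zero_add]
    push_cast
    module

theorem hasDerivWithinAt_halfPrim {δ : HalfL2} {f : ℝ → ℂ} (hf : Continuous f)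
    (h : δ =ᵐ[volume.restrict (Ioi (0:ℝ))] f) {x : ℝ} (hx : 0 ≤ x) :
    HasDerivWithinAt (halfPrim δ) (f x) (Ici 0) x := by
  have h1 : ∀ y ∈ Ici (0:ℝ), halfPrim δ y = ∫ z in (0:ℝ)..y, f z := fun y hy => by
    rw [halfPrim_eq δ hy, intervalIntegral.integral_of_le hy, intervalIntegral.integral_of_le hy]
    exact integral_congr_ae (ae_restrict_of_ae_restrict_of_subset Ioc_subset_Ioi_self h)
  have h2 : HasDerivAt (fun y => ∫ z in (0:ℝ)..y, f z) (f x) x :=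
    intervalIntegral.integral_hasDerivAt_right (hf.intervalIntegrable _ _)
      (hf.stronglyMeasurableAtFilter _ _) hf.continuousAt
  exact h2.hasDerivWithinAt.congr h1 (h1 x hx)

theorem exists_halfline_solution (γ : ℕ → ℝ → ℂ)
    (hγ : ∀ k t, HasDerivAt (γ k) (γ (k + 1) t) t)
    (hr : ∀ k, RapidFam (fun (_ : Unit) t => ‖γ k t‖)) :
    ∃ W V : ℕ → ℝ → ℝ → ℂ, (∀ k t, W k 0 t = 0) ∧ (∀ k, Continuous (uncurry (W k))) ∧
      (∀ k, Continuous (uncurry (V k))) ∧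
      (∀ k x t, HasDerivAt (fun s => W k x s) (W (k + 1) x t) t) ∧
      (∀ k x t, HasDerivAt (fun s => V k x s) (V (k + 1) x t) t) ∧
      (∀ k x t, 0 ≤ x → HasDerivWithinAt (fun y => W k y t) (V k x t) (Ici 0) x) ∧
      (∀ k x t, 0 ≤ x → HasDerivWithinAt (fun y => V k y t)
        (-2 * Complex.I * (W (k + 1) x t + ((t ^ 2 / 2 : ℝ) : ℂ) * V k x t +
          ((k * t : ℝ) : ℂ) * V (k - 1) x t + ((k.choose 2 : ℝ) : ℂ) * V (k - 2) x t -
          γ k t * (Real.exp (-x) : ℂ))) (Ici 0) x) ∧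
      (∀ k, RapidX (W k)) ∧ (∀ k, RapidX (V k)) ∧
      Tendsto (fun t => ∫ x in Ioi (0:ℝ), ‖W 0 x t‖ ^ 2) atTop (nhds 0) := by
  obtain ⟨w, d, hmem, hw, hd, heq, hwr, hdr⟩ := exists_abstract_evolution derivGraph
    isClosed_derivGraph (fun p hp q hq => derivGraph_skew hp hq) (fun p hp h0 => derivGraph_inj hp h0)
    halfExp γ hγ hr
  have hdec := weighted_decay derivGraph (fun p hp q hq => derivGraph_skew hp hq) halfExp γ hr w d hmem hw
    heq hwr hdr (fun R : Ioi (0:ℝ) => weightOp R) (fun R => weightOp' R)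
    (fun R => mulOp_symm) (fun R => mulOp_symm) (fun R => mulOp_commute)
    (fun R => norm_mulOp_le zero_le_one)
    (fun R p hp => (weight_mem_derivGraph (κ := 0) R.2 (by simpa only [zero_add] using mem_derivGraph.1 hp)).1)
    norm_weightOp_pow_halfExp_le
  set h := evolutionFlux w d γ with hh
  have hhd : ∀ k t, HasDerivAt (h k) (h (k + 1) t) t := hasDerivAt_evolutionFlux hw hd hγ
  set κ : ℕ → ℝ → ℂ := fun k t => ⟪halfInd 1, d k t⟫ - ⟪halfTri, h k t⟫ with hκ
  have hdV : ∀ k t, d k t =ᵐ[volume.restrict (Ioi (0:ℝ))] fun x => κ k t + halfPrim (h k t) x := by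
    intro k t
    refine ae_eq_const_add_halfPrim fun p hp => ?_
    have := heq p hp k t
    rw [WeakEq] at this
    simp only [hh, evolutionFlux, inner_smul_right, inner_add_right, inner_sub_right] at this ⊢
    rw [this]
    linear_combination ⟪p.2, d k t⟫ * Complex.I_mul_I
  have hwW : ∀ k t, w k t =ᵐ[volume.restrict (Ioi (0:ℝ))] fun x => halfPrim (d k t) x :=
    fun k t => mem_derivGraph.1 (hmem k t)
  have hdc : ∀ k, Continuous (d k) := fun k => continuous_iff_continuousAt.2 fun t => (hd k t).continuousAt
  have hhc : ∀ k, Continuous (h k) := fun k => continuous_iff_continuousAt.2 fun t => (hhd k t).continuousAt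
  have hlocw : ∀ k (a : ℕ) (A : ℝ), ∃ C, ∀ (R : Ioi (0:ℝ)) (t : ℝ), |t| ≤ A →
      ‖(weightOp R ^ a) (w k t)‖ ≤ C := fun k a A => by
    obtain ⟨C, hC⟩ := (hdec a k).1 0 A
    exact ⟨C, fun R t ht => by simpa using hC R t (by linarith [(abs_le.1 ht).1])⟩
  have hlocd : ∀ k (a : ℕ) (A : ℝ), ∃ C, ∀ (R : Ioi (0:ℝ)) (t : ℝ), |t| ≤ A →
      ‖(weightOp R ^ a) (d k t)‖ ≤ C := fun k a A => by
    obtain ⟨C, hC⟩ := (hdec a k).2 0 A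
    exact ⟨C, fun R t ht => by simpa using hC R t (by linarith [(abs_le.1 ht).1])⟩
  have hloch : ∀ k (a : ℕ) (A : ℝ), ∃ C, ∀ (R : Ioi (0:ℝ)) (t : ℝ), |t| ≤ A →
      ‖(weightOp R ^ a) (h k t)‖ ≤ C := fun k a A => by
    obtain ⟨C1, h1⟩ := hlocw (k + 1) a A
    obtain ⟨C2, h2⟩ := hlocd k a A
    obtain ⟨C3, h3⟩ := hlocd (k - 1) a A
    obtain ⟨C4, h4⟩ := hlocd (k - 2) a A
    obtain ⟨C5, h5⟩ := norm_weightOp_pow_halfExp_le a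
    obtain ⟨C6, h6⟩ := hr k 0 A
    refine ⟨2 * (C1 + A ^ 2 / 2 * C2 + k * A * C3 + k.choose 2 * C4 + C6 * C5), fun R t ht => ?_⟩
    have hA : 0 ≤ A := (abs_nonneg t).trans ht
    have h1 := h1 R t ht
    have h2 := h2 R t ht
    have h3 := h3 R t ht
    have h4 := h4 R t ht
    have h5 := h5 R
    have h6 : ‖γ k t‖ ≤ C6 := by simpa using h6 () t (by linarith [(abs_le.1 ht).1])
    have ht2 : t ^ 2 ≤ A ^ 2 := sq_le_sq' (abs_le.1 ht).1 (abs_le.1 ht).2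
    have h60 := (norm_nonneg _).trans h6
    have hn : ∀ a b c d e : HalfL2, ‖a + b + c + d - e‖ ≤ ‖a‖ + ‖b‖ + ‖c‖ + ‖d‖ + ‖e‖ := fun a b c d e =>
      (norm_sub_le _ _).trans (add_le_add_left (norm_add₄_le) _)
    simp only [hh, evolutionFlux, map_smul, map_add, map_sub]
    rw [norm_smul]
    have : ‖-2 * Complex.I‖ = 2 := by simp
    rw [this]
    refine mul_le_mul_of_nonneg_left ((hn _ _ _ _ _).trans ?_) zero_le_two
    simp only [norm_smul, Complex.norm_real, Real.norm_eq_abs, abs_mul, Nat.abs_cast, abs_div, abs_pow, sq_abs,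
      abs_two]
    gcongr
  refine ⟨fun k x t => halfPrim (d k t) x, fun k x t => κ k t + halfPrim (h k t) x, ?_, ?_, ?_, ?_, ?_, ?_, ?_,
    ?_, ?_, ?_⟩
  · intro k t
    exact halfPrim_zero_right _
  · intro k
    exact (continuous_halfInd.comp continuous_fst).inner ((hdc k).comp continuous_snd)
  · intro k
    refine Continuous.add ?_ ((continuous_halfInd.comp continuous_fst).inner ((hhc k).comp continuous_snd))
    exact ((continuous_const.inner (hdc k)).sub (continuous_const.inner (hhc k))).comp continuous_snd
  · intro k x t
    exact ((innerSL ℂ (halfInd x)).restrictScalars ℝ).hasFDerivAt.comp_hasDerivAt t (hd k t)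
  · intro k x t
    have hi : ∀ (v : HalfL2) (u : ℕ → ℝ → HalfL2), (∀ k t, HasDerivAt (u k) (u (k + 1) t) t) →
        HasDerivAt (fun s => ⟪v, u k s⟫) ⟪v, u (k + 1) t⟫ t := fun v u hu =>
      ((innerSL ℂ v).restrictScalars ℝ).hasFDerivAt.comp_hasDerivAt t (hu k t)
    exact ((hi _ d hd).fun_sub (hi _ h hhd)).fun_add (hi _ h hhd)
  · intro k x t hx
    exact hasDerivWithinAt_halfPrim (continuous_const.add (continuous_halfPrim _)) (hdV k t) hx
  · intro k x t hx
    have hW := fun k => hasDerivWithinAt_halfPrim (continuous_halfPrim _) (hwW k t) hx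
    have hV := fun k => hasDerivWithinAt_halfPrim (continuous_const.add (continuous_halfPrim _)) (hdV k t) hx
    have hE := hasDerivWithinAt_halfPrim (δ := halfExp) (f := fun x => (Real.exp (-x) : ℂ)) (by fun_prop)
      halfExp_coeFn hx
    have hD := ((((((hW (k + 1)).fun_add ((hV k).const_mul ((t ^ 2 / 2 : ℝ) : ℂ))).fun_add
      ((hV (k - 1)).const_mul ((k * t : ℝ) : ℂ))).fun_add
      ((hV (k - 2)).const_mul ((k.choose 2 : ℝ) : ℂ))).fun_sub (hE.const_mul (γ k t))).const_mul
      (-2 * Complex.I)).const_add (κ k t)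
    refine hD.congr_of_eventuallyEq (Eventually.of_forall fun y => ?_) ?_ <;>
    simp only [hh, evolutionFlux, halfPrim, inner_smul_right, inner_add_right, inner_sub_right]
  · intro k
    have := rapidX_of_weighted (κ := fun _ => 0) (w := w k) (h := d k)
      (fun t => by simpa only [zero_add] using hwW k t) (hlocw k) (hlocd k)
    simpa only [zero_add] using this
  · intro k
    exact rapidX_of_weighted (hdV k) (hlocd k) (hloch k)
  · have h0 := (hwr 0).tendsto ()
    have h1 := h0.pow 2
    rw [zero_pow two_ne_zero] at h1
    refine h1.congr fun t => ?_
    have h2 : ‖w 0 t‖ ^ 2 = (⟪w 0 t, w 0 t⟫).re := norm_sq_eq_re_inner (𝕜 := ℂ) _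
    have h3 : ∀ z : ℂ, inner ℂ z z = ((‖z‖ ^ 2 : ℝ) : ℂ) := fun z => by
      rw [inner_self_eq_norm_sq_to_K]
      norm_cast
    simp only
    rw [h2, L2.inner_def]
    simp only [h3]
    rw [integral_complex_ofReal, Complex.ofReal_re]
    refine integral_congr_ae ?_
    filter_upwards [hwW 0 t] with x hx
    rw [hx]

end HalfLineSolution

section SmoothClass

/-- The closed right half-plane. -/
def halfPlane : Set (ℝ × ℝ) := {p | 0 ≤ p.1}

/-- Functions with `n` continuous derivatives on the closed half-plane, all of which satisfy `Q`. -/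
def SmoothClass (Q : (ℝ → ℝ → ℂ) → Prop) : ℕ → (ℝ → ℝ → ℂ) → Prop
  | 0, f => ContinuousOn (uncurry f) halfPlane ∧ Q f
  | n + 1, f => (ContinuousOn (uncurry f) halfPlane ∧ Q f) ∧ ∃ fx ft : ℝ → ℝ → ℂ,
      SmoothClass Q n fx ∧ SmoothClass Q n ft ∧
      (∀ x t, 0 ≤ x → HasDerivWithinAt (fun y => f y t) (fx x t) (Ici 0) x) ∧
      ∀ x t, 0 ≤ x → HasDerivAt (fun s => f x s) (ft x t) t

variable {Q Q1 Q2 : (ℝ → ℝ → ℂ) → Prop}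

theorem SmoothClass.base {n : ℕ} {f : ℝ → ℝ → ℂ} (h : SmoothClass Q n f) :
    ContinuousOn (uncurry f) halfPlane ∧ Q f := by
  cases n with
  | zero => exact h
  | succ n => exact h.1

theorem SmoothClass.of_succ {n : ℕ} {f : ℝ → ℝ → ℂ} (h : SmoothClass Q (n + 1) f) :
    SmoothClass Q n f := by
  induction n generalizing f with
  | zero => exact h.1
  | succ n ih =>
    obtain ⟨h0, fx, ft, hx, ht, h1, h2⟩ := h
    exact ⟨h0, fx, ft, ih hx, ih ht, h1, h2⟩

theorem SmoothClass.add (hQ : ∀ f g, Q f → Q g → Q (fun x t => f x t + g x t)) {n : ℕ}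
    {f g : ℝ → ℝ → ℂ} (hf : SmoothClass Q n f) (hg : SmoothClass Q n g) :
    SmoothClass Q n fun x t => f x t + g x t := by
  induction n generalizing f g with
  | zero => exact ⟨hf.1.add hg.1, hQ _ _ hf.2 hg.2⟩
  | succ n ih =>
    obtain ⟨h0, fx, ft, hx, ht, h1, h2⟩ := hf
    obtain ⟨h0', gx, gt, hx', ht', h1', h2'⟩ := hg
    exact ⟨⟨h0.1.add h0'.1, hQ _ _ h0.2 h0'.2⟩, _, _, ih hx hx', ih ht ht',
      fun x t h => (h1 x t h).fun_add (h1' x t h), fun x t h => (h2 x t h).fun_add (h2' x t h)⟩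

theorem SmoothClass.mul (hQ : ∀ f g, Q f → Q g → Q (fun x t => f x t + g x t))
    (hm : ∀ f g, Q1 f → Q2 g → Q (fun x t => f x t * g x t)) {n : ℕ}
    {f g : ℝ → ℝ → ℂ} (hf : SmoothClass Q1 n f) (hg : SmoothClass Q2 n g) :
    SmoothClass Q n fun x t => f x t * g x t := by
  induction n generalizing f g with
  | zero => exact ⟨hf.1.mul hg.1, hm _ _ hf.2 hg.2⟩
  | succ n ih =>
    have hf' := hf.of_succ
    have hg' := hg.of_succ
    obtain ⟨h0, fx, ft, hx, ht, h1, h2⟩ := hf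
    obtain ⟨h0', gx, gt, hx', ht', h1', h2'⟩ := hg
    exact ⟨⟨h0.1.mul h0'.1, hm _ _ h0.2 h0'.2⟩, _, _, (ih hx hg').add hQ (ih hf' hx'),
      (ih ht hg').add hQ (ih hf' ht'), fun x t h => (h1 x t h).fun_mul (h1' x t h),
      fun x t h => (h2 x t h).fun_mul (h2' x t h)⟩

theorem hasFDerivWithinAt_halfPlane {f fx ft : ℝ → ℝ → ℂ}
    (hx : ∀ x t, 0 ≤ x → HasDerivWithinAt (fun y => f y t) (fx x t) (Ici 0) x)
    (ht : ∀ x t, 0 ≤ x → HasDerivAt (fun s => f x s) (ft x t) t)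
    (hc : ContinuousOn (uncurry fx) halfPlane) {p : ℝ × ℝ} (hp : p ∈ halfPlane) :
    HasFDerivWithinAt (uncurry f) ((ContinuousLinearMap.fst ℝ ℝ ℝ).smulRight (fx p.1 p.2) +
      (ContinuousLinearMap.snd ℝ ℝ ℝ).smulRight (ft p.1 p.2)) halfPlane p := by
  obtain ⟨x₀, t₀⟩ := p
  have hx0 : (0:ℝ) ≤ x₀ := hp
  have h1 : HasFDerivWithinAt (fun q : ℝ × ℝ => f x₀ q.2)
      ((ContinuousLinearMap.snd ℝ ℝ ℝ).smulRight (ft x₀ t₀)) halfPlane (x₀, t₀) := by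
    have := ((ht x₀ t₀ hx0).hasFDerivAt.comp (x₀, t₀) (hasFDerivAt_snd (𝕜 := ℝ))).hasFDerivWithinAt
      (s := halfPlane)
    refine this.congr_fderiv ?_
    ext <;> simp
  have h2 : HasFDerivWithinAt (fun q : ℝ × ℝ => f q.1 q.2 - f x₀ q.2)
      ((ContinuousLinearMap.fst ℝ ℝ ℝ).smulRight (fx x₀ t₀)) halfPlane (x₀, t₀) := by
    rw [hasFDerivWithinAt_iff_isLittleO, Asymptotics.isLittleO_iff]
    intro c hc0
    have hcw := hc (x₀, t₀) hp
    rw [Metric.continuousWithinAt_iff] at hcw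
    obtain ⟨δ, hδ, hball⟩ := hcw c hc0
    filter_upwards [self_mem_nhdsWithin, mem_nhdsWithin_of_mem_nhds (Metric.ball_mem_nhds _ hδ)] with q hq hqb
    obtain ⟨x, t⟩ := q
    have hq0 : (0:ℝ) ≤ x := hq
    have hb : |x - x₀| < δ ∧ |t - t₀| < δ := by
      simpa [Metric.mem_ball, Prod.dist_eq, Real.dist_eq] using hqb
    have hmv := (convex_uIcc x₀ x).norm_image_sub_le_of_norm_hasDerivWithin_le
      (f := fun y => f y t - y • fx x₀ t₀) (f' := fun y => fx y t - (1:ℝ) • fx x₀ t₀) (C := c) (x := x₀) (y := x)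
      (fun y hy => by
        have hy0 : 0 ≤ y := le_trans (le_inf hx0 hq0) hy.1
        exact (((hx y t hy0).mono fun z hz => le_trans (le_inf hx0 hq0) hz.1).fun_sub
          ((hasDerivWithinAt_id y _).smul_const (fx x₀ t₀))))
      (fun y hy => by
        have hy0 : 0 ≤ y := le_trans (le_inf hx0 hq0) hy.1
        have hyx : |y - x₀| ≤ |x - x₀| := abs_sub_left_of_mem_uIcc hy
        have := hball (x := (y, t)) hy0 (by
          simp only [Prod.dist_eq, Real.dist_eq]
          exact max_lt (hyx.trans_lt hb.1) hb.2)
        rw [one_smul, ← dist_eq_norm]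
        exact this.le)
      left_mem_uIcc right_mem_uIcc
    simp only [sub_self]
    refine le_trans (le_of_eq ?_) (hmv.trans ?_)
    · congr 1
      simp [sub_smul, Complex.real_smul]
      ring
    · refine mul_le_mul_of_nonneg_left ?_ hc0.le
      exact norm_fst_le ((x, t) - (x₀, t₀))
  refine (h2.add h1).congr_of_eventuallyEq (Eventually.of_forall fun q => ?_) ?_ <;> simp [uncurry]

theorem uniqueDiffOn_halfPlane : UniqueDiffOn ℝ halfPlane := by
  refine uniqueDiffOn_convex (convex_halfSpace_ge (LinearMap.isLinear (LinearMap.fst ℝ ℝ ℝ)) 0) ?_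
  refine ⟨(1, 0), mem_interior_iff_mem_nhds.2 ?_⟩
  filter_upwards [(isOpen_lt continuous_const continuous_fst).mem_nhds
    (show (0:ℝ) < ((1, 0) : ℝ × ℝ).1 by norm_num)] with q hq
  exact le_of_lt hq

theorem SmoothClass.contDiffOn {n : ℕ} {f : ℝ → ℝ → ℂ} (h : SmoothClass Q n f) :
    ContDiffOn ℝ n (uncurry f) halfPlane := by
  induction n generalizing f with
  | zero => exact contDiffOn_zero.2 h.1
  | succ n ih =>
    obtain ⟨h0, fx, ft, hx, ht, h1, h2⟩ := h
    push_cast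
    refine (contDiffOn_succ_iff_hasFDerivWithinAt_of_uniqueDiffOn uniqueDiffOn_halfPlane).2 ⟨by simp, _, ?_,
      fun p hp => hasFDerivWithinAt_halfPlane h1 h2 hx.base.1 hp⟩
    exact (contDiffOn_const.smulRight (ih hx)).add (contDiffOn_const.smulRight (ih ht))

theorem SmoothClass.iterate_pdX {f : ℝ → ℝ → ℂ} (m : ℕ) {n : ℕ} (h : SmoothClass Q (n + m) f) :
    ∃ f', SmoothClass Q n f' ∧ ∀ x t, 0 < x → (pdX^[m] f) x t = f' x t := by
  induction m generalizing n with
  | zero => exact ⟨f, h, fun _ _ _ => rfl⟩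
  | succ m ih =>
    obtain ⟨f', hf', he⟩ := ih (n := n + 1) (by rwa [add_assoc, add_comm 1])
    obtain ⟨-, fx, -, hx, -, h1, -⟩ := hf'
    refine ⟨fx, hx, fun x t hxp => ?_⟩
    rw [iterate_succ_apply', pdX]
    have h2 : HasDerivAt (fun y => f' y t) (fx x t) x := (h1 x t hxp.le).hasDerivAt (Ici_mem_nhds hxp)
    refine (h2.congr_of_eventuallyEq ?_).deriv
    filter_upwards [Ioi_mem_nhds hxp] with y hy using he y t hy

theorem SmoothClass.iterate_pdT {f g : ℝ → ℝ → ℂ} (hg : ∀ x t, 0 < x → g x t = f x t) (m : ℕ) {n : ℕ}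
    (h : SmoothClass Q (n + m) f) :
    ∃ f', SmoothClass Q n f' ∧ ∀ x t, 0 < x → (pdT^[m] g) x t = f' x t := by
  induction m generalizing n with
  | zero => exact ⟨f, h, hg⟩
  | succ m ih =>
    obtain ⟨f', hf', he⟩ := ih (n := n + 1) (by rwa [add_assoc, add_comm 1])
    obtain ⟨-, -, ft, -, ht, -, h1⟩ := hf'
    refine ⟨ft, ht, fun x t hxp => ?_⟩
    rw [iterate_succ_apply', pdT]
    exact ((h1 x t hxp.le).congr_of_eventuallyEq (Eventually.of_forall fun s => he x s hxp)).deriv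

theorem SmoothClass.decay {f : ℝ → ℝ → ℂ} (h : ∀ n, SmoothClass RapidX n f) (α β γ : ℕ) (A₁ A₂ : ℝ)
    {ε : ℝ} (hε : 0 < ε) : ∃ X : ℝ, ∀ x ≥ X, ∀ t ∈ Icc A₁ A₂, x ^ α * ‖(pdT^[β] (pdX^[γ] f)) x t‖ < ε := by
  obtain ⟨f₁, h₁, e₁⟩ := (h (0 + β + γ)).iterate_pdX
  obtain ⟨f₂, h₂, e₂⟩ := h₁.iterate_pdT e₁
  obtain ⟨C, hC⟩ := h₂.2 (α + 1) (max |A₁| |A₂|)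
  refine ⟨max 1 ((|C| + 1) / ε), fun x hx t ht => ?_⟩
  have hx1 : 1 ≤ x := (le_max_left _ _).trans hx
  have hx0 : 0 < x := by linarith
  have hx2 : |C| + 1 ≤ x * ε := (div_le_iff₀ hε).1 ((le_max_right _ _).trans hx)
  have hb := hC x t hx1 (abs_le_max_abs_abs ht.1 ht.2)
  rw [e₂ x t hx0]
  refine lt_of_mul_lt_mul_left (a := x) ?_ hx0.le
  calc x * (x ^ α * ‖f₂ x t‖) = x ^ (α + 1) * ‖f₂ x t‖ := by ring
    _ ≤ C := hb
    _ < |C| + 1 := by linarith [le_abs_self C]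
    _ ≤ _ := hx2

theorem RapidX.add {f g : ℝ → ℝ → ℂ} (hf : RapidX f) (hg : RapidX g) :
    RapidX fun x t => f x t + g x t := by
  intro a A
  obtain ⟨C, hC⟩ := hf a A
  obtain ⟨D, hD⟩ := hg a A
  refine ⟨C + D, fun x t hx ht => ?_⟩
  have h0 : 0 ≤ x ^ a := by positivity
  nlinarith [hC x t hx ht, hD x t hx ht, norm_add_le (f x t) (g x t)]

/-- Polynomial growth in `x`, locally uniformly in `t`. -/
def PolyX (f : ℝ → ℝ → ℂ) : Prop :=
  ∀ A : ℝ, ∃ (N : ℕ) (C : ℝ), ∀ x t : ℝ, 1 ≤ x → |t| ≤ A → ‖f x t‖ ≤ C * x ^ N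

theorem PolyX.add {f g : ℝ → ℝ → ℂ} (hf : PolyX f) (hg : PolyX g) :
    PolyX fun x t => f x t + g x t := by
  intro A
  obtain ⟨N, C, hC⟩ := hf A
  obtain ⟨M, D, hD⟩ := hg A
  refine ⟨N + M, |C| + |D|, fun x t hx ht => (norm_add_le _ _).trans ?_⟩
  have h1 : x ^ N ≤ x ^ (N + M) := pow_le_pow_right₀ hx (by omega)
  have h2 : x ^ M ≤ x ^ (N + M) := pow_le_pow_right₀ hx (by omega)
  have h3 : C * x ^ N ≤ |C| * x ^ (N + M) :=
    mul_le_mul (le_abs_self C) h1 (by positivity) (abs_nonneg C)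
  have h4 : D * x ^ M ≤ |D| * x ^ (N + M) :=
    mul_le_mul (le_abs_self D) h2 (by positivity) (abs_nonneg D)
  linarith [hC x t hx ht, hD x t hx ht]

theorem PolyX.mul {f g : ℝ → ℝ → ℂ} (hf : PolyX f) (hg : PolyX g) :
    PolyX fun x t => f x t * g x t := by
  intro A
  obtain ⟨N, C, hC⟩ := hf A
  obtain ⟨M, D, hD⟩ := hg A
  refine ⟨N + M, C * D, fun x t hx ht => ?_⟩
  rw [norm_mul, pow_add, mul_mul_mul_comm]
  exact mul_le_mul (hC x t hx ht) (hD x t hx ht) (norm_nonneg _)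
    ((norm_nonneg _).trans (hC x t hx ht))

theorem PolyX.mul_rapidX {f g : ℝ → ℝ → ℂ} (hf : PolyX f) (hg : RapidX g) :
    RapidX fun x t => f x t * g x t := by
  intro a A
  obtain ⟨N, C, hC⟩ := hf A
  obtain ⟨D, hD⟩ := hg (N + a) A
  refine ⟨|C| * D, fun x t hx ht => ?_⟩
  have hx0 : 0 ≤ x := by linarith
  rw [norm_mul]
  calc x ^ a * (‖f x t‖ * ‖g x t‖) ≤ x ^ a * (|C| * x ^ N * ‖g x t‖) := by
        gcongr
        exact (hC x t hx ht).trans (mul_le_mul_of_nonneg_right (le_abs_self C) (by positivity))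
    _ = |C| * (x ^ (N + a) * ‖g x t‖) := by ring
    _ ≤ _ := mul_le_mul_of_nonneg_left (hD x t hx ht) (abs_nonneg C)

theorem polyX_const (c : ℂ) : PolyX fun _ _ => c := fun _ => ⟨0, ‖c‖, fun _ _ _ _ => by simp⟩

theorem polyX_fst : PolyX fun x _ => (x : ℂ) := fun _ => ⟨1, 1, fun x t hx _ => by
  simp [abs_of_pos (show 0 < x by linarith)]⟩

theorem polyX_snd : PolyX fun _ t => (t : ℂ) := fun A => ⟨0, A, fun x t _ ht => by simpa using ht⟩

theorem smoothClass_const (c : ℂ) (n : ℕ) : SmoothClass PolyX n fun _ _ => c := by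
  induction n generalizing c with
  | zero => exact ⟨continuousOn_const, polyX_const c⟩
  | succ n ih =>
    exact ⟨⟨continuousOn_const, polyX_const c⟩, _, _, ih 0, ih 0,
      fun x t _ => hasDerivWithinAt_const _ _ _, fun x t _ => hasDerivAt_const _ _⟩

theorem smoothClass_fst (n : ℕ) : SmoothClass PolyX n fun x _ => (x : ℂ) := by
  have hc : ContinuousOn (uncurry fun (x : ℝ) (_ : ℝ) => (x : ℂ)) halfPlane :=
    (Complex.continuous_ofReal.comp continuous_fst).continuousOn
  cases n with
  | zero => exact ⟨hc, polyX_fst⟩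
  | succ n =>
    exact ⟨⟨hc, polyX_fst⟩, _, _, smoothClass_const 1 n, smoothClass_const 0 n,
      fun x t _ => (hasDerivAt_id x).ofReal_comp.hasDerivWithinAt, fun x t _ => hasDerivAt_const _ _⟩

theorem smoothClass_snd (n : ℕ) : SmoothClass PolyX n fun _ t => (t : ℂ) := by
  have hc : ContinuousOn (uncurry fun (_ : ℝ) (t : ℝ) => (t : ℂ)) halfPlane :=
    (Complex.continuous_ofReal.comp continuous_snd).continuousOn
  cases n with
  | zero => exact ⟨hc, polyX_snd⟩
  | succ n =>
    exact ⟨⟨hc, polyX_snd⟩, _, _, smoothClass_const 0 n, smoothClass_const 1 n,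
      fun x t _ => hasDerivWithinAt_const _ _ _, fun x t _ => (hasDerivAt_id t).ofReal_comp⟩

theorem SmoothClass.polyAdd {n : ℕ} {f g : ℝ → ℝ → ℂ} (hf : SmoothClass PolyX n f)
    (hg : SmoothClass PolyX n g) : SmoothClass PolyX n fun x t => f x t + g x t :=
  hf.add (fun _ _ => PolyX.add) hg

theorem SmoothClass.polyMul {n : ℕ} {f g : ℝ → ℝ → ℂ} (hf : SmoothClass PolyX n f)
    (hg : SmoothClass PolyX n g) : SmoothClass PolyX n fun x t => f x t * g x t :=
  hf.mul (fun _ _ => PolyX.add) (fun _ _ => PolyX.mul) hg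

theorem SmoothClass.rapidAdd {n : ℕ} {f g : ℝ → ℝ → ℂ} (hf : SmoothClass RapidX n f)
    (hg : SmoothClass RapidX n g) : SmoothClass RapidX n fun x t => f x t + g x t :=
  hf.add (fun _ _ => RapidX.add) hg

theorem SmoothClass.polyMulRapid {n : ℕ} {f g : ℝ → ℝ → ℂ} (hf : SmoothClass PolyX n f)
    (hg : SmoothClass RapidX n g) : SmoothClass RapidX n fun x t => f x t * g x t :=
  hf.mul (fun _ _ => RapidX.add) (fun _ _ => PolyX.mul_rapidX) hg

/-- The unimodular factor passing to the accelerated frame. -/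
def framePhase (x t : ℝ) : ℂ := Complex.exp (Complex.I * (x * t ^ 2 / 2 - t ^ 5 / 40))

theorem norm_framePhase (x t : ℝ) : ‖framePhase x t‖ = 1 := by
  have := Complex.norm_exp_ofReal_mul_I (x * t ^ 2 / 2 - t ^ 5 / 40)
  rw [framePhase, mul_comm]
  exact_mod_cast this

theorem hasDerivAt_framePhase_fst (x t : ℝ) :
    HasDerivAt (fun y => framePhase y t) (Complex.I / 2 * t * t * framePhase x t) x := by
  have h1 : HasDerivAt (fun y : ℝ => Complex.I * ((y : ℂ) * t ^ 2 / 2 - t ^ 5 / 40))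
      (Complex.I * (1 * t ^ 2 / 2)) x := by
    have := (hasDerivAt_id x).ofReal_comp
    exact ((((this.mul_const _).div_const 2).sub_const _).const_mul Complex.I)
  refine h1.cexp.congr_deriv ?_
  rw [framePhase]
  ring

theorem hasDerivAt_framePhase_snd (x t : ℝ) : HasDerivAt (fun s => framePhase x s)
    ((Complex.I * x * t + -Complex.I / 8 * t * t * t * t) * framePhase x t) t := by
  have h1 : HasDerivAt (fun s : ℝ => Complex.I * ((x : ℂ) * s ^ 2 / 2 - s ^ 5 / 40))
      (Complex.I * ((x : ℂ) * (2 * t) / 2 - 5 * t ^ 4 / 40)) t := by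
    have := (hasDerivAt_id t).ofReal_comp
    have h2 : HasDerivAt (fun s : ℝ => (s : ℂ) ^ 2) (2 * t) t := by simpa using this.fun_pow 2
    have h5 : HasDerivAt (fun s : ℝ => (s : ℂ) ^ 5) (5 * t ^ 4) t := by simpa using this.fun_pow 5
    exact ((((h2.const_mul _).div_const 2).sub (h5.div_const _)).const_mul Complex.I)
  refine h1.cexp.congr_deriv ?_
  rw [framePhase]
  ring

theorem continuous_framePhase : Continuous (uncurry framePhase) := by
  unfold framePhase uncurry
  fun_prop

theorem polyX_framePhase : PolyX framePhase := fun _ => ⟨0, 1, fun x t _ _ => by simp [norm_framePhase]⟩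

theorem smoothClass_framePhase (n : ℕ) : SmoothClass PolyX n framePhase := by
  induction n with
  | zero => exact ⟨continuous_framePhase.continuousOn, polyX_framePhase⟩
  | succ n ih =>
    have ht := smoothClass_snd n
    have hx := smoothClass_fst n
    have hc := fun c => smoothClass_const c n
    exact ⟨⟨continuous_framePhase.continuousOn, polyX_framePhase⟩, _, _, (((hc _).polyMul ht).polyMul ht).polyMul ih,
      ((((hc _).polyMul hx).polyMul ht).polyAdd
        (((((hc _).polyMul ht).polyMul ht).polyMul ht).polyMul ht)).polyMul ih,
      fun x t _ => (hasDerivAt_framePhase_fst x t).hasDerivWithinAt, fun x t _ => hasDerivAt_framePhase_snd x t⟩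

theorem rapidX_exp {γ : ℝ → ℂ} (hγ : Continuous γ) :
    RapidX fun x t => γ t * (Real.exp (-x) : ℂ) := by
  intro a A
  obtain ⟨C, hC⟩ := (isCompact_Icc (a := -A) (b := A)).exists_bound_of_continuousOn hγ.continuousOn
  refine ⟨a.factorial * |C|, fun x t hx ht => ?_⟩
  have h1 : x ^ a ≤ a.factorial * Real.exp x := by
    have := Real.pow_div_factorial_le_exp x (by linarith) a
    rwa [div_le_iff₀' (by positivity)] at this
  rw [norm_mul, Complex.norm_real, Real.norm_eq_abs, abs_of_pos (Real.exp_pos _)]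
  have h2 := (hC t (abs_le.1 ht)).trans (le_abs_self C)
  calc x ^ a * (‖γ t‖ * Real.exp (-x)) ≤ (a.factorial * Real.exp x) * (|C| * Real.exp (-x)) := by gcongr
    _ = a.factorial * |C| * (Real.exp x * Real.exp (-x)) := by ring
    _ = _ := by rw [← Real.exp_add]; simp

theorem smoothClass_exp {γ : ℕ → ℝ → ℂ} (hγ : ∀ k t, HasDerivAt (γ k) (γ (k + 1) t) t) (n k : ℕ) :
    SmoothClass RapidX n fun x t => γ k t * (Real.exp (-x) : ℂ) := by
  have hcγ : ∀ k, Continuous (γ k) := fun k => continuous_iff_continuousAt.2 fun t => (hγ k t).continuousAt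
  have hc : ∀ k, ContinuousOn (uncurry fun (x t : ℝ) => γ k t * (Real.exp (-x) : ℂ)) halfPlane := fun k =>
    (((hcγ k).comp continuous_snd).mul (by fun_prop)).continuousOn
  induction n generalizing k with
  | zero => exact ⟨hc k, rapidX_exp (hcγ k)⟩
  | succ n ih =>
    refine ⟨⟨hc k, rapidX_exp (hcγ k)⟩, _, _, (smoothClass_const (-1) n).polyMulRapid (ih k), ih (k + 1),
      fun x t _ => ?_, fun x t _ => (hγ k t).mul_const _⟩
    have h1 : HasDerivAt (fun y : ℝ => Real.exp (-y)) (Real.exp (-x) * -1) x := (hasDerivAt_neg x).exp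
    refine ((h1.ofReal_comp.const_mul (γ k t)).congr_deriv ?_).hasDerivWithinAt
    push_cast
    ring

theorem smoothClass_halfline {W V : ℕ → ℝ → ℝ → ℂ} {γ : ℕ → ℝ → ℂ}
    (hγ : ∀ k t, HasDerivAt (γ k) (γ (k + 1) t) t)
    (hWc : ∀ k, Continuous (uncurry (W k))) (hVc : ∀ k, Continuous (uncurry (V k)))
    (hWt : ∀ k x t, HasDerivAt (fun s => W k x s) (W (k + 1) x t) t)
    (hVt : ∀ k x t, HasDerivAt (fun s => V k x s) (V (k + 1) x t) t)
    (hWx : ∀ k x t, 0 ≤ x → HasDerivWithinAt (fun y => W k y t) (V k x t) (Ici 0) x)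
    (hVx : ∀ k x t, 0 ≤ x → HasDerivWithinAt (fun y => V k y t)
        (-2 * Complex.I * (W (k + 1) x t + ((t ^ 2 / 2 : ℝ) : ℂ) * V k x t +
          ((k * t : ℝ) : ℂ) * V (k - 1) x t + ((k.choose 2 : ℝ) : ℂ) * V (k - 2) x t -
          γ k t * (Real.exp (-x) : ℂ))) (Ici 0) x)
    (hWr : ∀ k, RapidX (W k)) (hVr : ∀ k, RapidX (V k)) (n : ℕ) :
    ∀ k, SmoothClass RapidX n (W k) ∧ SmoothClass RapidX n (V k) := by
  induction n with
  | zero => exact fun k => ⟨⟨(hWc k).continuousOn, hWr k⟩, (hVc k).continuousOn, hVr k⟩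
  | succ n ih =>
    intro k
    refine ⟨⟨⟨(hWc k).continuousOn, hWr k⟩, V k, W (k + 1), (ih k).2, (ih (k + 1)).1, hWx k,
      fun x t _ => hWt k x t⟩, ⟨(hVc k).continuousOn, hVr k⟩, _, V (k + 1), ?_, (ih (k + 1)).2, hVx k,
      fun x t _ => hVt k x t⟩
    have ht := smoothClass_snd n
    have hc := fun c => smoothClass_const c n
    have h1 := (hc (-2 * Complex.I)).polyMulRapid ((((((ih (k + 1)).1.rapidAdd
      ((((hc (1 / 2)).polyMul ht).polyMul ht).polyMulRapid (ih k).2)).rapidAdd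
      (((hc k).polyMul ht).polyMulRapid (ih (k - 1)).2)).rapidAdd
      ((hc (k.choose 2)).polyMulRapid (ih (k - 2)).2))).rapidAdd
      ((hc (-1)).polyMulRapid (smoothClass_exp hγ n k)))
    convert h1 using 3
    push_cast
    ring

end SmoothClass

section Uniqueness

theorem ContDiffOn.exists_partials {f : ℝ → ℝ → ℂ}
    (hf : ContDiffOn ℝ (⊤ : ℕ∞) (uncurry f) halfPlane) :
    ∃ fx ft : ℝ → ℝ → ℂ, ContDiffOn ℝ (⊤ : ℕ∞) (uncurry fx) halfPlane ∧
      ContDiffOn ℝ (⊤ : ℕ∞) (uncurry ft) halfPlane ∧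
      (∀ x t, 0 ≤ x → HasDerivWithinAt (fun y => f y t) (fx x t) (Ici 0) x) ∧
      ∀ x t, 0 ≤ x → HasDerivAt (fun s => f x s) (ft x t) t := by
  have hD := hf.fderivWithin (m := (⊤ : ℕ∞)) uniqueDiffOn_halfPlane (by norm_cast)
  have hd : ∀ x t, 0 ≤ x → HasFDerivWithinAt (uncurry f) (fderivWithin ℝ (uncurry f) halfPlane (x, t))
      halfPlane (x, t) := fun x t hx =>
    ((hf.differentiableOn (by simp)) (x, t) hx).hasFDerivWithinAt
  refine ⟨fun x t => fderivWithin ℝ (uncurry f) halfPlane (x, t) (1, 0),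
    fun x t => fderivWithin ℝ (uncurry f) halfPlane (x, t) (0, 1), hD.clm_apply contDiffOn_const,
    hD.clm_apply contDiffOn_const, fun x t hx => ?_, fun x t hx => ?_⟩
  · exact (hd x t hx).comp_hasDerivWithinAt (f := fun y : ℝ => (y, t)) x
      ((hasDerivWithinAt_id x _).prodMk (hasDerivWithinAt_const x _ t)) fun y hy => hy
  · have := (hd x t hx).comp_hasDerivWithinAt (f := fun s : ℝ => (x, s)) (s := univ) t
      ((hasDerivWithinAt_const t _ x).prodMk (hasDerivWithinAt_id t _)) fun y _ => hx
    exact hasDerivWithinAt_univ.1 this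

theorem pdX_eq_of_hasDerivWithinAt {f fx : ℝ → ℝ → ℂ}
    (h : ∀ x t, 0 ≤ x → HasDerivWithinAt (fun y => f y t) (fx x t) (Ici 0) x) {x : ℝ} (hx : 0 < x) (t : ℝ) :
    pdX f x t = fx x t :=
  ((h x t hx.le).hasDerivAt (Ici_mem_nhds hx)).deriv

theorem pdX_pdX_eq {f fx fxx : ℝ → ℝ → ℂ}
    (h : ∀ x t, 0 ≤ x → HasDerivWithinAt (fun y => f y t) (fx x t) (Ici 0) x)
    (h' : ∀ x t, 0 ≤ x → HasDerivWithinAt (fun y => fx y t) (fxx x t) (Ici 0) x) {x : ℝ} (hx : 0 < x) (t : ℝ) :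
    pdX (pdX f) x t = fxx x t := by
  rw [← pdX_eq_of_hasDerivWithinAt h' hx, pdX, pdX]
  refine EventuallyEq.deriv_eq ?_
  filter_upwards [Ioi_mem_nhds hx] with y hy using pdX_eq_of_hasDerivWithinAt h hy t

theorem norm_sq_flux {u ux uxx ut : ℝ → ℝ → ℂ} (hu : ContinuousOn (uncurry u) halfPlane)
    (hux : ContinuousOn (uncurry ux) halfPlane) (hut : ContinuousOn (uncurry ut) halfPlane)
    (h1 : ∀ x t, 0 ≤ x → HasDerivWithinAt (fun y => u y t) (ux x t) (Ici 0) x)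
    (h2 : ∀ x t, 0 ≤ x → HasDerivWithinAt (fun y => ux y t) (uxx x t) (Ici 0) x)
    (h3 : ∀ x t, 0 ≤ x → HasDerivAt (fun s => u x s) (ut x t) t)
    (he : ∀ x t : ℝ, 0 < x → Complex.I * ut x t = -(1 / 2) * uxx x t - (x : ℂ) * (t : ℂ) * u x t)
    (h0 : ∀ t, u 0 t = 0) {R : ℝ} (hR : 0 ≤ R) (t₁ t₂ : ℝ) :
    (∫ x in (0:ℝ)..R, ‖u x t₂‖ ^ 2) - ∫ x in (0:ℝ)..R, ‖u x t₁‖ ^ 2 =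
      -∫ t in t₁..t₂, (inner ℂ (u R t) (ux R t)).im := by
  have hline : ∀ (f : ℝ → ℝ → ℂ), ContinuousOn (uncurry f) halfPlane → ∀ t, ContinuousOn (fun x => f x t) (Ici 0) :=
    fun f hf t => hf.comp (f := fun x => (x, t)) (by fun_prop) fun x hx => hx
  have hvert : ∀ (f : ℝ → ℝ → ℂ), ContinuousOn (uncurry f) halfPlane → ∀ x, 0 ≤ x → Continuous (fun t => f x t) :=
    fun f hf x hx => hf.comp_continuous (f := fun t => (x, t)) (by fun_prop) fun _ => hx
  have hsub : uIcc 0 R ⊆ Ici 0 := by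
    rw [uIcc_of_le hR]; exact Icc_subset_Ici_self
  have hint : ∀ t, IntervalIntegrable (fun x => ‖u x t‖ ^ 2) volume 0 R := fun t =>
    (((hline u hu t).mono hsub).norm.pow 2).intervalIntegrable
  rw [← intervalIntegral.integral_sub (hint _) (hint _)]
  have hρc : ContinuousOn (uncurry fun x t => 2 * (inner ℂ (u x t) (ut x t)).re) halfPlane :=
    continuousOn_const.mul (Complex.continuous_re.comp_continuousOn (hu.inner hut))
  have e1 : ∀ x ∈ uIcc 0 R, ‖u x t₂‖ ^ 2 - ‖u x t₁‖ ^ 2 =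
      ∫ t in t₁..t₂, 2 * (inner ℂ (u x t) (ut x t)).re := fun x hx => by
    symm
    refine intervalIntegral.integral_eq_sub_of_hasDerivAt (f := fun t => ‖u x t‖ ^ 2)
      (fun t _ => hasDerivAt_norm_sq_complex (h3 x t (hsub hx))) (Continuous.intervalIntegrable ?_ _ _)
    exact continuous_const.mul (Complex.continuous_re.comp ((hvert u hu x (hsub hx)).inner (hvert ut hut x (hsub hx))))
  rw [intervalIntegral.integral_congr e1, intervalIntegral_intervalIntegral_swap, ← intervalIntegral.integral_neg]
  swap
  · refine IntegrableOn.mono_set (t := uIcc 0 R ×ˢ uIcc t₁ t₂) ?_ (prod_mono uIoc_subset_uIcc uIoc_subset_uIcc)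
    exact (hρc.mono fun p hp => hsub hp.1).integrableOn_compact (isCompact_uIcc.prod isCompact_uIcc)
  refine intervalIntegral.integral_congr fun t _ => ?_
  have hJ := intervalIntegral.integral_eq_sub_of_hasDerivAt_of_le (f := fun x => -(inner ℂ (u x t) (ux x t)).im)
    (f' := fun x => 2 * (inner ℂ (u x t) (ut x t)).re) hR
    ((Complex.continuous_im.comp_continuousOn
      (((hline u hu t).mono hsub).inner ((hline ux hux t).mono hsub))).neg.mono (by rw [uIcc_of_le hR]))
    (fun x hx => by
      have d1 := (h1 x t hx.1.le).hasDerivAt (Ici_mem_nhds hx.1)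
      have d2 := (h2 x t hx.1.le).hasDerivAt (Ici_mem_nhds hx.1)
      have d := (Complex.imCLM.hasFDerivAt.comp_hasDerivAt x (d1.inner ℂ d2)).neg
      refine d.congr_deriv ?_
      have hut' : ut x t = Complex.I * (1 / 2 * uxx x t + (x : ℂ) * (t : ℂ) * u x t) := by
        linear_combination -Complex.I * he x t hx.1 + ut x t * Complex.I_mul_I
      rw [hut']
      have hr : ((‖ux x t‖ : ℂ) ^ 2).im = 0 := by norm_cast
      simp [Complex.mul_re, Complex.mul_im, hr]
      ring)
    ((((hρc.comp (f := fun x => (x, t)) (s := uIcc 0 R) (by fun_prop) fun x hx => hsub hx)).intervalIntegrable))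
  rw [hJ, h0]
  simp

theorem integrableOn_norm_sq_of_decay {f : ℝ → ℂ} (hc : ContinuousOn f (Ici 0))
    (hd : ∀ᶠ x in atTop, x * ‖f x‖ ≤ 1) : IntegrableOn (fun x => ‖f x‖ ^ 2) (Ioi 0) := by
  refine IntegrableOn.mono_set ?_ Ioi_subset_Ici_self
  refine ((hc.norm.pow 2).locallyIntegrableOn measurableSet_Ici).integrableOn_of_isBigO_atTop
    (g := fun x : ℝ => x ^ (-2 : ℝ)) ?_ (integrableAtFilter_rpow_atTop_iff.2 (by norm_num))
  refine Asymptotics.IsBigO.of_bound 1 ?_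
  filter_upwards [hd, eventually_gt_atTop 0] with x hx hx0
  have h1 : ‖f x‖ ≤ x⁻¹ := by rwa [← one_div, le_div_iff₀' hx0]
  rw [one_mul, Pi.pow_apply, norm_pow, norm_norm, Real.norm_eq_abs, abs_of_nonneg (by positivity),
    Real.rpow_neg hx0.le, Real.rpow_two, ← inv_pow]
  gcongr

theorem continuous_searchlight {G₀ : ℝ → ℂ} (hG : Continuous G₀) (t : ℝ) :
    Continuous fun x => searchlight G₀ x t := by
  unfold searchlight
  refine Continuous.mul ?_ (hG.comp (by fun_prop))
  fun_prop

theorem searchlight_eventually_zero {G₀ : ℝ → ℂ} (hG : HasCompactSupport G₀) {t : ℝ} (ht : 0 < t) :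
    ∀ᶠ x in atTop, searchlight G₀ x t = 0 := by
  have h1 : Tendsto (fun x : ℝ => x / t - t ^ 2 / 6) atTop atTop :=
    tendsto_atTop_add_const_right _ _ (tendsto_id.atTop_div_const ht)
  have h2 : ∀ᶠ y in atTop, G₀ y = 0 := by
    have := hasCompactSupport_iff_eventuallyEq.1 hG
    rw [coclosedCompact_eq_cocompact] at this
    exact this.filter_mono atTop_le_cocompact
  filter_upwards [h1.eventually h2] with x hx
  rw [searchlight, hx, mul_zero]

theorem IsAdmissible.eventually_decay {ψ : ℝ → ℝ → ℂ} (h : IsAdmissible ψ) (γ : ℕ) {A₁ A₂ ε : ℝ} (hA : A₁ < A₂)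
    (hε : 0 < ε) : ∀ᶠ x in atTop, ∀ t ∈ Icc A₁ A₂, x * ‖(pdX^[γ] ψ) x t‖ ≤ ε := by
  obtain ⟨X, hX⟩ := h.decay 1 0 γ A₁ A₂ hA ε hε
  filter_upwards [eventually_ge_atTop X] with x hx t ht
  simpa using (hX x hx t ht).le

theorem IsAdmissible.integrableOn_sub_searchlight {ψ : ℝ → ℝ → ℂ} (h : IsAdmissible ψ) {G₀ : ℝ → ℂ}
    (hG : Continuous G₀) (hcs : HasCompactSupport G₀) {t : ℝ} (ht : 0 < t) :
    IntegrableOn (fun x => ‖ψ x t - searchlight G₀ x t‖ ^ 2) (Ioi 0) := by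
  refine integrableOn_norm_sq_of_decay ?_ ?_
  · exact (h.smooth.continuousOn.comp (f := fun x => (x, t)) (by fun_prop) fun x hx => hx).sub
      (continuous_searchlight hG t).continuousOn
  · filter_upwards [searchlight_eventually_zero hcs ht,
      h.eventually_decay 0 (show t - 1 < t + 1 by linarith) one_pos] with x h1 h2
    rw [h1, sub_zero]
    exact h2 t ⟨by linarith, by linarith⟩

theorem IsAdmissible.eq_of_searchlightLimit {ψ ψ' : ℝ → ℝ → ℂ} {G₀ : ℝ → ℂ} (h : IsAdmissible ψ)
    (h' : IsAdmissible ψ') (hG : Continuous G₀) (hcs : HasCompactSupport G₀) (hl : SearchlightLimit ψ G₀)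
    (hl' : SearchlightLimit ψ' G₀) {x t : ℝ} (hx : 0 ≤ x) : ψ' x t = ψ x t := by
  obtain ⟨px, pt, hpx, hpt, p1, p3⟩ := ContDiffOn.exists_partials h.smooth
  obtain ⟨pxx, -, -, -, p2, -⟩ := ContDiffOn.exists_partials hpx
  obtain ⟨qx, qt, hqx, hqt, q1, q3⟩ := ContDiffOn.exists_partials h'.smooth
  obtain ⟨qxx, -, -, -, q2, -⟩ := ContDiffOn.exists_partials hqx
  set u : ℝ → ℝ → ℂ := fun x t => ψ' x t - ψ x t with hu
  set J : ℝ → ℝ → ℝ := fun x t => (inner ℂ (u x t) (qx x t - px x t)).im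
  have huc : ContinuousOn (uncurry u) halfPlane := h'.smooth.continuousOn.sub h.smooth.continuousOn
  have hflux : ∀ R, 0 ≤ R → ∀ t₁ t₂, (∫ x in (0:ℝ)..R, ‖u x t₂‖ ^ 2) - ∫ x in (0:ℝ)..R, ‖u x t₁‖ ^ 2 =
      -∫ t in t₁..t₂, J R t := fun R hR t₁ t₂ =>
    norm_sq_flux (ux := fun x t => qx x t - px x t) (uxx := fun x t => qxx x t - pxx x t)
      (ut := fun x t => qt x t - pt x t) huc (hqx.continuousOn.sub hpx.continuousOn)
      (hqt.continuousOn.sub hpt.continuousOn)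
      (fun x t hx => (q1 x t hx).fun_sub (p1 x t hx)) (fun x t hx => (q2 x t hx).fun_sub (p2 x t hx))
      (fun x t hx => (q3 x t hx).fun_sub (p3 x t hx))
      (fun x t hx => by
        have e1 := h.eqn x t hx
        have e2 := h'.eqn x t hx
        rw [pdX_pdX_eq p1 p2 hx, pdT, (p3 x t hx.le).deriv] at e1
        rw [pdX_pdX_eq q1 q2 hx, pdT, (q3 x t hx.le).deriv] at e2
        linear_combination e2 - e1)
      (fun t => by simp [hu, h.bc, h'.bc]) hR t₁ t₂
  have hJ : ∀ t₁ t₂, t₁ < t₂ → ∀ ε > 0, ∀ᶠ R in atTop, ∀ t ∈ Icc t₁ t₂, ‖J R t‖ ≤ ε := fun t₁ t₂ ht ε hε => by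
    have hδ : 0 < min 1 (ε / 4) := by positivity
    filter_upwards [h.eventually_decay 0 ht hδ, h'.eventually_decay 0 ht hδ, h.eventually_decay 1 ht hδ,
      h'.eventually_decay 1 ht hδ, eventually_ge_atTop 1] with R a1 a2 a3 a4 hR t ht'
    have hR0 : 0 < R := by linarith
    have key : ∀ z : ℂ, R * ‖z‖ ≤ min 1 (ε / 4) → ‖z‖ ≤ 1 ∧ ‖z‖ ≤ ε / 4 := fun z hz => by
      have h1 : ‖z‖ ≤ R * ‖z‖ := le_mul_of_one_le_left (norm_nonneg _) hR
      exact le_min_iff.1 (h1.trans hz)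
    have a1 := key _ (a1 t ht')
    have a2 := key _ (a2 t ht')
    have a3 := key _ (a3 t ht')
    have a4 := key _ (a4 t ht')
    simp only [iterate_one, iterate_zero, id] at a1 a2 a3 a4
    rw [pdX_eq_of_hasDerivWithinAt p1 hR0] at a3
    rw [pdX_eq_of_hasDerivWithinAt q1 hR0] at a4
    refine (Complex.abs_im_le_norm _).trans ((norm_inner_le_norm _ _).trans ?_)
    have b1 : ‖u R t‖ ≤ 2 := (norm_sub_le _ _).trans (by linarith)
    have b2 : ‖qx R t - px R t‖ ≤ ε / 2 := (norm_sub_le _ _).trans (by linarith)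
    calc ‖u R t‖ * ‖qx R t - px R t‖ ≤ 2 * (ε / 2) := by gcongr
      _ = ε := by ring
  have hlim : Tendsto (fun t => 2 * L2h (fun x => ψ' x t - searchlight G₀ x t) ^ 2 +
      2 * L2h (fun x => ψ x t - searchlight G₀ x t) ^ 2) atTop (nhds 0) := by
    simpa using ((hl'.pow 2).const_mul 2).add ((hl.pow 2).const_mul 2)
  have hL2 : ∀ f : ℝ → ℂ, L2h f ^ 2 = ∫ x in Ioi (0:ℝ), ‖f x‖ ^ 2 := fun f =>
    Real.sq_sqrt (integral_nonneg fun _ => by positivity)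
  have hbound : ∀ t, 0 < t → ∀ R, 0 ≤ R → ∫ x in (0:ℝ)..R, ‖u x t‖ ^ 2 ≤
      2 * L2h (fun x => ψ' x t - searchlight G₀ x t) ^ 2 +
      2 * L2h (fun x => ψ x t - searchlight G₀ x t) ^ 2 := fun t ht R hR => by
    have i1 := h.integrableOn_sub_searchlight hG hcs ht
    have i2 := h'.integrableOn_sub_searchlight hG hcs ht
    rw [hL2, hL2, ← integral_const_mul, ← integral_const_mul, ← integral_add (i2.const_mul 2) (i1.const_mul 2),
      intervalIntegral.integral_of_le hR]
    refine (setIntegral_mono_set (t := Ioi 0) ?_ (Eventually.of_forall fun x => by positivity)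
      (Eventually.of_forall fun x => fun hx => hx.1)).trans (integral_mono_of_nonneg
        (Eventually.of_forall fun x => by positivity) ((i2.const_mul 2).add (i1.const_mul 2))
        (Eventually.of_forall fun x => ?_))
    · refine integrableOn_norm_sq_of_decay (huc.comp (f := fun x => (x, t)) (by fun_prop) fun x hx => hx) ?_
      filter_upwards [h.eventually_decay 0 (show t - 1 < t + 1 by linarith) one_half_pos,
        h'.eventually_decay 0 (show t - 1 < t + 1 by linarith) one_half_pos, eventually_ge_atTop 0] with x a1 a2 hx
      have a1 := a1 t ⟨by linarith, by linarith⟩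
      have a2 := a2 t ⟨by linarith, by linarith⟩
      simp only [iterate_zero, id] at a1 a2
      have := mul_le_mul_of_nonneg_left (norm_sub_le (ψ' x t) (ψ x t)) hx
      linarith
    · have : u x t = (ψ' x t - searchlight G₀ x t) - (ψ x t - searchlight G₀ x t) := by simp [hu]
      beta_reduce
      rw [this]
      have := norm_sub_le (ψ' x t - searchlight G₀ x t) (ψ x t - searchlight G₀ x t)
      have h0 := norm_nonneg ((ψ' x t - searchlight G₀ x t) - (ψ x t - searchlight G₀ x t))
      nlinarith [sq_nonneg (‖ψ' x t - searchlight G₀ x t‖ - ‖ψ x t - searchlight G₀ x t‖)]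
  have hzero : ∀ R, 0 ≤ R → ∀ t, ∫ x in (0:ℝ)..R, ‖u x t‖ ^ 2 ≤ 0 := fun R hR t => by
    refine le_of_forall_pos_le_add fun ε hε => ?_
    obtain ⟨t₂, ⟨ht₂, htt⟩, ht0⟩ := ((hlim.eventually (gt_mem_nhds (half_pos hε))).and
      (eventually_gt_atTop t) |>.and (eventually_gt_atTop 0)).exists
    obtain ⟨R₂, hJ₂, hR₂⟩ := ((hJ t t₂ htt (ε / 2 / (t₂ - t)) (by
      have := sub_pos.2 htt; positivity)).and (eventually_ge_atTop R)).exists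
    have e1 := hflux R₂ (hR.trans hR₂) t t₂
    have e2 : ‖∫ s in t..t₂, J R₂ s‖ ≤ ε / 2 / (t₂ - t) * |t₂ - t| :=
      intervalIntegral.norm_integral_le_of_norm_le_const fun s hs => by
        rw [uIoc_of_le htt.le] at hs
        exact hJ₂ s ⟨hs.1.le, hs.2⟩
    rw [abs_of_pos (sub_pos.2 htt), div_mul_cancel₀ _ (sub_pos.2 htt).ne'] at e2
    have e3 := hbound t₂ ht0 R₂ (hR.trans hR₂)
    have e4 : ∫ x in (0:ℝ)..R, ‖u x t‖ ^ 2 ≤ ∫ x in (0:ℝ)..R₂, ‖u x t‖ ^ 2 := by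
      refine intervalIntegral.integral_mono_interval le_rfl hR hR₂
        (Eventually.of_forall fun x => by positivity) (ContinuousOn.intervalIntegrable ?_)
      rw [uIcc_of_le (hR.trans hR₂)]
      exact ((huc.comp (f := fun x => (x, t)) (by fun_prop) fun x hx => hx.1)).norm.pow 2
    have e5 := (abs_le.1 (Real.norm_eq_abs _ ▸ e2)).1
    have e6 := (abs_le.1 (Real.norm_eq_abs _ ▸ e2)).2
    linarith
  have hline : ContinuousOn (fun x => ‖u x t‖ ^ 2) (Icc 0 (x + 1)) :=
    ((huc.comp (f := fun x => (x, t)) (by fun_prop) fun x hx => hx.1)).norm.pow 2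
  by_contra hne
  have hpos : 0 < ∫ x in (0:ℝ)..(x + 1), ‖u x t‖ ^ 2 := by
    refine intervalIntegral.integral_pos (by linarith) hline (fun _ _ => by positivity) ⟨x, ⟨hx, by linarith⟩, ?_⟩
    have : u x t ≠ 0 := sub_ne_zero.2 hne
    positivity
  exact absurd (hzero (x + 1) (by linarith) t) (not_le.2 hpos)

end Uniqueness

section FreeWave

/-- Smooth compactly supported amplitudes. -/
def IsTest (g : ℝ → ℂ) : Prop := ContDiff ℝ (⊤ : ℕ∞) g ∧ HasCompactSupport g

theorem IsTest.mul_left {a g : ℝ → ℂ} (ha : ContDiff ℝ (⊤ : ℕ∞) a) (hg : IsTest g) :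
    IsTest fun k => a k * g k := ⟨ha.mul hg.1, hg.2.mul_left⟩

theorem IsTest.mul_id {g : ℝ → ℂ} (hg : IsTest g) : IsTest fun k => (k : ℂ) * g k :=
  .mul_left Complex.ofRealCLM.contDiff hg

theorem IsTest.derivative {g : ℝ → ℂ} (hg : IsTest g) : IsTest (deriv g) :=
  ⟨(contDiff_infty_iff_deriv.1 hg.1).2, hg.2.deriv⟩

theorem IsTest.integrable {g : ℝ → ℂ} (hg : IsTest g) : Integrable g :=
  hg.1.continuous.integrable_of_hasCompactSupport hg.2

theorem IsTest.hasDerivAt {g : ℝ → ℂ} (hg : IsTest g) (k : ℝ) : HasDerivAt g (deriv g k) k :=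
  ((hg.1.differentiable (by simp)) k).hasDerivAt

/-- The plane wave of frequency `k` for the free Schrödinger equation. -/
def planeWave (y t k : ℝ) : ℂ := Complex.exp (Complex.I * ((y * k - t * k ^ 2 / 2 : ℝ) : ℂ))

/-- The superposition of plane waves with amplitude `g`. -/
def freeWave (g : ℝ → ℂ) (y t : ℝ) : ℂ := ∫ k : ℝ, planeWave y t k * g k

theorem norm_planeWave (y t k : ℝ) : ‖planeWave y t k‖ = 1 := by
  rw [planeWave, mul_comm, Complex.norm_exp_ofReal_mul_I]

theorem continuous_planeWave {p q r : ℝ × ℝ → ℝ} (hp : Continuous p) (hq : Continuous q) (hr : Continuous r) :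
    Continuous fun z => planeWave (p z) (q z) (r z) := by
  unfold planeWave
  fun_prop

theorem continuous_planeWave_right (y t : ℝ) : Continuous (planeWave y t) := by
  unfold planeWave
  fun_prop

theorem IsTest.integrable_planeWave_mul {g : ℝ → ℂ} (hg : IsTest g) (y t : ℝ) :
    Integrable fun k => planeWave y t k * g k :=
  ((continuous_planeWave_right y t).mul hg.1.continuous).integrable_of_hasCompactSupport hg.2.mul_left

theorem norm_freeWave_le (g : ℝ → ℂ) (y t : ℝ) : ‖freeWave g y t‖ ≤ ∫ k, ‖g k‖ := by
  refine (norm_integral_le_integral_norm _).trans_eq ?_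
  simp [norm_planeWave]

theorem IsTest.continuous_freeWave {g : ℝ → ℂ} (hg : IsTest g) : Continuous (uncurry (freeWave g)) := by
  unfold freeWave
  refine continuous_of_dominated (bound := fun k => ‖g k‖) (fun z => ?_) (fun z => ?_) hg.integrable.norm ?_
  · exact (hg.integrable_planeWave_mul _ _).aestronglyMeasurable
  · simp [norm_planeWave]
  · exact ae_of_all _ fun k => (continuous_planeWave continuous_fst continuous_snd continuous_const).mul continuous_const

theorem IsTest.hasDerivAt_freeWave {g : ℝ → ℂ} (hg : IsTest g) {p q p' q' : ℝ → ℝ}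
    (hp : ∀ s, HasDerivAt p (p' s) s) (hq : ∀ s, HasDerivAt q (q' s) s) (hp' : Continuous p')
    (hq' : Continuous q') (s : ℝ) :
    HasDerivAt (fun s => freeWave g (p s) (q s))
      (p' s * (Complex.I * freeWave (fun k => (k : ℂ) * g k) (p s) (q s))
        + q' s * (-(Complex.I / 2) * freeWave (fun k => (k : ℂ) * ((k : ℂ) * g k)) (p s) (q s))) s := by
  obtain ⟨P, hP⟩ := (isCompact_closedBall s 1).exists_bound_of_continuousOn hp'.continuousOn
  obtain ⟨R, hR⟩ := (isCompact_closedBall s 1).exists_bound_of_continuousOn hq'.continuousOn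
  have h := hasDerivAt_integral_of_dominated_loc_of_deriv_le (μ := volume) (x₀ := s)
    (F := fun s (k : ℝ) => planeWave (p s) (q s) k * g k)
    (F' := fun s (k : ℝ) => planeWave (p s) (q s) k *
      (p' s * (Complex.I * (k * g k)) + q' s * (-(Complex.I / 2) * (k * (k * g k)))))
    (bound := fun k : ℝ => P * ‖(k : ℂ) * g k‖ + R * (1 / 2 * ‖(k : ℂ) * ((k : ℂ) * g k)‖))
    (s := Metric.closedBall s 1) (Metric.closedBall_mem_nhds s one_pos)
    (.of_forall fun s => (hg.integrable_planeWave_mul _ _).aestronglyMeasurable)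
    (hg.integrable_planeWave_mul _ _) ?_ ?_ ?_ ?_
  · refine h.2.congr_deriv ?_
    simp only [mul_add]
    have e1 : ∀ k : ℝ, planeWave (p s) (q s) k * (p' s * (Complex.I * (k * g k)))
        = (p' s * Complex.I) * (planeWave (p s) (q s) k * (k * g k)) := fun k => by ring
    have e2 : ∀ k : ℝ, planeWave (p s) (q s) k * (q' s * (-(Complex.I / 2) * (k * (k * g k))))
        = (q' s * -(Complex.I / 2)) * (planeWave (p s) (q s) k * (k * (k * g k))) := fun k => by ring
    simp only [e1, e2]
    rw [integral_add ((hg.mul_id.integrable_planeWave_mul _ _).const_mul _)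
      ((hg.mul_id.mul_id.integrable_planeWave_mul _ _).const_mul _), integral_const_mul, integral_const_mul]
    simp only [freeWave]
    ring
  · refine ((continuous_planeWave_right _ _).mul ?_).aestronglyMeasurable
    have := hg.1.continuous
    fun_prop
  · refine ae_of_all _ fun k s hs => ?_
    rw [norm_mul, norm_planeWave, one_mul]
    refine (norm_add_le _ _).trans ?_
    have h1 : ‖(-(Complex.I / 2))‖ = 1 / 2 := by simp
    rw [norm_mul, norm_mul Complex.I, norm_mul (q' s : ℂ), norm_mul (-(Complex.I / 2)), h1, Complex.norm_I, one_mul,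
      Complex.norm_real, Complex.norm_real]
    gcongr
    · exact hP s hs
    · exact hR s hs
  · exact (hg.mul_id.integrable.norm.const_mul _).add ((hg.mul_id.mul_id.integrable.norm.const_mul _).const_mul _)
  · refine ae_of_all _ fun k s _ => ?_
    have h1 : HasDerivAt (fun s => p s * k - q s * k ^ 2 / 2) (p' s * k - q' s * k ^ 2 / 2 : ℝ) s :=
      ((hp s).mul_const k).fun_sub (((hq s).mul_const _).div_const _)
    refine (((h1.ofReal_comp.const_mul Complex.I).cexp).mul_const (g k)).congr_deriv ?_
    simp only [planeWave]
    push_cast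
    ring

theorem IsTest.mul_freeWave {g : ℝ → ℂ} (hg : IsTest g) (y t : ℝ) :
    (y : ℂ) * freeWave g y t
      = Complex.I * freeWave (deriv g) y t + t * freeWave (fun k => (k : ℂ) * g k) y t := by
  have hd : ∀ k, HasDerivAt (fun k => planeWave y t k * g k)
      ((Complex.I * y) * (planeWave y t k * g k) - (Complex.I * t) * (planeWave y t k * (k * g k))
        + planeWave y t k * deriv g k) k := fun k => by
    have h1 : HasDerivAt (fun k : ℝ => y * k - t * k ^ 2 / 2) (y - t * k) k := by
      refine (((hasDerivAt_id k).const_mul y).fun_sub ((((hasDerivAt_id k).fun_pow 2).const_mul t).div_const 2)).congr_deriv ?_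
      simp
      ring
    refine (((h1.ofReal_comp.const_mul Complex.I).cexp).fun_mul (hg.hasDerivAt k)).congr_deriv ?_
    simp only [planeWave]
    push_cast
    ring
  have i1 := (hg.integrable_planeWave_mul y t).const_mul (Complex.I * y)
  have i2 := (hg.mul_id.integrable_planeWave_mul y t).const_mul (Complex.I * t)
  have i3 := hg.derivative.integrable_planeWave_mul y t
  have h0 := integral_eq_zero_of_hasDerivAt_of_integrable hd ((i1.sub i2).add i3) (hg.integrable_planeWave_mul y t)
  rw [integral_add (by exact i1.sub i2) i3, integral_sub i1 i2, integral_const_mul, integral_const_mul] at h0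
  simp only [freeWave]
  linear_combination (-Complex.I) * h0 + ((∫ k, planeWave y t k * g k) * y
    - t * (∫ k, planeWave y t k * (k * g k))) * Complex.I_mul_I

theorem IsTest.pow_mul_freeWave_le {g : ℝ → ℂ} (hg : IsTest g) (a : ℕ) :
    ∃ C, 0 ≤ C ∧ ∀ y t, |y| ^ a * ‖freeWave g y t‖ ≤ C * (1 + |t|) ^ a := by
  induction a generalizing g with
  | zero => exact ⟨∫ k, ‖g k‖, integral_nonneg fun _ => norm_nonneg _, fun y t => by simpa using norm_freeWave_le g y t⟩
  | succ a ih =>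
    obtain ⟨C1, h1, hC1⟩ := ih hg.derivative
    obtain ⟨C2, h2, hC2⟩ := ih hg.mul_id
    refine ⟨C1 + C2, by positivity, fun y t => ?_⟩
    have e := congrArg norm (hg.mul_freeWave y t)
    rw [norm_mul, Complex.norm_real, Real.norm_eq_abs] at e
    rw [pow_succ, mul_assoc, e]
    have h3 := norm_add_le (Complex.I * freeWave (deriv g) y t) (t * freeWave (fun k => (k : ℂ) * g k) y t)
    rw [norm_mul, norm_mul, Complex.norm_I, one_mul, Complex.norm_real, Real.norm_eq_abs] at h3
    have h4 : (0:ℝ) ≤ |t| := abs_nonneg t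
    calc |y| ^ a * _ ≤ |y| ^ a * (‖freeWave (deriv g) y t‖ + |t| * ‖freeWave (fun k => (k : ℂ) * g k) y t‖) := by gcongr
      _ = |y| ^ a * ‖freeWave (deriv g) y t‖ + |t| * (|y| ^ a * ‖freeWave (fun k => (k : ℂ) * g k) y t‖) := by ring
      _ ≤ C1 * (1 + |t|) ^ a + |t| * (C2 * (1 + |t|) ^ a) := by
        exact add_le_add (hC1 y t) (mul_le_mul_of_nonneg_left (hC2 y t) h4)
      _ ≤ (C1 + C2) * (1 + |t|) ^ (a + 1) := by
        rw [pow_succ]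
        have : 0 ≤ (1 + |t|) ^ a := by positivity
        nlinarith [mul_nonneg h1 (mul_nonneg h4 this), mul_nonneg h2 this]

end FreeWave

section TiltedWave

/-- The free wave in the accelerated frame. -/
def tiltedWave (g : ℝ → ℂ) (x t : ℝ) : ℂ := freeWave g (x - t ^ 3 / 6) t

theorem IsTest.continuous_tiltedWave {g : ℝ → ℂ} (hg : IsTest g) : Continuous (uncurry (tiltedWave g)) :=
  hg.continuous_freeWave.comp ((by fun_prop : Continuous fun z : ℝ × ℝ => (z.1 - z.2 ^ 3 / 6, z.2)))

theorem IsTest.hasDerivAt_tiltedWave_fst {g : ℝ → ℂ} (hg : IsTest g) (x t : ℝ) :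
    HasDerivAt (fun y => tiltedWave g y t) (Complex.I * tiltedWave (fun k => (k : ℂ) * g k) x t) x := by
  refine (hg.hasDerivAt_freeWave (p := fun y => y - t ^ 3 / 6) (q := fun _ => t) (p' := fun _ => 1) (q' := fun _ => 0)
    (fun s => (hasDerivAt_id s).sub_const _) (fun s => hasDerivAt_const s t) continuous_const continuous_const x).congr_deriv ?_
  simp [tiltedWave]

theorem IsTest.hasDerivAt_tiltedWave_snd {g : ℝ → ℂ} (hg : IsTest g) (x t : ℝ) :
    HasDerivAt (fun s => tiltedWave g x s)
      (-(Complex.I / 2) * t * t * tiltedWave (fun k => (k : ℂ) * g k) x t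
        + -(Complex.I / 2) * tiltedWave (fun k => (k : ℂ) * ((k : ℂ) * g k)) x t) t := by
  have h1 : ∀ s : ℝ, HasDerivAt (fun s => x - s ^ 3 / 6) (-(s ^ 2 / 2)) s := fun s => by
    refine ((((hasDerivAt_id s).fun_pow 3).div_const 6).const_sub x).congr_deriv ?_
    simp
    ring
  refine (hg.hasDerivAt_freeWave h1 (fun s => hasDerivAt_id s) (by fun_prop) continuous_const t).congr_deriv ?_
  simp only [tiltedWave, id]
  push_cast
  ring

theorem IsTest.rapidX_tiltedWave {g : ℝ → ℂ} (hg : IsTest g) : RapidX (tiltedWave g) := fun a A => by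
  obtain ⟨C, hC, h⟩ := hg.pow_mul_freeWave_le a
  obtain ⟨B, hBd⟩ : ∃ B : ℝ, B = |A| ^ 3 / 6 := ⟨_, rfl⟩
  refine ⟨2 ^ (a - 1) * (C * (1 + |A|) ^ a + B ^ a * ∫ k, ‖g k‖), fun x t hx ht => ?_⟩
  have hA : |t| ≤ |A| := ht.trans (le_abs_self A)
  have h0 : |t ^ 3 / 6| ≤ B := by
    rw [abs_div, abs_pow, abs_of_pos (by norm_num : (0:ℝ) < 6), hBd]
    gcongr
  have h1 : x ≤ |x - t ^ 3 / 6| + B := by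
    have h2 := le_abs_self (x - t ^ 3 / 6)
    have h3 := le_abs_self (t ^ 3 / 6)
    linarith
  have hB : 0 ≤ B := (abs_nonneg _).trans h0
  calc x ^ a * ‖tiltedWave g x t‖ ≤ (2 ^ (a - 1) * (|x - t ^ 3 / 6| ^ a + B ^ a)) * ‖tiltedWave g x t‖ := by
        gcongr
        exact (pow_le_pow_left₀ (by linarith) h1 a).trans (add_pow_le (abs_nonneg _) hB a)
    _ = 2 ^ (a - 1) * (|x - t ^ 3 / 6| ^ a * ‖tiltedWave g x t‖ + B ^ a * ‖tiltedWave g x t‖) := by ring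
    _ ≤ _ := by
        refine mul_le_mul_of_nonneg_left (add_le_add ((h _ _).trans (by gcongr)) ?_) (by positivity)
        exact mul_le_mul_of_nonneg_left (norm_freeWave_le _ _ _) (by positivity)

theorem IsTest.smoothClass_tiltedWave {g : ℝ → ℂ} (hg : IsTest g) (n : ℕ) : SmoothClass RapidX n (tiltedWave g) := by
  induction n generalizing g with
  | zero => exact ⟨hg.continuous_tiltedWave.continuousOn, hg.rapidX_tiltedWave⟩
  | succ n ih =>
    have hc := fun c => smoothClass_const c n
    have ht := smoothClass_snd n
    exact ⟨⟨hg.continuous_tiltedWave.continuousOn, hg.rapidX_tiltedWave⟩, _, _, (hc _).polyMulRapid (ih hg.mul_id),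
      ((((hc _).polyMul ht).polyMul ht).polyMulRapid (ih hg.mul_id)).rapidAdd ((hc _).polyMulRapid (ih hg.mul_id.mul_id)),
      fun x t _ => (hg.hasDerivAt_tiltedWave_fst x t).hasDerivWithinAt, fun x t _ => hg.hasDerivAt_tiltedWave_snd x t⟩

/-- The algebra of functions of time generated by traces of free waves on the boundary. -/
inductive BoundaryTrace : (ℝ → ℂ) → Prop
  | base {g : ℝ → ℂ} (hg : IsTest g) : BoundaryTrace fun t => tiltedWave g 0 t
  | add {u v : ℝ → ℂ} (hu : BoundaryTrace u) (hv : BoundaryTrace v) : BoundaryTrace fun t => u t + v t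
  | const_mul {u : ℝ → ℂ} (c : ℂ) (hu : BoundaryTrace u) : BoundaryTrace fun t => c * u t
  | time_mul {u : ℝ → ℂ} (hu : BoundaryTrace u) : BoundaryTrace fun t => (t : ℂ) * u t

theorem BoundaryTrace.exists_hasDerivAt {u : ℝ → ℂ} (hu : BoundaryTrace u) :
    ∃ v, BoundaryTrace v ∧ ∀ t, HasDerivAt u (v t) t := by
  induction hu with
  | base hg =>
    refine ⟨_, .add (.const_mul (-(Complex.I / 2)) (.time_mul (.time_mul (.base hg.mul_id))))
      (.const_mul (-(Complex.I / 2)) (.base hg.mul_id.mul_id)), fun t => (hg.hasDerivAt_tiltedWave_snd 0 t).congr_deriv ?_⟩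
    ring
  | add _ _ ih1 ih2 =>
    obtain ⟨v1, h1, h1'⟩ := ih1
    obtain ⟨v2, h2, h2'⟩ := ih2
    exact ⟨_, h1.add h2, fun t => (h1' t).fun_add (h2' t)⟩
  | const_mul c _ ih =>
    obtain ⟨v, h, h'⟩ := ih
    exact ⟨_, h.const_mul c, fun t => (h' t).const_mul c⟩
  | time_mul hu ih =>
    obtain ⟨v, h, h'⟩ := ih
    refine ⟨_, hu.add h.time_mul, fun t => ((Complex.ofRealCLM.hasDerivAt (x := t)).fun_mul (h' t)).congr_deriv ?_⟩
    simp

theorem IsTest.rapidFam_trace {g : ℝ → ℂ} (hg : IsTest g) :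
    RapidFam fun (_ : Unit) t => ‖tiltedWave g 0 t‖ := fun N M => by
  obtain ⟨C, hC, h⟩ := hg.pow_mul_freeWave_le N
  set J := ∫ k, ‖g k‖
  have hJ : 0 ≤ J := integral_nonneg fun _ => norm_nonneg _
  refine ⟨2 ^ N * J + 2 ^ N * (12 ^ N * C), fun _ t _ => ?_⟩
  rw [abs_norm]
  have hb : ‖tiltedWave g 0 t‖ ≤ J := norm_freeWave_le _ _ _
  rcases le_total |t| 1 with h1 | h1
  · have h2 : 1 + t ^ 2 ≤ 2 := by
      have := (sq_le_one_iff_abs_le_one t).2 h1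
      linarith
    have : (1 + t ^ 2) ^ N * ‖tiltedWave g 0 t‖ ≤ 2 ^ N * J := by gcongr
    have : (0:ℝ) ≤ 2 ^ N * (12 ^ N * C) := by positivity
    linarith
  · have h2 : 1 + t ^ 2 ≤ 2 * |t| ^ 2 := by
      have := one_le_pow₀ h1 (n := 2)
      rw [sq_abs] at *
      linarith
    have h3 : |0 - t ^ 3 / 6| = |t| ^ 2 * |t| / 6 := by
      rw [zero_sub, abs_neg, abs_div, abs_pow, abs_of_pos (by norm_num : (0:ℝ) < 6)]
      ring
    have h4 := h (0 - t ^ 3 / 6) t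
    rw [h3] at h4
    have h5 : (0:ℝ) < |t| ^ N := by positivity
    have h6 : (|t| ^ 2) ^ N * ‖tiltedWave g 0 t‖ ≤ 12 ^ N * C := by
      have h7 : (1 + |t|) ^ N ≤ (2 * |t|) ^ N := by gcongr; linarith
      have h8 := h4.trans (mul_le_mul_of_nonneg_left h7 hC)
      rw [div_pow, mul_pow, mul_pow] at h8
      rw [show (12:ℝ) = 2 * 6 by norm_num, mul_pow]
      change (|t| ^ 2) ^ N * |t| ^ N / 6 ^ N * ‖tiltedWave g 0 t‖ ≤ _ at h8
      rw [div_mul_eq_mul_div, div_le_iff₀ (by positivity)] at h8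
      refine le_of_mul_le_mul_right ?_ h5
      linarith
    calc (1 + t ^ 2) ^ N * ‖tiltedWave g 0 t‖ ≤ (2 * |t| ^ 2) ^ N * ‖tiltedWave g 0 t‖ := by gcongr
      _ = 2 ^ N * ((|t| ^ 2) ^ N * ‖tiltedWave g 0 t‖) := by rw [mul_pow]; ring
      _ ≤ 2 ^ N * (12 ^ N * C) := by gcongr
      _ ≤ _ := by
        have : 0 ≤ 2 ^ N * J := by positivity
        linarith

theorem BoundaryTrace.rapidFam {u : ℝ → ℂ} (hu : BoundaryTrace u) : RapidFam fun (_ : Unit) t => ‖u t‖ := by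
  induction hu with
  | base hg => exact hg.rapidFam_trace
  | add _ _ ih1 ih2 =>
    refine (ih1.add ih2).mono fun _ t => ?_
    rw [abs_norm]
    exact (norm_add_le _ _).trans (le_abs_self _)
  | const_mul c _ ih =>
    refine (ih.const_mul ‖c‖).mono fun _ t => ?_
    rw [norm_mul]
  | time_mul hu ih =>
    refine (ih.poly_mul (fun t => t) 1 1 fun t => ?_).mono fun _ t => ?_
    · rw [one_mul, pow_one]
      nlinarith [sq_nonneg (|t| - 1), sq_abs t]
    · rw [norm_mul, Complex.norm_real, abs_mul, abs_mul, Real.norm_eq_abs, abs_abs]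

end TiltedWave

section Dispersion

open FourierTransform in
theorem IsTest.exists_fourier {g : ℝ → ℂ} (hg : IsTest g) :
    ∃ u : ℝ → ℂ, Integrable u ∧ Integrable (fun w => w ^ 2 * ‖u w‖) ∧ 𝓕 g = u ∧
      ∀ η : ℝ, ∫ w : ℝ, Complex.exp (2 * Real.pi * Complex.I * η * w) * u w = g η := by
  let f : SchwartzMap ℝ ℂ := hg.2.toSchwartzMap hg.1
  have hf : (f : ℝ → ℂ) = g := rfl
  have hu : 𝓕 g = (𝓕 f : SchwartzMap ℝ ℂ) := by rw [SchwartzMap.fourier_coe, hf]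
  refine ⟨(𝓕 f : SchwartzMap ℝ ℂ), SchwartzMap.integrable _, ?_, hu, fun η => ?_⟩
  · simpa using SchwartzMap.integrable_pow_mul volume (𝓕 f : SchwartzMap ℝ ℂ) 2
  · have h1 : 𝓕⁻ (𝓕 g) η = g η := hg.integrable.fourierInv_fourier_eq
      (by rw [hu]; exact SchwartzMap.integrable _) hg.1.continuous.continuousAt
    rw [Real.fourierInv_eq', hu] at h1
    rw [← h1]
    refine integral_congr_ae (ae_of_all _ fun w => ?_)
    simp only [smul_eq_mul, RCLike.inner_apply, conj_trivial]
    congr 2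
    push_cast
    ring

open FourierTransform in
theorem gaussian_fourier_flip {g u : ℝ → ℂ} (hg : Integrable g) (hu : 𝓕 g = u) {b : ℂ} (hb : 0 < b.re) (η : ℝ) :
    1 / b ^ (1 / 2 : ℂ) * ∫ k : ℝ, Complex.exp (-Real.pi / b * (k - η) ^ 2) * g k
      = ∫ w : ℝ, Complex.exp (-Real.pi * b * w ^ 2) * (Complex.exp (2 * Real.pi * Complex.I * η * w) * u w) := by
  have hJ : Integrable fun w : ℝ => Complex.exp (-Real.pi * b * w ^ 2 + 2 * Real.pi * (Complex.I * η) * w) := by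
    have h1 : (-Real.pi * b).re < 0 := by
      have := mul_pos Real.pi_pos hb
      simpa using this
    simpa using integrable_cexp_quadratic' h1 (2 * Real.pi * (Complex.I * η)) 0
  have h := VectorFourier.integral_fourierIntegral_smul_eq_flip (L := innerₗ ℝ) (μ := volume) (ν := volume)
    Real.continuous_fourierChar continuous_inner hJ hg
  have h2 := fourier_gaussian_pi' hb (Complex.I * η)
  rw [← integral_const_mul]
  have e1 : (∫ k : ℝ, 1 / b ^ (1 / 2 : ℂ) * (Complex.exp (-Real.pi / b * (k - η) ^ 2) * g k))
      = ∫ k : ℝ, (𝓕 fun w : ℝ => Complex.exp (-Real.pi * b * w ^ 2 + 2 * Real.pi * (Complex.I * η) * w)) k • g k := by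
    refine integral_congr_ae (ae_of_all _ fun k => ?_)
    beta_reduce
    rw [h2, smul_eq_mul, ← mul_assoc]
    congr 4
    rw [← mul_assoc, Complex.I_mul_I]
    ring
  have e2 : (∫ w : ℝ, Complex.exp (-Real.pi * b * w ^ 2) * (Complex.exp (2 * Real.pi * Complex.I * η * w) * u w))
      = ∫ w : ℝ, Complex.exp (-Real.pi * b * w ^ 2 + 2 * Real.pi * (Complex.I * η) * w) • 𝓕 g w := by
    refine integral_congr_ae (ae_of_all _ fun k => ?_)
    beta_reduce
    rw [hu, smul_eq_mul, ← mul_assoc, ← Complex.exp_add]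
    congr 3
    ring
  rw [e1, e2]
  simpa using! h

open FourierTransform in
theorem fresnel_fourier_flip {g u : ℝ → ℂ} (hg : Integrable g) (hui : Integrable u) (hu : 𝓕 g = u) {b : ℂ}
    (hb : b.re = 0) (hb0 : b ≠ 0) (η : ℝ) :
    1 / b ^ (1 / 2 : ℂ) * ∫ k : ℝ, Complex.exp (-Real.pi / b * (k - η) ^ 2) * g k
      = ∫ w : ℝ, Complex.exp (-Real.pi * b * w ^ 2) * (Complex.exp (2 * Real.pi * Complex.I * η * w) * u w) := by
  have hbs : b ∈ Complex.slitPlane := by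
    refine Or.inr fun h => hb0 (Complex.ext hb h)
  have hlim : Tendsto (fun ε : ℝ => (ε : ℂ) + b) (nhdsWithin 0 (Ioi 0)) (nhds b) := by
    have h : Continuous fun ε : ℝ => (ε : ℂ) + b := by fun_prop
    have := h.tendsto 0
    simp only [Complex.ofReal_zero, zero_add] at this
    exact this.mono_left nhdsWithin_le_nhds
  have hre : ∀ᶠ ε : ℝ in nhdsWithin 0 (Ioi 0), 0 < ((ε : ℂ) + b).re := by
    filter_upwards [self_mem_nhdsWithin] with ε hε
    simpa [hb] using hε
  have hsq : ∀ {z : ℂ} (x : ℝ), 0 < z.re → ‖Complex.exp (-Real.pi * z * x ^ 2)‖ ≤ 1 := fun {z} x hz => by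
    rw [Complex.norm_exp, Real.exp_le_one_iff]
    have h1 : (-Real.pi * z * x ^ 2 : ℂ).re = -(Real.pi * z.re * x ^ 2) := by
      rw [show (-Real.pi * z * x ^ 2 : ℂ) = ((-Real.pi * x ^ 2 : ℝ) : ℂ) * z by push_cast; ring, Complex.re_ofReal_mul]
      ring
    rw [h1, neg_nonpos]
    have := Real.pi_pos
    positivity
  have hinv : ∀ {z : ℂ}, 0 < z.re → 0 < (z⁻¹).re := fun {z} hz => by
    rw [Complex.inv_re]
    exact div_pos hz (Complex.normSq_pos.2 fun h => by simp [h] at hz)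
  have hL : Tendsto (fun ε : ℝ => 1 / ((ε : ℂ) + b) ^ (1 / 2 : ℂ) *
      ∫ k : ℝ, Complex.exp (-Real.pi / ((ε : ℂ) + b) * (k - η) ^ 2) * g k) (nhdsWithin 0 (Ioi 0))
      (nhds (1 / b ^ (1 / 2 : ℂ) * ∫ k : ℝ, Complex.exp (-Real.pi / b * (k - η) ^ 2) * g k)) := by
    refine Tendsto.mul ?_ ?_
    · refine Tendsto.div tendsto_const_nhds ?_ ?_
      · exact (continuousAt_id.cpow continuousAt_const hbs).tendsto.comp hlim
      · simp [Complex.cpow_eq_zero_iff, hb0]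
    · refine tendsto_integral_filter_of_dominated_convergence (fun k => ‖g k‖) (.of_forall fun ε => ?_) ?_ hg.norm ?_
      · exact (Continuous.aestronglyMeasurable (by fun_prop)).mul hg.aestronglyMeasurable
      · filter_upwards [hre] with ε hε
        refine ae_of_all _ fun k => ?_
        rw [norm_mul]
        refine mul_le_of_le_one_left (norm_nonneg _) ?_
        have := hsq (k - η) (hinv hε)
        push_cast at this
        rwa [← div_eq_mul_inv] at this
      · refine ae_of_all _ fun k => Tendsto.mul_const _ ?_
        exact ((tendsto_const_nhds.div hlim hb0).mul_const _).cexp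
  have hR : Tendsto (fun ε : ℝ => ∫ w : ℝ, Complex.exp (-Real.pi * ((ε : ℂ) + b) * w ^ 2) *
      (Complex.exp (2 * Real.pi * Complex.I * η * w) * u w)) (nhdsWithin 0 (Ioi 0))
      (nhds (∫ w : ℝ, Complex.exp (-Real.pi * b * w ^ 2) * (Complex.exp (2 * Real.pi * Complex.I * η * w) * u w))) := by
    refine tendsto_integral_filter_of_dominated_convergence (fun k => ‖u k‖) (.of_forall fun ε => ?_) ?_ hui.norm ?_
    · exact (Continuous.aestronglyMeasurable (by fun_prop)).mul
        ((Continuous.aestronglyMeasurable (by fun_prop)).mul hui.aestronglyMeasurable)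
    · filter_upwards [hre] with ε hε
      refine ae_of_all _ fun w => ?_
      rw [norm_mul, norm_mul]
      have h1 : ‖Complex.exp (2 * Real.pi * Complex.I * η * w)‖ = 1 := by
        rw [show (2 * Real.pi * Complex.I * η * w : ℂ) = ((2 * Real.pi * η * w : ℝ) : ℂ) * Complex.I by push_cast; ring]
        exact Complex.norm_exp_ofReal_mul_I _
      rw [h1, one_mul]
      exact mul_le_of_le_one_left (norm_nonneg _) (hsq w hε)
    · exact ae_of_all _ fun k => Tendsto.mul_const _ (((tendsto_const_nhds.mul hlim).mul_const _).cexp)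
  refine tendsto_nhds_unique hL (hR.congr' ?_)
  filter_upwards [hre] with ε hε
  exact (gaussian_fourier_flip hg hu hε η).symm

end Dispersion

section Focusing

/-- The normalisation of the Fresnel integral. -/
def fresnelConst : ℂ := 1 / (-2 * Real.pi * Complex.I) ^ (1 / 2 : ℂ)

theorem fresnelConst_scale {t : ℝ} (ht : 0 < t) :
    1 / ((t⁻¹ : ℝ) * (-2 * Real.pi * Complex.I)) ^ (1 / 2 : ℂ) = (√t : ℂ) * fresnelConst := by
  have h0 : (-2 * Real.pi * Complex.I : ℂ) ≠ 0 := by simp [Real.pi_ne_zero]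
  have ht' : (0:ℝ) < t⁻¹ := inv_pos.2 ht
  have h1 : ((t⁻¹ : ℝ) : ℂ) * (-2 * Real.pi * Complex.I) ≠ 0 := mul_ne_zero (by exact_mod_cast ht'.ne') h0
  rw [fresnelConst, Complex.cpow_def_of_ne_zero h1, Complex.cpow_def_of_ne_zero h0, Complex.log_ofReal_mul ht' h0,
    add_mul, Complex.exp_add, Real.log_inv, Real.sqrt_eq_rpow, Real.rpow_def_of_pos ht]
  have h2 : ((Real.exp (Real.log t * (1 / 2)) : ℝ) : ℂ) = Complex.exp (Real.log t * (1 / 2)) := by push_cast; rfl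
  have h3 : Complex.exp (((-Real.log t : ℝ) : ℂ) * (1 / 2)) = (Complex.exp (Real.log t * (1 / 2)))⁻¹ := by
    rw [← Complex.exp_neg]; push_cast; ring_nf
  rw [h2, h3]
  field_simp

/-- The phase of the focused free wave along the ray `y = η t`. -/
def rayPhase (η t : ℝ) : ℂ := Complex.exp (Complex.I * ((η ^ 2 * t / 2 : ℝ) : ℂ))

theorem norm_rayPhase (η t : ℝ) : ‖rayPhase η t‖ = 1 := by
  rw [rayPhase, mul_comm, Complex.norm_exp_ofReal_mul_I]

/-- The difference between the rescaled free wave and its stationary phase approximation. -/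
def rayError (g : ℝ → ℂ) (η t : ℝ) : ℂ :=
  √t * fresnelConst * freeWave g (η * t) t - rayPhase η t * g η

theorem IsTest.rayError_le {g : ℝ → ℂ} (hg : IsTest g) :
    ∃ C, 0 ≤ C ∧ ∀ η t, 0 < t → ‖rayError g η t‖ ≤ C / t := by
  obtain ⟨u, hui, hu2, hu, hinv⟩ := hg.exists_fourier
  refine ⟨2 * Real.pi ^ 2 * ∫ w, w ^ 2 * ‖u w‖, mul_nonneg (by positivity)
    (integral_nonneg fun w => by positivity), fun η t ht => ?_⟩
  have ht0 : (t : ℂ) ≠ 0 := by exact_mod_cast ht.ne'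
  have hb0 : ((t⁻¹ : ℝ) : ℂ) * (-2 * Real.pi * Complex.I) ≠ 0 := by simp [Real.pi_ne_zero, ht.ne']
  have key := fresnel_fourier_flip hg.integrable hui hu (b := ((t⁻¹ : ℝ) : ℂ) * (-2 * Real.pi * Complex.I))
    (by rw [Complex.re_ofReal_mul]; simp) hb0 η
  rw [fresnelConst_scale ht] at key
  have hfw : freeWave g (η * t) t = rayPhase η t * ∫ k : ℝ,
      Complex.exp (-Real.pi / (((t⁻¹ : ℝ) : ℂ) * (-2 * Real.pi * Complex.I)) * (k - η) ^ 2) * g k := by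
    rw [freeWave, ← integral_const_mul]
    refine integral_congr_ae (ae_of_all _ fun k => ?_)
    simp only [planeWave, rayPhase]
    rw [← mul_assoc, ← Complex.exp_add]
    congr 2
    have hpi : (Real.pi : ℂ) ≠ 0 := by exact_mod_cast Real.pi_ne_zero
    have h2 : (-Real.pi / (((t⁻¹ : ℝ) : ℂ) * (-2 * Real.pi * Complex.I)) : ℂ) = -(Complex.I * t / 2) := by
      rw [div_eq_iff hb0]
      push_cast
      field_simp
      rw [Complex.I_sq]
    rw [h2]
    push_cast
    ring
  set E : ℝ → ℂ := fun w => Complex.exp (2 * Real.pi * Complex.I * η * w) * u w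
  have hE : ∀ w : ℝ, ‖E w‖ = ‖u w‖ := fun w => by
    simp only [E]
    rw [norm_mul, show (2 * Real.pi * Complex.I * η * w : ℂ) = ((2 * Real.pi * η * w : ℝ) : ℂ) * Complex.I by push_cast; ring,
      Complex.norm_exp_ofReal_mul_I, one_mul]
  have hEi : Integrable E := hui.norm.mono' ((Continuous.aestronglyMeasurable (by fun_prop)).mul hui.aestronglyMeasurable)
    (ae_of_all _ fun w => (hE w).le)
  have hphase : ∀ w : ℝ, (-Real.pi * (((t⁻¹ : ℝ) : ℂ) * (-2 * Real.pi * Complex.I)) * w ^ 2 : ℂ)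
      = Complex.I * ((2 * Real.pi ^ 2 * w ^ 2 / t : ℝ) : ℂ) := fun w => by
    push_cast
    field_simp
  have hFi : Integrable fun w : ℝ => Complex.exp (-Real.pi * (((t⁻¹ : ℝ) : ℂ) * (-2 * Real.pi * Complex.I)) * w ^ 2) * E w := by
    refine hui.norm.mono' ((Continuous.aestronglyMeasurable (by fun_prop)).mul hEi.aestronglyMeasurable) (ae_of_all _ fun w => ?_)
    rw [norm_mul, hphase, mul_comm Complex.I, Complex.norm_exp_ofReal_mul_I, one_mul, hE]
  have hR : rayError g η t = rayPhase η t * ∫ w : ℝ,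
      (Complex.exp (-Real.pi * (((t⁻¹ : ℝ) : ℂ) * (-2 * Real.pi * Complex.I)) * w ^ 2) * E w - E w) := by
    rw [rayError, hfw, integral_sub hFi hEi, ← key, hinv η]
    ring
  rw [hR, norm_mul, norm_rayPhase, one_mul]
  calc _ ≤ ∫ w : ℝ, 2 * Real.pi ^ 2 / t * (w ^ 2 * ‖u w‖) := by
        refine norm_integral_le_of_norm_le (hu2.const_mul _) (ae_of_all _ fun w => ?_)
        rw [← sub_one_mul, norm_mul, hE, hphase]
        refine (mul_le_mul_of_nonneg_right Real.norm_exp_I_mul_ofReal_sub_one_le (norm_nonneg _)).trans_eq ?_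
        rw [Real.norm_of_nonneg (by positivity)]
        ring
    _ = _ := by rw [integral_const_mul]; ring

theorem IsTest.mul_rayError_le {g : ℝ → ℂ} (hg : IsTest g) :
    ∃ C, 0 ≤ C ∧ ∀ η t, 1 ≤ t → (1 + |η|) * ‖rayError g η t‖ ≤ C / t := by
  obtain ⟨C1, h1, hC1⟩ := hg.rayError_le
  obtain ⟨C2, h2, hC2⟩ := hg.mul_id.rayError_le
  obtain ⟨C3, h3, hC3⟩ := hg.derivative.rayError_le
  obtain ⟨M, hM⟩ := hg.derivative.2.exists_bound_of_continuous hg.derivative.1.continuous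
  refine ⟨C1 + (C2 + (C3 + |M|)), by positivity, fun η t ht => ?_⟩
  have htp : 0 < t := by linarith
  have ht0 : (t : ℂ) ≠ 0 := by exact_mod_cast htp.ne'
  have e : (η : ℂ) * rayError g η t = rayError (fun k => (k : ℂ) * g k) η t
      + (t⁻¹ : ℝ) * (Complex.I * (rayError (deriv g) η t + rayPhase η t * deriv g η)) := by
    have h := hg.mul_freeWave (η * t) t
    simp only [rayError]
    push_cast at h ⊢
    field_simp
    linear_combination (√t * fresnelConst) * h
  have hb : ‖(η : ℂ) * rayError g η t‖ ≤ C2 / t + t⁻¹ * (C3 + |M|) := by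
    rw [e]
    refine (norm_add_le _ _).trans (add_le_add (hC2 η t htp) ?_)
    rw [norm_mul, norm_mul, Complex.norm_I, one_mul, Complex.norm_real, Real.norm_of_nonneg (by positivity)]
    refine mul_le_mul_of_nonneg_left ((norm_add_le _ _).trans (add_le_add ((hC3 η t htp).trans (div_le_self h3 ht)) ?_)) (by positivity)
    rw [norm_mul, norm_rayPhase, one_mul]
    exact (hM η).trans (le_abs_self M)
  rw [norm_mul, Complex.norm_real, Real.norm_eq_abs] at hb
  have := hC1 η t htp
  calc _ = ‖rayError g η t‖ + |η| * ‖rayError g η t‖ := by ring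
    _ ≤ C1 / t + (C2 / t + t⁻¹ * (C3 + |M|)) := add_le_add this hb
    _ = _ := by ring

theorem IsTest.tiltedWave_sub_searchlight {g : ℝ → ℂ} {t : ℝ} (ht : 0 < t) (x : ℝ) :
    framePhase x t * (fresnelConst * tiltedWave g x t) - searchlight g x t
      = framePhase x t * ((√t)⁻¹ : ℝ) * rayError g (x / t - t ^ 2 / 6) t := by
  obtain ⟨η, hη⟩ : ∃ η, η = x / t - t ^ 2 / 6 := ⟨_, rfl⟩
  have hx : x = η * t + t ^ 3 / 6 := by rw [hη]; field_simp; ring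
  have hy : x - t ^ 3 / 6 = η * t := by rw [hx]; ring
  have hs : (√t : ℂ) ≠ 0 := by exact_mod_cast (Real.sqrt_pos.2 ht).ne'
  rw [searchlight, tiltedWave, rayError, ← hη, hy, rayPhase, framePhase, mul_sub]
  have h1 : Complex.exp (Complex.I * ((7 / 120) * (t : ℂ) ^ 5 + (η : ℂ) * (t : ℂ) ^ 3 / 2 + (η : ℂ) ^ 2 * (t : ℂ) / 2))
      = Complex.exp (Complex.I * (x * t ^ 2 / 2 - t ^ 5 / 40)) * Complex.exp (Complex.I * ((η ^ 2 * t / 2 : ℝ) : ℂ)) := by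
    rw [← Complex.exp_add]
    congr 1
    rw [hx]
    push_cast
    ring
  rw [h1]
  push_cast
  field_simp

theorem IsTest.tendsto_integral_tiltedWave_sub {g : ℝ → ℂ} (hg : IsTest g) :
    Tendsto (fun t => ∫ x in Ioi (0:ℝ), ‖framePhase x t * (fresnelConst * tiltedWave g x t) - searchlight g x t‖ ^ 2)
      atTop (nhds 0) := by
  obtain ⟨C, hC, h⟩ := hg.mul_rayError_le
  have hlim : Tendsto (fun t : ℝ => C ^ 2 * Real.pi / t ^ 2) atTop (nhds 0) :=
    (tendsto_pow_atTop two_ne_zero).const_div_atTop _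
  refine squeeze_zero' (.of_forall fun t => integral_nonneg fun x => by positivity) ?_ hlim
  filter_upwards [eventually_ge_atTop 1] with t ht
  have htp : 0 < t := by linarith
  have hint : Integrable fun x : ℝ => (1 + (x / t - t ^ 2 / 6) ^ 2)⁻¹ :=
    (integrable_inv_one_add_sq.comp_sub_right (t ^ 2 / 6)).comp_div htp.ne'
  have hval : ∫ x : ℝ, (1 + (x / t - t ^ 2 / 6) ^ 2)⁻¹ = t * Real.pi := by
    rw [Measure.integral_comp_div (fun y => (1 + (y - t ^ 2 / 6) ^ 2)⁻¹) t,
      integral_sub_right_eq_self (fun y : ℝ => (1 + y ^ 2)⁻¹), integral_univ_inv_one_add_sq, abs_of_pos htp, smul_eq_mul]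
  have hpt : ∀ x : ℝ, ‖framePhase x t * (fresnelConst * tiltedWave g x t) - searchlight g x t‖ ^ 2
      ≤ C ^ 2 / t ^ 3 * (1 + (x / t - t ^ 2 / 6) ^ 2)⁻¹ := fun x => by
    rw [IsTest.tiltedWave_sub_searchlight htp, norm_mul, norm_mul, norm_framePhase, one_mul, Complex.norm_real,
      Real.norm_of_nonneg (by positivity), mul_pow, inv_pow, Real.sq_sqrt htp.le]
    have h1 := h (x / t - t ^ 2 / 6) t ht
    generalize x / t - t ^ 2 / 6 = η at h1 ⊢
    have h2 : (1 + |η|) ^ 2 * ‖rayError g η t‖ ^ 2 ≤ C ^ 2 / t ^ 2 := by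
      rw [← mul_pow, ← div_pow]
      exact pow_le_pow_left₀ (by positivity) h1 2
    have h3 : (1 + η ^ 2) * ‖rayError g η t‖ ^ 2 ≤ C ^ 2 / t ^ 2 := by
      refine le_trans (mul_le_mul_of_nonneg_right ?_ (by positivity)) h2
      nlinarith [abs_nonneg η, sq_abs η]
    rw [← div_eq_mul_inv, le_div_iff₀ (by positivity), inv_mul_eq_div, div_mul_eq_mul_div, div_le_iff₀ htp]
    calc _ = (1 + η ^ 2) * ‖rayError g η t‖ ^ 2 := by ring
      _ ≤ _ := h3
      _ = _ := by field_simp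
  calc _ ≤ ∫ x in Ioi (0:ℝ), C ^ 2 / t ^ 3 * (1 + (x / t - t ^ 2 / 6) ^ 2)⁻¹ := by
        refine integral_mono_of_nonneg (ae_of_all _ fun x => by positivity) (hint.const_mul _).integrableOn (ae_of_all _ hpt)
    _ ≤ ∫ x : ℝ, C ^ 2 / t ^ 3 * (1 + (x / t - t ^ 2 / 6) ^ 2)⁻¹ :=
        setIntegral_le_integral (hint.const_mul _) (ae_of_all _ fun x => by positivity)
    _ = _ := by
        rw [integral_const_mul, hval]
        field_simp

end Focusing

section Existence

theorem BoundaryTrace.exists_sequence {u : ℝ → ℂ} (hu : BoundaryTrace u) :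
    ∃ γ : ℕ → ℝ → ℂ, γ 0 = u ∧ (∀ k, BoundaryTrace (γ k)) ∧ ∀ k t, HasDerivAt (γ k) (γ (k + 1) t) t := by
  have hd : ∀ {v : ℝ → ℂ}, BoundaryTrace v → BoundaryTrace (deriv v) ∧ ∀ t, HasDerivAt v (deriv v t) t := fun {v} hv => by
    obtain ⟨w, hw, h⟩ := hv.exists_hasDerivAt
    have : deriv v = w := funext fun t => (h t).deriv
    rw [this]
    exact ⟨hw, h⟩
  have ht : ∀ k, BoundaryTrace (deriv^[k] u) := fun k => by
    induction k with
    | zero => exact hu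
    | succ k ih => rw [iterate_succ_apply']; exact (hd ih).1
  refine ⟨fun k => deriv^[k] u, rfl, ht, fun k t => ?_⟩
  beta_reduce
  rw [iterate_succ_apply']
  exact (hd (ht k)).2 t

theorem IsAdmissible.of_comoving {ϕ ϕx ϕxx ϕt : ℝ → ℝ → ℂ} (hs : ∀ n, SmoothClass RapidX n ϕ)
    (hx : ∀ x t, 0 ≤ x → HasDerivWithinAt (fun y => ϕ y t) (ϕx x t) (Ici 0) x)
    (hxx : ∀ x t, 0 ≤ x → HasDerivWithinAt (fun y => ϕx y t) (ϕxx x t) (Ici 0) x)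
    (ht : ∀ x t, 0 ≤ x → HasDerivAt (fun s => ϕ x s) (ϕt x t) t)
    (heq : ∀ x t, 0 ≤ x → ϕt x t = Complex.I / 2 * ϕxx x t - (t ^ 2 / 2 : ℂ) * ϕx x t)
    (h0 : ∀ t, ϕ 0 t = 0) : IsAdmissible fun x t => framePhase x t * ϕ x t where
  smooth := contDiffOn_infty.2 fun n => ((smoothClass_framePhase n).polyMulRapid (hs n)).contDiffOn
  eqn x t hx0 := by
    have e1 : ∀ x t : ℝ, 0 ≤ x → HasDerivWithinAt (fun y => framePhase y t * ϕ y t)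
        (framePhase x t * (ϕx x t + Complex.I / 2 * t * t * ϕ x t)) (Ici 0) x := fun x t h =>
      ((hasDerivAt_framePhase_fst x t).hasDerivWithinAt.fun_mul (hx x t h)).congr_deriv (by ring)
    have e2 : ∀ x t : ℝ, 0 ≤ x → HasDerivWithinAt
        (fun y => framePhase y t * (ϕx y t + Complex.I / 2 * t * t * ϕ y t))
        (framePhase x t * (ϕxx x t + Complex.I * t * t * ϕx x t
          + (Complex.I * Complex.I) / 4 * t ^ 4 * ϕ x t)) (Ici 0) x := fun x t h =>
      ((hasDerivAt_framePhase_fst x t).hasDerivWithinAt.fun_mul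
        ((hxx x t h).fun_add ((hx x t h).const_mul (Complex.I / 2 * t * t)))).congr_deriv (by ring)
    have e3 : pdT (fun x t => framePhase x t * ϕ x t) x t
        = framePhase x t * (ϕt x t + (Complex.I * x * t + -Complex.I / 8 * t * t * t * t) * ϕ x t) :=
      (((hasDerivAt_framePhase_snd x t).fun_mul (ht x t hx0.le)).congr_deriv (by ring)).deriv
    rw [pdX_pdX_eq e1 e2 hx0, e3, heq x t hx0.le]
    linear_combination (framePhase x t * (ϕxx x t / 2 + (x * t : ℂ) * ϕ x t)) * Complex.I_mul_I
  bc t := by rw [h0, mul_zero]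
  decay α β γ A₁ A₂ _ ε hε :=
    SmoothClass.decay (fun n => (smoothClass_framePhase n).polyMulRapid (hs n)) α β γ A₁ A₂ hε

theorem IsTest.exists_comoving {g : ℝ → ℂ} (hg : IsTest g) :
    ∃ (ϕ W : ℝ → ℝ → ℂ) (v : ℝ → ℂ), IsAdmissible (fun x t => framePhase x t * ϕ x t) ∧
      (∀ x t, ϕ x t = fresnelConst * tiltedWave g x t - v t * (Real.exp (-x) : ℂ) + W x t) ∧
      (∀ t, IntegrableOn (fun x => ‖W x t‖ ^ 2) (Ioi 0)) ∧
      Tendsto (fun t => ∫ x in Ioi (0:ℝ), ‖W x t‖ ^ 2) atTop (nhds 0) ∧ Tendsto (fun t => ‖v t‖) atTop (nhds 0) := by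
  obtain ⟨v, hv0, hvT, hvd⟩ := ((BoundaryTrace.base hg).const_mul fresnelConst).exists_sequence
  obtain ⟨γ, hγ0, hγT, hγd⟩ := ((hvT 1).add (((hvT 0).const_mul (-(Complex.I / 2))).add
    (((hvT 0).time_mul.time_mul).const_mul (-(1 / 2))))).exists_sequence
  obtain ⟨W, V, hW0, hWc, hVc, hWt, hVt, hWx, hVx, hWr, hVr, hlim⟩ :=
    exists_halfline_solution γ hγd fun k => (hγT k).rapidFam
  have hWs := smoothClass_halfline hγd hWc hVc hWt hVt hWx hVx hWr hVr
  have hexp : ∀ x t : ℝ, HasDerivWithinAt (fun y : ℝ => v 0 t * (Real.exp (-y) : ℂ))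
      (-(v 0 t * (Real.exp (-x) : ℂ))) (Ici 0) x := fun x t => by
    have h1 : HasDerivAt (fun y : ℝ => Real.exp (-y)) (Real.exp (-x) * -1) x := (hasDerivAt_neg x).exp
    refine ((h1.ofReal_comp.const_mul (v 0 t)).congr_deriv ?_).hasDerivWithinAt
    push_cast
    ring
  have hV : ∀ x t : ℝ, 0 ≤ x → HasDerivWithinAt (fun y => V 0 y t)
      (-2 * Complex.I * (W 1 x t + ((t ^ 2 / 2 : ℝ) : ℂ) * V 0 x t - γ 0 t * (Real.exp (-x) : ℂ))) (Ici 0) x :=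
    fun x t hx => (hVx 0 x t hx).congr_deriv (by simp)
  refine ⟨fun x t => fresnelConst * tiltedWave g x t + -1 * (v 0 t * (Real.exp (-x) : ℂ)) + W 0 x t, W 0, v 0,
    IsAdmissible.of_comoving
      (ϕx := fun x t => fresnelConst * (Complex.I * tiltedWave (fun k => (k : ℂ) * g k) x t)
        + -1 * (-(v 0 t * (Real.exp (-x) : ℂ))) + V 0 x t)
      (ϕxx := fun x t => fresnelConst * (Complex.I * (Complex.I * tiltedWave (fun k => (k : ℂ) * ((k : ℂ) * g k)) x t))
        + -1 * (- -(v 0 t * (Real.exp (-x) : ℂ)))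
        + -2 * Complex.I * (W 1 x t + ((t ^ 2 / 2 : ℝ) : ℂ) * V 0 x t - γ 0 t * (Real.exp (-x) : ℂ)))
      (ϕt := fun x t => fresnelConst * (-(Complex.I / 2) * t * t * tiltedWave (fun k => (k : ℂ) * g k) x t
          + -(Complex.I / 2) * tiltedWave (fun k => (k : ℂ) * ((k : ℂ) * g k)) x t)
        + -1 * (v 1 t * (Real.exp (-x) : ℂ)) + W 1 x t)
      (fun n => ?_) (fun x t hx => ?_) (fun x t hx => ?_) (fun x t hx => ?_) (fun x t hx => ?_) (fun t => ?_),
    fun x t => by ring, fun t => ?_, hlim, ?_⟩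
  · exact (((smoothClass_const _ n).polyMulRapid (hg.smoothClass_tiltedWave n)).rapidAdd
      ((smoothClass_const (-1) n).polyMulRapid (smoothClass_exp hvd n 0))).rapidAdd (hWs n 0).1
  · exact (((hg.hasDerivAt_tiltedWave_fst x t).const_mul _).hasDerivWithinAt.fun_add ((hexp x t).const_mul _)).fun_add
      (hWx 0 x t hx)
  · exact ((((hg.mul_id.hasDerivAt_tiltedWave_fst x t).const_mul _).const_mul _).hasDerivWithinAt.fun_add
      ((hexp x t).fun_neg.const_mul _)).fun_add (hV x t hx)
  · exact (((hg.hasDerivAt_tiltedWave_snd x t).const_mul _).fun_add (((hvd 0 t).mul_const _).const_mul _)).fun_add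
      (hWt 0 x t)
  · have hγt := congrFun hγ0 t
    rw [hγt]
    push_cast
    generalize Complex.exp (-x) = e
    linear_combination (-(1 / 2) * fresnelConst * Complex.I * tiltedWave (fun k => (k : ℂ) * ((k : ℂ) * g k)) x t
      + W 1 x t + t ^ 2 / 2 * V 0 x t
      - e * (v 1 t - Complex.I / 2 * v 0 t - 1 / 2 * (t * (t * v 0 t)))) * Complex.I_mul_I
  · rw [hW0, congrFun hv0 t]
    simp
  · refine integrableOn_norm_sq_of_decay ?_ ?_
    · exact ((hWc 0).comp (by fun_prop : Continuous fun x : ℝ => (x, t))).continuousOn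
    · obtain ⟨C, hC⟩ := hWr 0 2 |t|
      filter_upwards [eventually_ge_atTop (max 1 C)] with x hx
      have h1 := hC x t ((le_max_left _ _).trans hx) le_rfl
      have hx1 : 1 ≤ x := (le_max_left _ _).trans hx
      have h2 : x ^ 2 * ‖W 0 x t‖ ≤ x := h1.trans ((le_max_right _ _).trans hx)
      refine le_of_mul_le_mul_left ?_ (by linarith : 0 < x)
      linarith
  · exact ((hvT 0).rapidFam.tendsto ())

theorem IsTest.exists_admissible {g : ℝ → ℂ} (hg : IsTest g) :
    ∃ ψ : ℝ → ℝ → ℂ, IsAdmissible ψ ∧ SearchlightLimit ψ g := by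
  obtain ⟨ϕ, W, v, hadm, hϕ, hWi, hW, hv⟩ := hg.exists_comoving
  refine ⟨_, hadm, ?_⟩
  set D : ℝ → ℝ → ℂ := fun x t => framePhase x t * (fresnelConst * tiltedWave g x t) - searchlight g x t
  have hD : Tendsto (fun t => ∫ x in Ioi (0:ℝ), ‖D x t‖ ^ 2) atTop (nhds 0) := hg.tendsto_integral_tiltedWave_sub
  have hsum : Tendsto (fun t => 3 * ((∫ x in Ioi (0:ℝ), ‖D x t‖ ^ 2) + ‖v t‖ ^ 2 * (∫ x in Ioi (0:ℝ), Real.exp (-2 * x))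
      + ∫ x in Ioi (0:ℝ), ‖W x t‖ ^ 2)) atTop (nhds 0) := by
    have := ((hD.add ((hv.pow 2).mul_const (∫ x in Ioi (0:ℝ), Real.exp (-2 * x)))).add hW).const_mul 3
    simpa using this
  have hE : IntegrableOn (fun x : ℝ => Real.exp (-2 * x)) (Ioi 0) := integrableOn_exp_mul_Ioi (by norm_num) 0
  suffices h : Tendsto (fun t => ∫ x in Ioi (0:ℝ), ‖framePhase x t * ϕ x t - searchlight g x t‖ ^ 2) atTop (nhds 0) by
    simpa [SearchlightLimit, L2h] using h.sqrt
  refine (squeeze_zero' (.of_forall fun t => integral_nonneg fun x => by positivity) ?_ hsum)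
  filter_upwards [eventually_gt_atTop 0] with t ht
  have hDi : IntegrableOn (fun x => ‖D x t‖ ^ 2) (Ioi 0) := by
    refine integrableOn_norm_sq_of_decay ?_ ?_
    · have h1 := hg.continuous_tiltedWave.comp (by fun_prop : Continuous fun x : ℝ => (x, t))
      have h2 := continuous_framePhase.comp (by fun_prop : Continuous fun x : ℝ => (x, t))
      exact ((h2.mul (continuous_const.mul h1)).sub (continuous_searchlight hg.1.continuous t)).continuousOn
    · obtain ⟨C, hC⟩ := hg.rapidX_tiltedWave 2 |t|
      filter_upwards [searchlight_eventually_zero hg.2 ht, eventually_ge_atTop (max 1 (‖fresnelConst‖ * C))] with x hx hxC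
      have hx1 : 1 ≤ x := (le_max_left _ _).trans hxC
      have h2 := (le_max_right _ _).trans hxC
      have h3 := mul_le_mul_of_nonneg_left (hC x t hx1 le_rfl) (norm_nonneg fresnelConst)
      simp only [D, hx, sub_zero, norm_mul, norm_framePhase, one_mul]
      refine le_of_mul_le_mul_left ?_ (by linarith : 0 < x)
      linarith
  have hs2 := hDi.add (hE.const_mul (‖v t‖ ^ 2))
  have hs3 := hs2.add (hWi t)
  calc _ ≤ ∫ x in Ioi (0:ℝ), 3 * (‖D x t‖ ^ 2 + ‖v t‖ ^ 2 * Real.exp (-2 * x) + ‖W x t‖ ^ 2) := by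
        refine integral_mono_of_nonneg (ae_of_all _ fun x => by positivity)
          (Integrable.const_mul (by exact hs3) 3) (ae_of_all _ fun x => ?_)
        have e : framePhase x t * ϕ x t - searchlight g x t
            = D x t + (-(framePhase x t * (v t * (Real.exp (-x) : ℂ))) + framePhase x t * W x t) := by
          simp only [D, hϕ]
          ring
        have h1 := norm_add_le (D x t) (-(framePhase x t * (v t * (Real.exp (-x) : ℂ))) + framePhase x t * W x t)
        have h2 := norm_add_le (-(framePhase x t * (v t * (Real.exp (-x) : ℂ)))) (framePhase x t * W x t)
        rw [norm_neg, norm_mul, norm_mul, norm_mul, norm_framePhase, one_mul, one_mul, Complex.norm_real,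
          Real.norm_of_nonneg (Real.exp_pos _).le] at h2
        have h3 : Real.exp (-2 * x) = Real.exp (-x) ^ 2 := by rw [← Real.exp_nat_mul]; push_cast; ring_nf
        beta_reduce
        rw [e, h3, ← mul_pow]
        generalize ‖v t‖ * Real.exp (-x) = b at *
        have h4 := h1.trans (add_le_add_right h2 _)
        refine (pow_le_pow_left₀ (norm_nonneg _) h4 2).trans ?_
        nlinarith [sq_nonneg (‖D x t‖ - b), sq_nonneg (‖D x t‖ - ‖W x t‖), sq_nonneg (b - ‖W x t‖)]
    _ = _ := by
        rw [integral_const_mul, integral_add (by exact hs2) (hWi t), integral_add hDi (hE.const_mul _),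
          integral_const_mul]

end Existence

/-- for every G₀ ∈ C₀^∞(ℝ) there is a unique admissible solution ψ
of the boundary-inflection inner problem with
‖ψ(·,t) − ψ₀⁺(·,t)‖_{L²(0,∞)} → 0 as t → +∞, where ψ₀⁺ is the searchlight ansatz
built from G₀ (uniqueness on the closed half-plane {x ≥ 0}). -/
theorem statement9 (G₀ : ℝ → ℂ) (hsm : ContDiff ℝ (⊤ : ℕ∞) G₀) (hcs : HasCompactSupport G₀) :
    ∃ ψ : ℝ → ℝ → ℂ, (IsAdmissible ψ ∧ SearchlightLimit ψ G₀) ∧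
      ∀ ψ' : ℝ → ℝ → ℂ, IsAdmissible ψ' → SearchlightLimit ψ' G₀ →
        ∀ x t : ℝ, 0 ≤ x → ψ' x t = ψ x t := by
  obtain ⟨ψ, h, hl⟩ := IsTest.exists_admissible ⟨hsm, hcs⟩
  exact ⟨ψ, ⟨h, hl⟩, fun ψ' h' hl' x t hx => h.eq_of_searchlightLimit h' hsm.continuous hcs hl hl' hx⟩
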